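/- arXiv:1603.01018 — 7 statements merged into one kernel-verified Lean document; each statement's English description precedes it below -/
import Mathlib

section
/- Let 𝒮 be a finite seed set with log₂ N ≤ log₂|𝒮| < N/12, and let G : 𝒮 → {-1,1}^N be a random generator whose entries e_n(s) are independent uniform ±1 random variables. Then with probability tending to 1 as N → ∞ one has Φ̃_k(G) < 2·√(N·(k·log N + log C(|𝒮|,k))) for every integer k with 2 ≤ k ≤ N/(6·log₂|𝒮|). -/
/-- The value `±1` associated to a Boolean. -/
def pmVal (b : Bool) : ℤ := if b then 1 else -1

/-- Entry of a binary sequence `E ∈ {-1,1}^N` at (0-based) position `t`,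
defaulting to `1` out of range. -/
def seqAt {N : ℕ} (E : Fin N → Bool) (t : ℕ) : ℤ :=
  if h : t < N then pmVal (E ⟨t, h⟩) else 1

/-- Set of values `|V_{k₁,…,k_ℓ}(E_N(s₁),…,E_N(s_ℓ),M,D)|` over all admissible
parameters: `ℓ ≥ 1`, `k₁,…,k_ℓ ≥ 1` with `k₁ + … + k_ℓ = k`, distinct seeds
`s₁,…,s_ℓ`, `1 ≤ M`, and shifts `0 ≤ dⁱ₁ < … < dⁱ_{kᵢ}` with `M + dⁱ_{kᵢ} ≤ N`. -/
def genCorrSet {S : Type*} {N : ℕ} (k : ℕ) (G : S → Fin N → Bool) : Set ℕ :=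
  {v | ∃ (ℓ : ℕ) (κ : Fin ℓ → ℕ) (s : Fin ℓ → S) (M : ℕ)
        (d : (i : Fin ℓ) → Fin (κ i) → ℕ),
      1 ≤ ℓ ∧ (∀ i, 1 ≤ κ i) ∧ (∑ i, κ i) = k ∧ Function.Injective s ∧
      1 ≤ M ∧ (∀ i, StrictMono (d i)) ∧ (∀ i j, M + d i j ≤ N) ∧
      v = (∑ n ∈ Finset.range M, ∏ i, ∏ j, seqAt (G (s i)) (n + d i j)).natAbs}

/-- The cross-correlation measure `Φ̃ₖ(G)` of order `k` of a generator
`G : 𝒮 → {-1,1}^N`. -/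
noncomputable def genCrossCorr {S : Type*} {N : ℕ} (k : ℕ) (G : S → Fin N → Bool) : ℕ :=
  sSup (genCorrSet k G)

section CrossCorrelation

open Finset

variable {S : Type*} {N : ℕ}

lemma pmVal_not (b : Bool) : pmVal (!b) = -pmVal b := by
  cases b <;> rfl

lemma seqAt_eq_one_or_neg_one (E : Fin N → Bool) (t : ℕ) :
    seqAt E t = 1 ∨ seqAt E t = -1 := by
  unfold seqAt pmVal
  split_ifs <;> simp

/-- The product of the entries of `G` at the positions in `T`, all shifted by `n`. -/
def shiftedProd (T : Finset (S × ℕ)) (G : S → Fin N → Bool) (n : ℕ) : ℤ :=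
  ∏ p ∈ T, seqAt (G p.1) (n + p.2)

lemma shiftedProd_eq_one_or_neg_one (T : Finset (S × ℕ)) (G : S → Fin N → Bool) (n : ℕ) :
    shiftedProd T G n = 1 ∨ shiftedProd T G n = -1 := by
  unfold shiftedProd
  refine Finset.prod_induction _ (fun x : ℤ => x = 1 ∨ x = -1) ?_ (Or.inl rfl)
    fun p _ => seqAt_eq_one_or_neg_one _ _
  rintro a b (rfl | rfl) (rfl | rfl) <;> simp

open Classical in
/-- Flip the entry of `G` at position `t` of the sequence with seed `s`. -/
noncomputable def flipEntry (s : S) (t : ℕ) (G : S → Fin N → Bool) : S → Fin N → Bool :=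
  fun s' t' => if s' = s ∧ (t' : ℕ) = t then !G s' t' else G s' t'

lemma flipEntry_involutive (s : S) (t : ℕ) :
    Function.Involutive (flipEntry s t : (S → Fin N → Bool) → _) := by
  intro G
  funext s' t'
  unfold flipEntry
  split_ifs <;> simp

lemma seqAt_flipEntry_self {t : ℕ} (ht : t < N) (s : S) (G : S → Fin N → Bool) :
    seqAt (flipEntry s t G s) t = -seqAt (G s) t := by
  simp [seqAt, ht, flipEntry, pmVal_not]

lemma seqAt_flipEntry_of_ne {s s' : S} {t t' : ℕ} (h : ¬(s' = s ∧ t' = t))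
    (G : S → Fin N → Bool) : seqAt (flipEntry s t G s') t' = seqAt (G s') t' := by
  unfold seqAt flipEntry
  split_ifs <;> simp_all

lemma shiftedProd_flipEntry_of_forall_ne {T : Finset (S × ℕ)} {s : S} {t n : ℕ}
    (h : ∀ p ∈ T, ¬(p.1 = s ∧ n + p.2 = t)) (G : S → Fin N → Bool) :
    shiftedProd T (flipEntry s t G) n = shiftedProd T G n :=
  Finset.prod_congr rfl fun p hp => seqAt_flipEntry_of_ne (h p hp) G

lemma shiftedProd_flipEntry_of_mem {T : Finset (S × ℕ)} {p : S × ℕ} (hp : p ∈ T) {n : ℕ}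
    (hn : n + p.2 < N) (G : S → Fin N → Bool) :
    shiftedProd T (flipEntry p.1 (n + p.2) G) n = -shiftedProd T G n := by
  classical
  unfold shiftedProd
  rw [← Finset.mul_prod_erase T _ hp, ← Finset.mul_prod_erase T _ hp,
    seqAt_flipEntry_self hn, neg_mul]
  congr 2
  refine Finset.prod_congr rfl fun q hq => seqAt_flipEntry_of_ne ?_ G
  rintro ⟨h1, h2⟩
  exact (Finset.mem_erase.1 hq).1 (Prod.ext h1 (by omega))

lemma exists_mem_forall_snd_le {T : Finset (S × ℕ)} (hT : T.Nonempty) :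
    ∃ p ∈ T, ∀ q ∈ T, q.2 ≤ p.2 :=
  T.exists_max_image Prod.snd hT

lemma sum_exp_shiftedProd [Fintype (S → Fin N → Bool)] {T : Finset (S × ℕ)} (hT : T.Nonempty)
    (c : ℝ) (M : ℕ) (hM : ∀ p ∈ T, M + p.2 ≤ N) :
    ∑ G : S → Fin N → Bool, Real.exp (c * ∑ n ∈ range M, (shiftedProd T G n : ℝ)) =
      Fintype.card (S → Fin N → Bool) * Real.cosh c ^ M := by
  induction M with
  | zero => simp
  | succ M ih =>
    obtain ⟨p, hp, hmax⟩ := exists_mem_forall_snd_le hT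
    have hpN : M + p.2 < N := by have := hM p hp; omega
    have hcosh : ∀ G : S → Fin N → Bool,
        Real.cosh (c * (shiftedProd T G M : ℝ)) = Real.cosh c := by
      intro G
      rcases shiftedProd_eq_one_or_neg_one T G M with h | h <;> simp [h]
    have hflip : ∑ G : S → Fin N → Bool,
          Real.exp (c * ∑ n ∈ range (M + 1), (shiftedProd T G n : ℝ)) =
        ∑ G : S → Fin N → Bool, Real.exp (c * ∑ n ∈ range M, (shiftedProd T G n : ℝ)) *
          Real.exp (-(c * (shiftedProd T G M : ℝ))) := by
      rw [← Equiv.sum_comp (flipEntry_involutive (N := N) p.1 (M + p.2)).toPerm]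
      refine Finset.sum_congr rfl fun G _ => ?_
      rw [Function.Involutive.coe_toPerm, sum_range_succ, mul_add, Real.exp_add,
        shiftedProd_flipEntry_of_mem hp hpN]
      congr 3
      · refine Finset.sum_congr rfl fun n hn => ?_
        rw [shiftedProd_flipEntry_of_forall_ne]
        rintro q hq ⟨-, h⟩
        have := hmax q hq
        have := mem_range.1 hn
        omega
      · push_cast; ring
    have hplain : ∑ G : S → Fin N → Bool,
          Real.exp (c * ∑ n ∈ range (M + 1), (shiftedProd T G n : ℝ)) =
        ∑ G : S → Fin N → Bool, Real.exp (c * ∑ n ∈ range M, (shiftedProd T G n : ℝ)) *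
          Real.exp (c * (shiftedProd T G M : ℝ)) := by
      refine Finset.sum_congr rfl fun G _ => ?_
      rw [sum_range_succ, mul_add, Real.exp_add]
    have hsum : ∑ G : S → Fin N → Bool,
          Real.exp (c * ∑ n ∈ range (M + 1), (shiftedProd T G n : ℝ)) =
        ∑ G : S → Fin N → Bool, Real.exp (c * ∑ n ∈ range M, (shiftedProd T G n : ℝ)) *
          Real.cosh c := by
      have h2 : ∑ G : S → Fin N → Bool, Real.exp (c * ∑ n ∈ range M, (shiftedProd T G n : ℝ)) *
          Real.cosh c = (∑ G : S → Fin N → Bool,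
            Real.exp (c * ∑ n ∈ range M, (shiftedProd T G n : ℝ)) *
              Real.exp (c * (shiftedProd T G M : ℝ)) +
          ∑ G : S → Fin N → Bool, Real.exp (c * ∑ n ∈ range M, (shiftedProd T G n : ℝ)) *
              Real.exp (-(c * (shiftedProd T G M : ℝ)))) / 2 := by
        rw [← Finset.sum_add_distrib, Finset.sum_div]
        refine Finset.sum_congr rfl fun G _ => ?_
        rw [← hcosh G, Real.cosh_eq]
        ring
      linarith
    rw [hsum, ← Finset.sum_mul, ih fun q hq => by have := hM q hq; omega, pow_succ, mul_assoc]

open Classical in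
/-- Hoeffding's inequality for the sums of shifted products. -/
lemma card_le_abs_sum_shiftedProd_le [Fintype (S → Fin N → Bool)] {T : Finset (S × ℕ)}
    (hT : T.Nonempty) {t : ℝ} (ht : 0 ≤ t) (hN : 0 < N) {M : ℕ} (hM : ∀ p ∈ T, M + p.2 ≤ N) :
    (#{G : S → Fin N → Bool | t ≤ |∑ n ∈ range M, (shiftedProd T G n : ℝ)|} : ℝ) ≤
      Fintype.card (S → Fin N → Bool) * (2 * Real.exp (-(t ^ 2 / (2 * N)))) := by
  have hN' : (0 : ℝ) < N := by exact_mod_cast hN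
  have hMN : (M : ℝ) ≤ N := by
    obtain ⟨p, hp⟩ := hT
    have := hM p hp
    exact_mod_cast (by omega : M ≤ N)
  set c : ℝ := t / N with hc
  have hc0 : 0 ≤ c := by positivity
  set V : (S → Fin N → Bool) → ℝ := fun G => ∑ n ∈ range M, (shiftedProd T G n : ℝ) with hV
  have hmgf : ∀ b : ℝ, b ^ 2 = c ^ 2 → ∑ G, Real.exp (b * V G) ≤
      Fintype.card (S → Fin N → Bool) * Real.exp (t ^ 2 / (2 * N)) := by
    intro b hb
    rw [hV, sum_exp_shiftedProd hT b M hM]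
    gcongr
    calc Real.cosh b ^ M ≤ Real.exp (b ^ 2 / 2) ^ M :=
          pow_le_pow_left₀ (Real.cosh_pos b).le (Real.cosh_le_exp_half_sq b) M
      _ = Real.exp (M * (b ^ 2 / 2)) := by rw [← Real.exp_nat_mul]
      _ ≤ Real.exp (N * (b ^ 2 / 2)) := by gcongr
      _ = Real.exp (t ^ 2 / (2 * N)) := by
          rw [hb, hc]; congr 1; field_simp
  have hpoint : (#{G : S → Fin N → Bool | t ≤ |V G|} : ℝ) * Real.exp (c * t) ≤
      ∑ G, Real.exp (c * V G) + ∑ G, Real.exp (-c * V G) := by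
    rw [← Finset.sum_add_distrib, ← nsmul_eq_mul]
    refine (Finset.card_nsmul_le_sum _
      (fun G => Real.exp (c * V G) + Real.exp (-c * V G)) _ ?_).trans
      (Finset.sum_le_sum_of_subset_of_nonneg (Finset.subset_univ _) fun _ _ _ => by positivity)
    intro G hG
    have hG' : t ≤ |V G| := (Finset.mem_filter.1 hG).2
    rcases le_abs.1 hG' with h | h
    · have : Real.exp (c * t) ≤ Real.exp (c * V G) := by gcongr
      linarith [Real.exp_pos (-c * V G)]
    · have : Real.exp (c * t) ≤ Real.exp (-c * V G) := by
        rw [neg_mul, ← mul_neg]; gcongr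
      linarith [Real.exp_pos (c * V G)]
  have h := hpoint.trans (add_le_add (hmgf c rfl) (hmgf (-c) (by ring)))
  have hct : c * t = t ^ 2 / (2 * N) + t ^ 2 / (2 * N) := by rw [hc]; field_simp; ring
  rw [hct, Real.exp_add] at h
  have he := Real.exp_pos (t ^ 2 / (2 * N))
  rw [Real.exp_neg, ← div_eq_mul_inv, mul_div_assoc', le_div_iff₀ he]
  refine le_of_mul_le_mul_right ?_ he
  linarith

lemma exists_shiftedProd_of_mem_genCorrSet [Fintype S] {k v : ℕ} {G : S → Fin N → Bool}
    (hv : v ∈ genCorrSet k G) :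
    ∃ M ∈ range (N + 1), ∃ T ∈ powersetCard k ((univ : Finset S) ×ˢ range N),
      (∀ p ∈ T, M + p.2 ≤ N) ∧
      (v : ℝ) = |∑ n ∈ range M, (shiftedProd T G n : ℝ)| := by
  classical
  obtain ⟨ℓ, κ, s, M, d, hℓ, hκ, hk, hs, hM, hd, hMd, rfl⟩ := hv
  have hinj : Function.Injective fun x : (i : Fin ℓ) × Fin (κ i) => (s x.1, d x.1 x.2) := by
    rintro ⟨i, j⟩ ⟨i', j'⟩ h
    obtain ⟨h1, h2⟩ := Prod.ext_iff.1 h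
    obtain rfl := hs h1
    obtain rfl := (hd i).injective h2
    rfl
  refine ⟨M, ?_, univ.image fun x : (i : Fin ℓ) × Fin (κ i) => (s x.1, d x.1 x.2), ?_, ?_, ?_⟩
  · have := hMd ⟨0, hℓ⟩ ⟨0, hκ _⟩
    exact mem_range.2 (by omega)
  · refine mem_powersetCard.2 ⟨?_, ?_⟩
    · intro p hp
      obtain ⟨x, -, rfl⟩ := mem_image.1 hp
      have := hMd x.1 x.2
      exact mem_product.2 ⟨mem_univ _, mem_range.2 (by dsimp only; omega)⟩
    · rw [card_image_of_injective _ hinj, card_univ, Fintype.card_sigma]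
      simpa using hk
  · intro p hp
    obtain ⟨x, -, rfl⟩ := mem_image.1 hp
    exact hMd x.1 x.2
  · rw [Nat.cast_natAbs, Int.cast_abs, Int.cast_sum]
    congr 1
    refine Finset.sum_congr rfl fun n _ => ?_
    rw [shiftedProd, prod_image fun x _ y _ h => hinj h, ← univ_sigma_univ, prod_sigma]

lemma genCrossCorr_lt {k : ℕ} {G : S → Fin N → Bool} {t : ℝ} (ht : 0 < t)
    (h : ∀ v ∈ genCorrSet k G, (v : ℝ) < t) : (genCrossCorr k G : ℝ) < t := by
  unfold genCrossCorr
  rcases (genCorrSet k G).eq_empty_or_nonempty with he | hne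
  · simpa [he] using ht
  · refine h _ (Nat.sSup_mem hne ⟨⌈t⌉₊, fun v hv => ?_⟩)
    exact_mod_cast (h v hv).le.trans (Nat.le_ceil t)

lemma div_pow_le_choose {q k : ℕ} (hk : 0 < k) (hkq : 6 * k ≤ q) :
    (5 * q / (6 * k) : ℝ) ^ k ≤ q.choose k := by
  have hk' : (0 : ℝ) < k := by exact_mod_cast hk
  have hkq' : (6 : ℝ) * k ≤ q := by exact_mod_cast hkq
  have h1 : (((q + 1 - k : ℕ) : ℝ)) ^ k ≤ k.factorial * q.choose k := by
    exact_mod_cast (q.pow_sub_le_descFactorial k).trans_eq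
      (Nat.descFactorial_eq_factorial_mul_choose q k)
  have h2 : (5 * q / 6 : ℝ) ≤ ((q + 1 - k : ℕ) : ℝ) := by
    rw [Nat.cast_sub (by omega)]
    push_cast
    linarith
  have h3 : (k.factorial : ℝ) ≤ (k : ℝ) ^ k := by exact_mod_cast k.factorial_le_pow
  have h4 : (5 * q / 6 : ℝ) ^ k ≤ (k : ℝ) ^ k * q.choose k :=
    (pow_le_pow_left₀ (by positivity) h2 k).trans (h1.trans (by gcongr))
  have h5 : (5 * q / (6 * k) : ℝ) = (5 * q / 6) / k := by field_simp
  rw [h5, div_pow, div_le_iff₀ (by positivity)]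
  linarith

lemma add_two_pow_four_le (m : ℕ) : (m + 2) ^ 4 ≤ 16 * 25 ^ m := by
  induction m with
  | zero => norm_num
  | succ m ih =>
    have h : (m + 1 + 2) ^ 2 ≤ 5 * (m + 2) ^ 2 := Nat.le.intro (k := 4 * m ^ 2 + 14 * m + 11) (by ring)
    calc (m + 1 + 2) ^ 4 = ((m + 1 + 2) ^ 2) ^ 2 := by ring
      _ ≤ (5 * (m + 2) ^ 2) ^ 2 := Nat.pow_le_pow_left h 2
      _ = 25 * (m + 2) ^ 4 := by ring
      _ ≤ 16 * 25 ^ (m + 1) := by rw [pow_succ 25]; omega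

lemma sq_pow_le_div_pow_four {k : ℕ} (hk : 2 ≤ k) (hkN : 6 * k ≤ N) :
    ((6 * k / (5 * N) : ℝ) ^ 2) ^ k ≤ 34 / (N : ℝ) ^ 4 := by
  obtain ⟨m, rfl⟩ := Nat.exists_eq_add_of_le' hk
  have hN : (0 : ℝ) < N := by exact_mod_cast (by omega : 0 < N)
  have hx : (6 * ((m + 2 : ℕ) : ℝ) / (5 * N)) ≤ 1 / 5 := by
    have : (6 : ℝ) * ((m + 2 : ℕ) : ℝ) ≤ N := by exact_mod_cast hkN
    rw [div_le_div_iff₀ (by positivity) (by norm_num)]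
    linarith
  have hm : (((m + 2 : ℕ) : ℝ)) ^ 4 ≤ 16 * 25 ^ m := by exact_mod_cast add_two_pow_four_le m
  set x : ℝ := 6 * ((m + 2 : ℕ) : ℝ) / (5 * N) with hxdef
  have hx0 : 0 ≤ x := by positivity
  calc (x ^ 2) ^ (m + 2) = x ^ 4 * (x ^ 2) ^ m := by ring
    _ ≤ x ^ 4 * ((1 / 5) ^ 2) ^ m := by gcongr
    _ = (6 / 5) ^ 4 * ((m + 2 : ℕ) : ℝ) ^ 4 / N ^ 4 / 25 ^ m := by
        rw [hxdef]
        norm_num [div_pow, mul_pow]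
        field_simp
    _ ≤ (6 / 5) ^ 4 * (16 * 25 ^ m) / N ^ 4 / 25 ^ m := by gcongr
    _ = ((6 / 5) ^ 4 * 16) / N ^ 4 := by field_simp
    _ ≤ 34 / (N : ℝ) ^ 4 := by gcongr; norm_num

lemma choose_mul_exp_le {q k : ℕ} (hk : 2 ≤ k) (hkN : 6 * k ≤ N) (hNq : N ≤ q) :
    ((q * N).choose k : ℝ) *
      (2 * Real.exp (-(2 * (k * Real.log N + Real.log (q.choose k))))) ≤ 68 / (N : ℝ) ^ 4 := by
  have hN : (0 : ℝ) < N := by exact_mod_cast (by omega : 0 < N)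
  have hq : (0 : ℝ) < q := by exact_mod_cast (by omega : 0 < q)
  have hk0 : (0 : ℝ) < k := by exact_mod_cast (by omega : 0 < k)
  have hNq' : (N : ℝ) ≤ q := by exact_mod_cast hNq
  have hC : (0 : ℝ) < q.choose k := by exact_mod_cast Nat.choose_pos (by omega)
  have hexp : Real.exp (-(2 * (k * Real.log N + Real.log (q.choose k)))) =
      (((N : ℝ) ^ k * q.choose k) ^ 2)⁻¹ := by
    rw [Real.exp_neg, two_mul, Real.exp_add, Real.exp_add, Real.exp_log hC, Real.exp_nat_mul,
      Real.exp_log hN, sq]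
  have h1 : ((q * N).choose k : ℝ) ≤ ((q : ℝ) * N) ^ k := by
    exact_mod_cast Nat.choose_le_pow (q * N) k
  have h2 := div_pow_le_choose (q := q) (k := k) (by omega) (by omega)
  have h3 := sq_pow_le_div_pow_four hk hkN
  rw [hexp]
  calc ((q * N).choose k : ℝ) * (2 * (((N : ℝ) ^ k * q.choose k) ^ 2)⁻¹)
      ≤ ((q : ℝ) * N) ^ k * (2 * (((N : ℝ) ^ k * (5 * q / (6 * k) : ℝ) ^ k) ^ 2)⁻¹) := by
        gcongr
    _ = 2 * (((q : ℝ) * N) * (((N : ℝ) * (5 * q / (6 * k))) ^ 2)⁻¹) ^ k := by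
        rw [mul_pow (q * N : ℝ), inv_pow, ← mul_pow, ← pow_mul, ← pow_mul, mul_comm 2 k]
        ring
    _ ≤ 2 * ((6 * k / (5 * N) : ℝ) ^ 2) ^ k := by
        gcongr
        have : ((q : ℝ) * N) * (((N : ℝ) * (5 * q / (6 * k))) ^ 2)⁻¹ = 36 * k ^ 2 / (25 * N * q : ℝ) := by
          field_simp
          norm_num
        rw [this, div_pow, mul_pow, mul_pow, div_le_div_iff₀ (by positivity) (by positivity)]
        have : (0 : ℝ) ≤ k ^ 2 * N * (q - N) := by
          have := sub_nonneg.2 hNq'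
          positivity
        nlinarith
    _ ≤ 68 / (N : ℝ) ^ 4 := by
        have : (68 : ℝ) / (N : ℝ) ^ 4 = 2 * (34 / (N : ℝ) ^ 4) := by ring
        rw [this]
        gcongr

open Classical in
/-- Union bound over all orders, lengths and shifts. -/
lemma card_exists_le_genCrossCorr [Fintype S] (hN : 2 ≤ N) (hS : N ≤ Fintype.card S) :
    (#{G : S → Fin N → Bool | ∃ k : ℕ, 2 ≤ k ∧ 6 * k ≤ N ∧
      2 * Real.sqrt ((N : ℝ) * (k * Real.log N + Real.log ((Fintype.card S).choose k))) ≤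
        (genCrossCorr k G : ℝ)} : ℝ) ≤
      Fintype.card (S → Fin N → Bool) * (68 / (N : ℝ)) := by
  set q := Fintype.card S with hq
  set L : ℕ → ℝ := fun k => k * Real.log N + Real.log (q.choose k) with hL
  set t : ℕ → ℝ := fun k => 2 * Real.sqrt (N * L k) with ht
  set Ω : ℝ := (Fintype.card (S → Fin N → Bool) : ℝ)
  have hN0 : (0 : ℝ) < N := by exact_mod_cast (by omega : 0 < N)
  have hN2 : (2 : ℝ) ≤ N := by exact_mod_cast hN
  have hLpos : ∀ k, 2 ≤ k → 0 < L k := by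
    intro k hk
    have h1 : 0 < Real.log N := Real.log_pos (by linarith)
    have h2 : 0 ≤ Real.log (q.choose k) := Real.log_natCast_nonneg _
    have h3 : (0 : ℝ) < k := by exact_mod_cast (by omega : 0 < k)
    simp only [hL]
    positivity
  let K : Finset ℕ := {k ∈ range N | 2 ≤ k ∧ 6 * k ≤ N}
  let A : ℕ → ℕ → Finset (S × ℕ) → Finset (S → Fin N → Bool) := fun k M T =>
    {G | (∀ p ∈ T, M + p.2 ≤ N) ∧ t k ≤ |∑ n ∈ range M, (shiftedProd T G n : ℝ)|}
  have hsub : ({G : S → Fin N → Bool | ∃ k : ℕ, 2 ≤ k ∧ 6 * k ≤ N ∧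
      t k ≤ (genCrossCorr k G : ℝ)} : Finset _) ⊆
      K.biUnion fun k => (range (N + 1)).biUnion fun M =>
        (powersetCard k ((univ : Finset S) ×ˢ range N)).biUnion fun T => A k M T := by
    intro G hG
    obtain ⟨k, hk, hkN, hle⟩ := (mem_filter.1 hG).2
    have htk : 0 < t k := by
      have := hLpos k hk
      simp only [ht]
      positivity
    have : ∃ v ∈ genCorrSet k G, t k ≤ (v : ℝ) := by
      by_contra! hcon
      exact absurd (genCrossCorr_lt htk hcon) (not_lt.2 hle)
    obtain ⟨v, hv, htv⟩ := this
    obtain ⟨M, hM, T, hT, hMT, hvT⟩ := exists_shiftedProd_of_mem_genCorrSet hv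
    simp only [mem_biUnion]
    exact ⟨k, mem_filter.2 ⟨mem_range.2 (by omega), hk, hkN⟩, M, hM, T, hT,
      mem_filter.2 ⟨mem_univ _, hMT, hvT ▸ htv⟩⟩
  have hA : ∀ k ∈ K, ∀ M, ∀ T ∈ powersetCard k ((univ : Finset S) ×ˢ range N),
      (#(A k M T) : ℝ) ≤ Ω * (2 * Real.exp (-(2 * L k))) := by
    intro k hk M T hT
    obtain ⟨-, hk2, hkN⟩ := mem_filter.1 hk
    by_cases hMT : ∀ p ∈ T, M + p.2 ≤ N
    · have hTne : T.Nonempty := card_pos.1 (by rw [(mem_powersetCard.1 hT).2]; omega)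
      have := card_le_abs_sum_shiftedProd_le hTne (t := t k) (by positivity) (by omega) hMT
      have hexp : t k ^ 2 / (2 * N) = 2 * L k := by
        simp only [ht]
        rw [mul_pow, Real.sq_sqrt (by have := hLpos k hk2; positivity)]
        field_simp
      rw [hexp] at this
      refine le_trans ?_ this
      refine Nat.cast_le.2 (card_le_card fun G hG => ?_)
      exact mem_filter.2 ⟨mem_univ _, (mem_filter.1 hG).2.2⟩
    · simp only [A, hMT, false_and, filter_false, card_empty, Nat.cast_zero]
      positivity
  have hK : ∀ k ∈ K, ((#((range (N + 1)).biUnion fun M =>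
      (powersetCard k ((univ : Finset S) ×ˢ range N)).biUnion fun T => A k M T) : ℕ) : ℝ) ≤
      Ω * ((N + 1) * (68 / (N : ℝ) ^ 4)) := by
    intro k hk
    obtain ⟨-, hk2, hkN⟩ := mem_filter.1 hk
    have h1 : ∀ M, ((#((powersetCard k ((univ : Finset S) ×ˢ range N)).biUnion
        fun T => A k M T) : ℕ) : ℝ) ≤ Ω * (68 / (N : ℝ) ^ 4) := by
      intro M
      calc ((#((powersetCard k ((univ : Finset S) ×ˢ range N)).biUnion
            fun T => A k M T) : ℕ) : ℝ)
          ≤ ∑ T ∈ powersetCard k ((univ : Finset S) ×ˢ range N), (#(A k M T) : ℝ) := by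
            exact_mod_cast card_biUnion_le
        _ ≤ #(powersetCard k ((univ : Finset S) ×ˢ range N)) •
              (Ω * (2 * Real.exp (-(2 * L k)))) := sum_le_card_nsmul _ _ _ (hA k hk M)
        _ = Ω * (((q * N).choose k : ℝ) * (2 * Real.exp (-(2 * L k)))) := by
            rw [card_powersetCard, card_product, card_range, card_univ, nsmul_eq_mul]
            ring
        _ ≤ Ω * (68 / (N : ℝ) ^ 4) := by
            gcongr
            exact choose_mul_exp_le hk2 hkN hS
    calc _ ≤ ∑ M ∈ range (N + 1), ((#((powersetCard k ((univ : Finset S) ×ˢ range N)).biUnion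
            fun T => A k M T) : ℕ) : ℝ) := by exact_mod_cast card_biUnion_le
      _ ≤ #(range (N + 1)) • (Ω * (68 / (N : ℝ) ^ 4)) :=
          sum_le_card_nsmul _ _ _ fun M _ => h1 M
      _ = _ := by
          rw [card_range, nsmul_eq_mul]
          push_cast
          ring
  calc _ ≤ ((#(K.biUnion fun k => (range (N + 1)).biUnion fun M =>
        (powersetCard k ((univ : Finset S) ×ˢ range N)).biUnion fun T => A k M T) : ℕ) : ℝ) := by
          exact_mod_cast card_le_card hsub
    _ ≤ ∑ k ∈ K, ((#((range (N + 1)).biUnion fun M =>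
        (powersetCard k ((univ : Finset S) ×ˢ range N)).biUnion fun T => A k M T) : ℕ) : ℝ) := by
          exact_mod_cast card_biUnion_le
    _ ≤ #K • (Ω * ((N + 1) * (68 / (N : ℝ) ^ 4))) := sum_le_card_nsmul _ _ _ hK
    _ ≤ N * (Ω * ((N + 1) * (68 / (N : ℝ) ^ 4))) := by
          rw [nsmul_eq_mul]
          gcongr
          exact_mod_cast (card_filter_le _ _).trans_eq (card_range N)
    _ ≤ N * (Ω * ((N * N) * (68 / (N : ℝ) ^ 4))) := by
          gcongr
          nlinarith
    _ = Ω * (68 / (N : ℝ)) := by field_simp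

end CrossCorrelation

/-- If `log₂ N ≤ log₂|𝒮| < N/12`, then with probability tending to `1` as `N → ∞`, a random
generator `G : 𝒮 → {-1,1}^N` (entries independent uniform `±1`) satisfies
`Φ̃ₖ(G) < 2·√(N(k log N + log C(|𝒮|,k)))` for every `k` with `2 ≤ k ≤ N/(6 log₂|𝒮|)`. -/
theorem upper_bound_cross_correlation_large_seed_set :
    ∀ ε : ℝ, 0 < ε → ∃ N₀ : ℕ, ∀ N : ℕ, N₀ ≤ N →
    ∀ (S : Type) [Fintype S],
      Real.logb 2 N ≤ Real.logb 2 (Fintype.card S) →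
      Real.logb 2 (Fintype.card S) < (N : ℝ) / 12 →
    (1 - ε) * (Nat.card (S → Fin N → Bool) : ℝ) ≤
      ({G : S → Fin N → Bool |
        ∀ k : ℕ, 2 ≤ k → (k : ℝ) ≤ (N : ℝ) / (6 * Real.logb 2 (Fintype.card S)) →
          (genCrossCorr k G : ℝ) < 2 * Real.sqrt ((N : ℝ) *
              (k * Real.log N + Real.log ((Fintype.card S).choose k)))}.ncard : ℝ) := by
  classical
  intro ε hε
  refine ⟨max 2 ⌈68 / ε⌉₊, fun N hN S _ hS _ => ?_⟩
  have hN2 : 2 ≤ N := (le_max_left _ _).trans hN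
  have hN2' : (2 : ℝ) ≤ N := by exact_mod_cast hN2
  have hNε : 68 / (N : ℝ) ≤ ε := by
    have : 68 / ε ≤ N := (Nat.le_ceil _).trans (by exact_mod_cast (le_max_right _ _).trans hN)
    rw [div_le_iff₀ hε] at this
    rw [div_le_iff₀ (by linarith)]
    linarith
  have hlogN : 1 ≤ Real.logb 2 N := by
    rw [Real.le_logb_iff_rpow_le one_lt_two (by linarith)]
    simpa using hN2'
  have hq0 : (0 : ℝ) < Fintype.card S := by
    rcases Nat.eq_zero_or_pos (Fintype.card S) with h | h
    · rw [h] at hS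
      simp only [Nat.cast_zero, Real.logb_zero] at hS
      linarith
    · exact_mod_cast h
  have hNq : N ≤ Fintype.card S := by
    exact_mod_cast (Real.logb_le_logb one_lt_two (by linarith) hq0).1 hS
  have hbad := card_exists_le_genCrossCorr (S := S) hN2 hNq
  rw [Set.ncard_eq_toFinset_card', Nat.card_eq_fintype_card]
  set B : Finset (S → Fin N → Bool) := {G | ∃ k : ℕ, 2 ≤ k ∧ 6 * k ≤ N ∧
      2 * Real.sqrt ((N : ℝ) * (k * Real.log N + Real.log ((Fintype.card S).choose k))) ≤
        (genCrossCorr k G : ℝ)}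
  have hcompl : (Fintype.card (S → Fin N → Bool) : ℝ) = Bᶜ.card + B.card := by
    exact_mod_cast (Finset.card_compl_add_card B).symm
  have hbound : (Fintype.card (S → Fin N → Bool) : ℝ) * (68 / (N : ℝ)) ≤
      Fintype.card (S → Fin N → Bool) * ε := by gcongr
  have hBc : (1 - ε) * (Fintype.card (S → Fin N → Bool) : ℝ) ≤ (Bᶜ.card : ℝ) := by linarith
  refine hBc.trans ?_
  norm_cast
  refine Finset.card_le_card fun G hG => ?_
  rw [Set.mem_toFinset]
  intro k hk hkN
  by_contra! hcon
  refine Finset.mem_compl.1 hG (Finset.mem_filter.2 ⟨Finset.mem_univ _, k, hk, ?_, hcon⟩)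
  rw [le_div_iff₀ (by linarith)] at hkN
  have : (6 * k : ℝ) ≤ N := by
    have : (k : ℝ) * 6 ≤ k * (6 * Real.logb 2 (Fintype.card S)) := by gcongr; linarith
    linarith
  exact_mod_cast this
end

section
/- Let m = ⌊N/3⌋ and let 𝒮 be a finite seed set with 1 ≤ log₂|𝒮| ≤ m^{1/4}. Let G : 𝒮 → {-1,1}^N be a random generator whose entries e_n(s) are independent uniform ±1 random variables. Then with probability tending to 1 as N → ∞ one has Φ̃_k(G) > (4/9)·√(N·(log C(N,k) + k·log|𝒮|)) for every integer k with 2 ≤ k ≤ N/(6·log₂|𝒮|). -/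
theorem Real.log_le_half_sub_inv {r : ℝ} (hr : 1 ≤ r) : Real.log r ≤ (r - r⁻¹) / 2 := by
  have h := Real.self_le_sinh_iff.2 (Real.log_nonneg hr)
  rwa [Real.sinh_log (by linarith)] at h

theorem Nat.four_pow_le_two_mul_sqrt_mul_centralBinom {h : ℕ} (hh : 1 ≤ h) :
    (4 : ℝ) ^ h ≤ 2 * √h * h.centralBinom := by
  have key : ∀ h : ℕ, 1 ≤ h → (16 : ℝ) ^ h ≤ 4 * h * (h.centralBinom : ℝ) ^ 2 := by
    intro h hh
    induction h, hh using Nat.le_induction with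
    | base => norm_num [Nat.centralBinom, Nat.choose]
    | succ h hh ih =>
      have e : ((h : ℝ) + 1) * ((h + 1).centralBinom : ℝ)
          = 2 * (2 * h + 1) * (h.centralBinom : ℝ) := by
        exact_mod_cast Nat.succ_mul_centralBinom_succ h
      have hp : (0 : ℝ) < (h : ℝ) + 1 := by positivity
      refine le_of_mul_le_mul_left ?_ hp
      have e2 : ((h : ℝ) + 1) * (4 * ((h + 1 : ℕ) : ℝ) * ((h + 1).centralBinom : ℝ) ^ 2)
          = 4 * (2 * (2 * h + 1) * (h.centralBinom : ℝ)) ^ 2 := by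
        rw [← e]; push_cast; ring
      rw [e2, pow_succ]
      have := mul_le_mul_of_nonneg_left ih (show (0 : ℝ) ≤ 16 * (h + 1) by positivity)
      nlinarith [sq_nonneg (h.centralBinom : ℝ)]
  refine le_of_sq_le_sq ?_ (by positivity)
  have := key h hh
  calc ((4 : ℝ) ^ h) ^ 2 = 16 ^ h := by rw [← pow_mul, mul_comm, pow_mul]; norm_num
    _ ≤ _ := this
    _ = _ := by rw [mul_pow, mul_pow, Real.sq_sqrt (by positivity)]; ring

/-- Gaussian type lower bound for binomial coefficients away from the centre. -/
theorem Nat.centralBinom_mul_exp_le_choose {h t : ℕ} (ht : t < h) {i : ℕ} (hi : i ≤ t) :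
    (h.centralBinom : ℝ) * Real.exp (-(h / ((h : ℝ) ^ 2 - (t : ℝ) ^ 2)) * (i : ℝ) ^ 2)
      ≤ (2 * h).choose (h + i) := by
  have htr : (t : ℝ) < h := by exact_mod_cast ht
  have hD : 0 < (h : ℝ) ^ 2 - (t : ℝ) ^ 2 := by
    have : (0 : ℝ) ≤ t := by positivity
    nlinarith
  induction i with
  | zero => simp [Nat.centralBinom]
  | succ i ih =>
    have ih := ih (by omega)
    have hit : (i : ℝ) + 1 ≤ t := by exact_mod_cast hi
    have hi0 : (0 : ℝ) ≤ i := by positivity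
    have hs : ((2 * h).choose (h + (i + 1)) : ℝ) * ((h : ℝ) + i + 1)
        = (2 * h).choose (h + i) * ((h : ℝ) - i) := by
      have := Nat.choose_succ_right_eq (2 * h) (h + i)
      have h3 : 2 * h - (h + i) = h - i := by omega
      rw [h3] at this
      have h4 : (((h - i : ℕ)) : ℝ) = (h : ℝ) - i := by
        rw [Nat.cast_sub (by omega)]
      rw [← h4]
      exact_mod_cast this
    set c : ℝ := h / ((h : ℝ) ^ 2 - (t : ℝ) ^ 2) with hc
    have hb : (0 : ℝ) < (h : ℝ) - i := by linarith
    have ha : (0 : ℝ) < (h : ℝ) + i + 1 := by linarith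
    have hlog : Real.log (((h : ℝ) + i + 1) / ((h : ℝ) - i)) ≤ c * (2 * i + 1) := by
      refine (Real.log_le_half_sub_inv ((one_le_div hb).2 (by linarith))).trans ?_
      have : (((h : ℝ) + i + 1) / ((h : ℝ) - i) - (((h : ℝ) + i + 1) / ((h : ℝ) - i))⁻¹) / 2
          = ((2 * h + 1) / (2 * (((h : ℝ) + i + 1) * ((h : ℝ) - i)))) * (2 * i + 1) := by
        field_simp; ring
      rw [this]
      refine mul_le_mul_of_nonneg_right ?_ (by positivity)
      rw [hc, div_le_div_iff₀ (by positivity) hD]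
      nlinarith [mul_nonneg hi0 (sub_nonneg.2 hit), sq_nonneg ((t : ℝ) - i - 1)]
    have hexp : Real.exp (-(c * (2 * i + 1))) * ((h : ℝ) + i + 1) ≤ (h : ℝ) - i := by
      rw [Real.log_le_iff_le_exp (by positivity), div_le_iff₀ hb] at hlog
      rw [Real.exp_neg, inv_mul_le_iff₀ (Real.exp_pos _)]
      exact hlog
    refine le_of_mul_le_mul_right ?_ ha
    rw [hs]
    have e : Real.exp (-c * ((i + 1 : ℕ) : ℝ) ^ 2)
        = Real.exp (-c * (i : ℝ) ^ 2) * Real.exp (-(c * (2 * i + 1))) := by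
      rw [← Real.exp_add]; congr 1; push_cast; ring
    rw [e]
    calc _ = (h.centralBinom * Real.exp (-c * (i : ℝ) ^ 2))
          * (Real.exp (-(c * (2 * i + 1))) * ((h : ℝ) + i + 1)) := by ring
      _ ≤ _ := mul_le_mul ih hexp (by positivity) (by positivity)

theorem Nat.log_factorial_le {j : ℕ} (hj : 1 ≤ j) :
    Real.log (j.factorial) ≤ (j + 1) * Real.log j - j + 1 := by
  induction j, hj using Nat.le_induction with
  | base => simp
  | succ j hj ih =>
    have hj0 : (0 : ℝ) < j := by exact_mod_cast hj
    rw [Nat.factorial_succ, Nat.cast_mul, Real.log_mul (by positivity) (by positivity)]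
    push_cast
    have h1 : Real.log ((j : ℝ) / (j + 1)) ≤ (j : ℝ) / (j + 1) - 1 :=
      Real.log_le_sub_one_of_pos (by positivity)
    rw [Real.log_div (by positivity) (by positivity)] at h1
    have h2 : (j : ℝ) / (j + 1) - 1 = -(1 / (j + 1)) := by field_simp; ring
    rw [h2] at h1
    have h3 := mul_le_mul_of_nonneg_left h1 (show (0 : ℝ) ≤ j + 1 by positivity)
    have h4 : ((j : ℝ) + 1) * -(1 / (j + 1)) = -1 := by field_simp
    rw [h4] at h3
    nlinarith

theorem Nat.log_choose_le {N k : ℕ} (hk : 1 ≤ k) (hkN : k ≤ N) :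
    Real.log (N.choose k) ≤ k * (1 + Real.log N - Real.log k) := by
  have hk0 : (0 : ℝ) < k := by exact_mod_cast hk
  have hN0 : (0 : ℝ) < N := by exact_mod_cast (by omega : 0 < N)
  have h1 : (N.choose k : ℝ) ≤ (N : ℝ) ^ k / k.factorial := Nat.choose_le_pow_div k N
  have h2 : (k : ℝ) ^ k / k.factorial ≤ Real.exp k := Real.pow_div_factorial_le_exp k hk0.le k
  have hc : (0 : ℝ) < N.choose k := by exact_mod_cast Nat.choose_pos hkN
  have h3 := Real.log_le_log hc h1
  have h4 := Real.log_le_log (by positivity) h2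
  rw [Real.log_div (by positivity) (by positivity), Real.log_pow] at h3 h4
  rw [Real.log_exp] at h4
  linarith

theorem Nat.le_log_choose {n j : ℕ} {B : ℝ} (hj : 1 ≤ j) (hB : 0 < B) (hn : B ≤ (n : ℝ) - j) :
    j * (Real.log B - Real.log j + 1) - Real.log j - 1 ≤ Real.log (n.choose j) := by
  have hjn : j ≤ n := by
    have : (j : ℝ) ≤ n := by linarith
    exact_mod_cast this
  have h2 : B ^ j ≤ (j.factorial : ℝ) * n.choose j := by
    have h3 : (n + 1 - j) ^ j ≤ j.factorial * n.choose j := by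
      rw [← Nat.descFactorial_eq_factorial_mul_choose]; exact Nat.pow_sub_le_descFactorial n j
    have h4 : B ≤ ((n + 1 - j : ℕ) : ℝ) := by
      rw [Nat.cast_sub (by omega)]; push_cast; linarith
    calc B ^ j ≤ ((n + 1 - j : ℕ) : ℝ) ^ j := pow_le_pow_left₀ hB.le h4 j
      _ ≤ _ := by exact_mod_cast h3
  have hc : (0 : ℝ) < n.choose j := by exact_mod_cast Nat.choose_pos hjn
  have h5 := Real.log_le_log (by positivity) h2
  rw [Real.log_mul (by positivity) hc.ne', Real.log_pow] at h5
  have := Nat.log_factorial_le hj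
  linarith

theorem exp_div_two_mul_sqrt_le_choose_div {h t : ℕ} (hh : 1 ≤ h) (ht : t < h) :
    Real.exp (-(h / ((h : ℝ) ^ 2 - (t : ℝ) ^ 2)) * (t : ℝ) ^ 2) / (2 * √h)
      ≤ (2 * h).choose (h + t) / 4 ^ h := by
  have hh0 : (0 : ℝ) < h := by exact_mod_cast hh
  rw [div_le_div_iff₀ (by positivity) (by positivity)]
  calc _ ≤ Real.exp (-(h / ((h : ℝ) ^ 2 - (t : ℝ) ^ 2)) * (t : ℝ) ^ 2)
        * (2 * √h * h.centralBinom) :=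
        mul_le_mul_of_nonneg_left (Nat.four_pow_le_two_mul_sqrt_mul_centralBinom hh)
          (Real.exp_pos _).le
    _ = (h.centralBinom * Real.exp (-(h / ((h : ℝ) ^ 2 - (t : ℝ) ^ 2)) * (t : ℝ) ^ 2))
        * (2 * √h) := by ring
    _ ≤ _ := mul_le_mul_of_nonneg_right (Nat.centralBinom_mul_exp_le_choose ht le_rfl)
        (by positivity)

theorem lt_and_mul_sq_le_of_eq_floor_sqrt {N h t : ℕ} {X : ℝ} (hNr : (10 : ℝ) ^ 6 ≤ N)
    (hh1 : 0.333 * (N : ℝ) ≤ h) (hh2 : (h : ℝ) ≤ N / 3) (hX1 : 1 ≤ X) (hXN : X ≤ 0.63 * N)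
    (ht : t = ⌊2 / 9 * √(N * X)⌋₊ + 1) :
    t < h ∧ h / ((h : ℝ) ^ 2 - (t : ℝ) ^ 2) * (t : ℝ) ^ 2 ≤ 0.22 * X := by
  have hN0 : (0 : ℝ) < N := by linarith
  have ht2 : (t : ℝ) ^ 2 ≤ 0.0499 * (N * X) := by
    have hNX : 0 ≤ N * X := by positivity
    set μ := 2 / 9 * √(N * X) with hμ
    have hμ2 : μ ^ 2 = 4 / 81 * (N * X) := by
      rw [hμ, mul_pow, Real.sq_sqrt hNX]; norm_num
    have hμ0 : 0 ≤ μ := by positivity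
    have hμ1 : 200 ≤ μ := by
      refine le_of_sq_le_sq ?_ hμ0
      rw [hμ2]
      nlinarith
    have htμ : (t : ℝ) ≤ 1.005 * μ := by
      rw [ht]
      push_cast
      have := Nat.floor_le hμ0
      linarith
    have : (t : ℝ) ^ 2 ≤ (1.005 * μ) ^ 2 := pow_le_pow_left₀ (by positivity) htμ 2
    rw [mul_pow, hμ2] at this
    linarith
  have hhN : 0.110889 * (N : ℝ) ^ 2 ≤ (h : ℝ) ^ 2 := by
    have := pow_le_pow_left₀ (by positivity) hh1 2
    nlinarith
  have ht3 : (t : ℝ) ^ 2 ≤ 0.03144 * (N : ℝ) ^ 2 := by nlinarith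
  have hD : 0.0794 * (N : ℝ) ^ 2 ≤ (h : ℝ) ^ 2 - (t : ℝ) ^ 2 := by nlinarith
  have hN2 : 0 < (N : ℝ) ^ 2 := by positivity
  have hth : t < h := by
    have : (t : ℝ) ^ 2 < (h : ℝ) ^ 2 := by linarith
    exact_mod_cast lt_of_pow_lt_pow_left₀ 2 (by positivity) this
  refine ⟨hth, ?_⟩
  rw [div_mul_eq_mul_div, div_le_iff₀ (by linarith)]
  calc (h : ℝ) * (t : ℝ) ^ 2 ≤ N / 3 * (0.0499 * (N * X)) :=
        mul_le_mul hh2 ht2 (by positivity) (by positivity)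
    _ ≤ 0.22 * X * (0.0794 * (N : ℝ) ^ 2) := by
        have := mul_pos hN2 (by linarith : 0 < X)
        linarith
    _ ≤ _ := mul_le_mul_of_nonneg_left hD (by linarith)

theorem le_log_choose_shift_sets {N q k : ℕ} (hN0 : 0 < N) (hq : 2 ≤ q) (hk : 2 ≤ k)
    (hk6 : 6 * (k : ℝ) ≤ N) :
    ((k : ℝ) - 1) * (Real.log N + Real.log q - Real.log 12 - Real.log k + 1) - Real.log k - 1
      ≤ Real.log (((N - 2 * (N / 3) + 1) * (q - 1)).choose (k - 1)) := by
  have hqr : (2 : ℝ) ≤ q := by exact_mod_cast hq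
  have hkr : (2 : ℝ) ≤ k := by exact_mod_cast hk
  set h := N / 3 with hh
  have hj : ((k - 1 : ℕ) : ℝ) = (k : ℝ) - 1 := by rw [Nat.cast_sub (by omega)]; simp
  have hn : (N : ℝ) * q / 12
      ≤ (((N - 2 * h + 1) * (q - 1) : ℕ) : ℝ) - ((k - 1 : ℕ) : ℝ) := by
    rw [hj, Nat.cast_mul, Nat.cast_sub (show 1 ≤ q by omega)]
    have h1 : (N : ℝ) / 3 ≤ ((N - 2 * h + 1 : ℕ) : ℝ) := by
      have : (N : ℝ) ≤ 3 * ((N - 2 * h + 1 : ℕ) : ℝ) := by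
        exact_mod_cast (by omega : N ≤ 3 * (N - 2 * h + 1))
      linarith
    have h2 := mul_le_mul_of_nonneg_right h1 (show (0 : ℝ) ≤ q - 1 by linarith)
    push_cast at h2 ⊢
    nlinarith
  have h1 := Nat.le_log_choose (show 1 ≤ k - 1 by omega) (show 0 < (N : ℝ) * q / 12 by positivity)
    hn
  rw [hj, Real.log_div (by positivity) (by norm_num),
    Real.log_mul (by positivity) (by positivity)] at h1
  have h2 : Real.log ((k : ℝ) - 1) ≤ Real.log k := Real.log_le_log (by linarith) (by linarith)
  have h3 := mul_le_mul_of_nonneg_left h2 (show (0 : ℝ) ≤ k by linarith)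
  nlinarith

theorem sq_mul_exp_le_choose_mul {N q k : ℕ} (hN : 10 ^ 6 ≤ N) (hlogN : 520 ≤ Real.log N)
    (hq : 2 ≤ q) (hk : 2 ≤ k) (hkN : (k : ℝ) ≤ N / (6 * Real.logb 2 q)) {t : ℕ}
    (ht : t = ⌊2 / 9 * √(N * (Real.log (N.choose k) + k * Real.log q))⌋₊ + 1) :
    (k : ℝ) ^ 2 * Real.exp (Real.log N / 100)
      ≤ ((N - 2 * (N / 3) + 1) * (q - 1)).choose (k - 1)
        * ((2 * (N / 3)).choose (N / 3 + t) / 4 ^ (N / 3)) := by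
  have hL1 := Real.log_two_gt_d9
  have hL2 := Real.log_two_lt_d9
  have hNr : (10 : ℝ) ^ 6 ≤ N := by exact_mod_cast hN
  have hqr : (2 : ℝ) ≤ q := by exact_mod_cast hq
  have hkr : (2 : ℝ) ≤ k := by exact_mod_cast hk
  have hN0 : (0 : ℝ) < N := by linarith
  have hb : Real.log 2 ≤ Real.log q := Real.log_le_log (by norm_num) hqr
  have hlogb : 0 < Real.logb 2 q := Real.logb_pos (by norm_num) (by linarith)
  have hkb : (k : ℝ) * Real.log q ≤ N * Real.log 2 / 6 := by
    rw [le_div_iff₀ (by positivity), Real.logb] at hkN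
    have : (k : ℝ) * (6 * (Real.log q / Real.log 2)) * Real.log 2 = 6 * (k * Real.log q) := by
      field_simp
    have := mul_le_mul_of_nonneg_right hkN (show 0 ≤ Real.log 2 by linarith)
    linarith
  have hk6 : 6 * (k : ℝ) ≤ N := by
    have := mul_le_mul_of_nonneg_left hb (show (0 : ℝ) ≤ k by linarith)
    exact le_of_mul_le_mul_right (by linarith) (show 0 < Real.log 2 by linarith)
  have hkNn : k ≤ N := by
    have : (k : ℝ) ≤ N := by linarith
    exact_mod_cast this
  have hch := Nat.log_choose_le (show 1 ≤ k by omega) hkNn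
  have hch0 : 0 ≤ Real.log (N.choose k) := Real.log_natCast_nonneg _
  set X := Real.log (N.choose k) + k * Real.log q with hX
  set a := Real.log N with ha
  set b := Real.log q with hb'
  set κ := Real.log k with hκ
  have hX1 : 1 ≤ X := by nlinarith
  have hXN : X ≤ 0.63 * N := by
    have h1 : Real.log ((N : ℝ) / (8 * k)) ≤ N / (8 * k) - 1 :=
      Real.log_le_sub_one_of_pos (by positivity)
    have h8 : Real.log 8 = 3 * Real.log 2 := by
      rw [show (8 : ℝ) = 2 ^ 3 by norm_num, Real.log_pow]; norm_num
    rw [Real.log_div (by positivity) (by positivity), Real.log_mul (by norm_num) (by positivity),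
      h8] at h1
    have h2 := mul_le_mul_of_nonneg_left h1 (show (0 : ℝ) ≤ k by linarith)
    have h3 : (k : ℝ) * (N / (8 * k) - 1) = N / 8 - k := by field_simp
    rw [h3] at h2
    nlinarith
  have hXY : X ≤ k * (1 + a + b - κ) := by rw [hX]; linarith
  set h := N / 3 with hh
  have hh1 : 0.333 * (N : ℝ) ≤ h := by
    have : (N : ℝ) ≤ 3 * h + 2 := by exact_mod_cast (by omega : N ≤ 3 * h + 2)
    linarith
  have hh2 : (h : ℝ) ≤ N / 3 := by
    have : (3 * h : ℝ) ≤ N := by exact_mod_cast (by omega : 3 * h ≤ N)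
    linarith
  have hh0 : 1 ≤ h := by omega
  obtain ⟨hth, hct⟩ := lt_and_mul_sq_le_of_eq_floor_sqrt hNr hh1 hh2 hX1 hXN ht
  have hcnt := le_log_choose_shift_sets (by omega) hq hk hk6
  rw [← ha, ← hb', ← hκ, ← hh] at hcnt
  have hcpos : (0 : ℝ) < (((N - 2 * h + 1) * (q - 1)).choose (k - 1) : ℝ) := by
    refine Nat.cast_pos.2 (Nat.choose_pos ?_)
    have h1 : 6 * k ≤ N := by exact_mod_cast hk6
    calc k - 1 ≤ (N - 2 * h + 1) * 1 := by omega
      _ ≤ _ := Nat.mul_le_mul_left _ (by omega)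
  -- comparison of exponents
  have h12 : Real.log 12 ≤ 2.5227 := by
    have h1 : Real.log (3 / 4) ≤ 3 / 4 - 1 := Real.log_le_sub_one_of_pos (by norm_num)
    have h2 : Real.log 12 = 4 * Real.log 2 + Real.log (3 / 4) := by
      rw [show (12 : ℝ) = 2 ^ 4 * (3 / 4) by norm_num, Real.log_mul (by norm_num) (by norm_num),
        Real.log_pow]
      norm_num
    linarith
  have hY : Real.log 12 + κ ≤ a + b := by
    rw [ha, hb', hκ, ← Real.log_mul (by norm_num) (by positivity),
      ← Real.log_mul (by positivity) (by positivity)]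
    refine Real.log_le_log (by positivity) ?_
    have := mul_le_mul hk6 hqr (by norm_num) (by linarith)
    linarith
  have hκ' : κ ≤ k / 16 + 4 * Real.log 2 - 1 := by
    have h1 : Real.log ((k : ℝ) / 16) ≤ k / 16 - 1 := Real.log_le_sub_one_of_pos (by positivity)
    have h16 : Real.log 16 = 4 * Real.log 2 := by
      rw [show (16 : ℝ) = 2 ^ 4 by norm_num, Real.log_pow]; norm_num
    rw [Real.log_div (by positivity) (by norm_num), h16] at h1
    linarith
  have hfin : 2 * κ + a / 100 ≤ ((k : ℝ) - 1) * (a + b - Real.log 12 - κ + 1) - κ - 1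
      + (-(0.22 * (k * (1 + a + b - κ))) - (Real.log 2 + a / 2)) := by
    have h1 := mul_nonneg (show (0 : ℝ) ≤ 0.78 * k - 1.53 by linarith)
      (show 0 ≤ a + b - κ - Real.log 12 by linarith)
    have h2 := mul_le_mul_of_nonneg_left h12 (show (0 : ℝ) ≤ 0.22 * k + 0.53 by linarith)
    nlinarith
  have hhr : (0 : ℝ) < h := by exact_mod_cast hh0
  have hbin := exp_div_two_mul_sqrt_le_choose_div hh0 hth
  have hsq : 2 * √(h : ℝ) ≤ Real.exp (Real.log 2 + a / 2) := by
    rw [Real.exp_add, Real.exp_log (by norm_num), Real.exp_half, ha, Real.exp_log hN0]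
    have := Real.sqrt_le_sqrt (show (h : ℝ) ≤ N by linarith)
    linarith
  calc (k : ℝ) ^ 2 * Real.exp (a / 100) = Real.exp (2 * κ + a / 100) := by
        rw [Real.exp_add, two_mul, Real.exp_add, hκ, Real.exp_log (by positivity), sq]
    _ ≤ Real.exp (((k : ℝ) - 1) * (a + b - Real.log 12 - κ + 1) - κ - 1)
        * (Real.exp (-(0.22 * (k * (1 + a + b - κ)))) / Real.exp (Real.log 2 + a / 2)) := by
        rw [← Real.exp_sub, ← Real.exp_add]
        exact Real.exp_le_exp.2 hfin
    _ ≤ _ := by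
        refine mul_le_mul ((Real.le_log_iff_exp_le hcpos).1 hcnt) (le_trans ?_ hbin)
          (by positivity) (by positivity)
        gcongr
        linarith

theorem abs_seqAt {N : ℕ} (E : Fin N → Bool) (t : ℕ) : |seqAt E t| = 1 := by
  unfold seqAt pmVal
  split_ifs <;> simp

theorem bddAbove_genCorrSet {S : Type*} {N : ℕ} (k : ℕ) (G : S → Fin N → Bool) :
    BddAbove (genCorrSet k G) := by
  refine ⟨N, ?_⟩
  rintro v ⟨ℓ, κ, s, M, d, hℓ, hκ, -, -, -, -, hd, rfl⟩
  have hM : M ≤ N := (Nat.le_add_right _ _).trans (hd ⟨0, hℓ⟩ ⟨0, hκ _⟩)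
  have h : |∑ n ∈ Finset.range M, ∏ i, ∏ j, seqAt (G (s i)) (n + d i j)| ≤ (M : ℤ) := by
    refine (Finset.abs_sum_le_sum_abs _ _).trans ?_
    simp [Finset.abs_prod, abs_seqAt]
  rw [Int.abs_eq_natAbs] at h
  have : (∑ n ∈ Finset.range M, ∏ i, ∏ j, seqAt (G (s i)) (n + d i j)).natAbs ≤ M := by
    exact_mod_cast h
  exact this.trans hM

open Classical in
theorem natAbs_sum_prod_mem_genCorrSet {S : Type*} {N M : ℕ} (G : S → Fin N → Bool)
    (U : Finset (S × ℕ)) (hU : U.Nonempty) (hM : 1 ≤ M) (hd : ∀ u ∈ U, M + u.2 ≤ N) :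
    (∑ n ∈ Finset.range M, ∏ u ∈ U, seqAt (G u.1) (n + u.2)).natAbs
      ∈ genCorrSet U.card G := by
  set I : Finset S := U.image Prod.fst with hI
  set F : S → Finset ℕ := fun s => (U.filter fun u => u.1 = s).image Prod.snd with hF
  have memF : ∀ s d, d ∈ F s ↔ (s, d) ∈ U := by
    intro s d
    simp only [hF, Finset.mem_image, Finset.mem_filter, Prod.exists]
    constructor
    · rintro ⟨a, b, ⟨h, rfl⟩, rfl⟩; exact h
    · intro h; exact ⟨s, d, ⟨h, rfl⟩, rfl⟩
  have hprod : ∀ f : S × ℕ → ℤ, ∏ u ∈ U, f u = ∏ s ∈ I, ∏ d ∈ F s, f (s, d) := by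
    intro f
    refine Finset.prod_finset_product U I F ?_
    rintro ⟨s, d⟩
    simp only [memF, hI, Finset.mem_image]
    exact ⟨fun h => ⟨⟨_, h, rfl⟩, h⟩, fun h => h.2⟩
  have hcard : U.card = ∑ s ∈ I, (F s).card := by
    refine (Finset.card_eq_sum_card_image Prod.fst U).trans (Finset.sum_congr rfl fun s _ => ?_)
    rw [hF, Finset.card_image_of_injOn]
    rintro ⟨a, b⟩ h ⟨a', b'⟩ h' e
    simp only [Finset.coe_filter, Set.mem_ofPred_eq] at h h' e
    rw [Prod.mk.injEq]
    exact ⟨h.2.trans h'.2.symm, e⟩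
  let e := I.equivFin.symm
  refine ⟨I.card, fun i => (F (e i)).card, fun i => e i, M,
    fun i => (F (e i)).orderEmbOfFin rfl, ?_, ?_, ?_, ?_, hM, ?_, ?_, ?_⟩
  · exact Finset.card_pos.2 (hU.image _)
  · intro i
    obtain ⟨u, hu, h⟩ := Finset.mem_image.1 (e i).2
    exact Finset.card_pos.2 ⟨u.2, (memF _ _).2 (by rw [← h]; exact hu)⟩
  · rw [hcard, Equiv.sum_comp e fun s : I => (F s).card, Finset.sum_coe_sort I fun s => (F s).card]
  · exact Subtype.val_injective.comp e.injective
  · intro i; exact OrderEmbedding.strictMono _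
  · intro i j
    exact hd _ ((memF _ _).1 (Finset.orderEmbOfFin_mem (F (e i)) rfl j))
  · congr 1
    refine Finset.sum_congr rfl fun n _ => ?_
    rw [hprod, ← Finset.prod_coe_sort I, ← Equiv.prod_comp e]
    refine Finset.prod_congr rfl fun i _ => ?_
    have : F (e i) = Finset.univ.map ((F (e i)).orderEmbOfFin rfl).toEmbedding := by
      simp
    conv_lhs => rw [this]
    rw [Finset.prod_map]
    rfl

/-- The linear map sending a family of sequences over `ZMod 2` to the first `M` values of the
sum of its shifts indexed by `U`. -/
def shiftSum (S : Type*) (N M : ℕ) (U : Finset (S × ℕ)) :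
    (S → Fin N → ZMod 2) →ₗ[ZMod 2] (Fin M → ZMod 2) where
  toFun x n := ∑ u ∈ U, if h : n + u.2 < N then x u.1 ⟨n + u.2, h⟩ else 0
  map_add' x y := by
    ext n
    simp only [Pi.add_apply, ← Finset.sum_add_distrib]
    refine Finset.sum_congr rfl fun u _ => ?_
    split_ifs <;> simp
  map_smul' c x := by
    ext n
    simp only [Pi.smul_apply, smul_eq_mul, Finset.mul_sum, RingHom.id_apply]
    refine Finset.sum_congr rfl fun u _ => ?_
    split_ifs <;> simp

open Classical in
theorem shiftSum_single {S : Type*} {N M : ℕ} {U : Finset (S × ℕ)}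
    (s : S) (p : Fin N) (hU : ∀ u ∈ U, M + u.2 ≤ N) (n : Fin M) :
    shiftSum S N M U (Pi.single s (Pi.single p 1)) n
      = if (n : ℕ) ≤ p ∧ (s, (p : ℕ) - n) ∈ U then 1 else 0 := by
  have h1 : ∀ u ∈ U, (if h : (n : ℕ) + u.2 < N then
      (Pi.single s (Pi.single p 1) : S → Fin N → ZMod 2) u.1 ⟨n + u.2, h⟩ else 0)
      = if u = (s, (p : ℕ) - n) then (if (n : ℕ) ≤ p then 1 else 0) else 0 := by
    rintro ⟨a, d⟩ hu
    have hlt : (n : ℕ) + d < N := by have := hU _ hu; have := n.2; simp only at *; omega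
    simp only [hlt, dif_pos, Prod.mk.injEq]
    by_cases ha : a = s
    · subst ha
      simp only [Pi.single_eq_same, Pi.single_apply, Fin.ext_iff, true_and]
      split_ifs <;> first | rfl | omega
    · simp [ha]
  change (∑ u ∈ U, _) = _
  rw [Finset.sum_congr rfl h1, Finset.sum_ite_eq']
  by_cases h2 : (n : ℕ) ≤ p <;> simp [h2]

theorem shiftSum_prod_surjective {S : Type*} {N M : ℕ} {s₀ : S}
    {T T' : Finset (S × ℕ)} (hne : T ≠ T') (hMN : M ≤ N)
    (hs : ∀ u ∈ T, u.1 ≠ s₀) (hs' : ∀ u ∈ T', u.1 ≠ s₀)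
    (hT : ∀ u ∈ T, M + u.2 ≤ N) (hT' : ∀ u ∈ T', M + u.2 ≤ N) :
    Function.Surjective ((shiftSum S N M (Finset.cons (s₀, 0) T fun h => hs _ h rfl)).prod
      (shiftSum S N M (Finset.cons (s₀, 0) T' fun h => hs' _ h rfl))) := by
  classical
  set f := shiftSum S N M (Finset.cons (s₀, 0) T fun h => hs _ h rfl) with hf
  set f' := shiftSum S N M (Finset.cons (s₀, 0) T' fun h => hs' _ h rfl) with hf'
  have hU : ∀ u ∈ Finset.cons (s₀, 0) T fun h => hs _ h rfl, M + u.2 ≤ N := by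
    intro u hu
    rcases Finset.mem_cons.1 hu with rfl | hu
    exacts [hMN, hT u hu]
  have hU' : ∀ u ∈ Finset.cons (s₀, 0) T' fun h => hs' _ h rfl, M + u.2 ≤ N := by
    intro u hu
    rcases Finset.mem_cons.1 hu with rfl | hu
    exacts [hMN, hT' u hu]
  rw [← LinearMap.range_eq_top]
  by_contra hlt
  obtain ⟨φ, hφ0, hφ⟩ := Submodule.exists_le_ker_of_lt_top _ (lt_top_iff_ne_top.2 hlt)
  have hker : ∀ x, φ (f x, f' x) = 0 := fun x =>
    LinearMap.mem_ker.1 (hφ (LinearMap.mem_range_self (f.prod f') x))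
  set α : Fin M → ZMod 2 := fun n => φ (Pi.single n 1, 0) with hα
  set β : Fin M → ZMod 2 := fun n => φ (0, Pi.single n 1) with hβ
  have hrep : ∀ a b, φ (a, b) = ∑ n, (a n * α n + b n * β n) := by
    intro a b
    have ha : (a, (0 : Fin M → ZMod 2)) = ∑ n, a n • (Pi.single n (1 : ZMod 2), 0) := by
      ext i <;> simp [Prod.fst_sum, Prod.snd_sum, Finset.sum_apply, Pi.single_apply]
    have hb : ((0 : Fin M → ZMod 2), b) = ∑ n, b n • (0, Pi.single n (1 : ZMod 2)) := by
      ext i <;> simp [Prod.fst_sum, Prod.snd_sum, Finset.sum_apply, Pi.single_apply]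
    have : (a, b) = (a, 0) + (0, b) := by simp
    rw [this, map_add, ha, hb, map_sum, map_sum, ← Finset.sum_add_distrib]
    simp only [map_smul, smul_eq_mul, hα, hβ]
  have hαβ : ∀ n, α n + β n = 0 := by
    intro n
    have hn : (n : ℕ) < N := n.2.trans_le hMN
    have h := hker (Pi.single s₀ (Pi.single ⟨n, hn⟩ 1))
    rw [hrep, Finset.sum_eq_single n] at h
    · rw [hf, hf', shiftSum_single _ _ hU, shiftSum_single _ _ hU'] at h
      simpa using h
    · intro m _ hm
      have hmn : (m : ℕ) ≠ n := fun h => hm (Fin.ext h)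
      have h0 : ¬ ((m : ℕ) ≤ n ∧ (n : ℕ) - m = 0) := by omega
      have e1 : ∀ j, (s₀, j) ∉ T := fun j h => hs _ h rfl
      have e2 : ∀ j, (s₀, j) ∉ T' := fun j h => hs' _ h rfl
      rw [hf, hf', shiftSum_single _ _ hU, shiftSum_single _ _ hU']
      simp only [Finset.mem_cons, Prod.mk.injEq, true_and, e1, e2, or_false, h0, if_false,
        zero_mul, add_zero]
    · simp
  have hβα : ∀ n, β n = α n := by
    intro n
    have := hαβ n
    rw [add_comm, ← CharTwo.sub_eq_add, sub_eq_zero] at this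
    exact this
  have hα0 : ∃ n, α n ≠ 0 := by
    by_contra! h
    refine hφ0 (LinearMap.ext fun ⟨a, b⟩ => ?_)
    rw [hrep]
    simp [hβα, h]
  obtain ⟨m, hm, hmax⟩ : ∃ m, α m ≠ 0 ∧ ∀ n, α n ≠ 0 → n ≤ m := by
    obtain ⟨n, hn⟩ := hα0
    obtain ⟨m, hm, h⟩ := (Finset.univ.filter fun n => α n ≠ 0).exists_max_image id
      ⟨n, by simpa using hn⟩
    exact ⟨m, by simpa using hm, fun n hn => h n (by simpa using hn)⟩
  obtain ⟨⟨s, d⟩, hsd, hdmax⟩ := (symmDiff T T').exists_max_image Prod.snd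
    (Finset.nonempty_iff_ne_empty.2 fun h => hne (symmDiff_eq_bot.1 h))
  have hdN : M + d ≤ N := by
    rcases Finset.mem_symmDiff.1 hsd with h | h
    exacts [hT _ h.1, hT' _ h.1]
  have hs0 : s ≠ s₀ := by
    rcases Finset.mem_symmDiff.1 hsd with h | h
    exacts [hs _ h.1, hs' _ h.1]
  have hmd : (m : ℕ) + d < N := by have := m.2; omega
  have h := hker (Pi.single s (Pi.single ⟨m + d, hmd⟩ 1))
  rw [hrep, Finset.sum_eq_single m] at h
  · rw [hf, hf', shiftSum_single _ _ hU, shiftSum_single _ _ hU', hβα] at h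
    rcases Finset.mem_symmDiff.1 hsd with h' | h' <;> simp [hs0, h'.1, h'.2, hm] at h
  · intro n _ hn
    by_cases hαn : α n = 0
    · simp [hβα, hαn]
    have hnm : (n : ℕ) < m := lt_of_le_of_ne (hmax n hαn) fun h => hn (Fin.ext h)
    have hiff : (s, (m : ℕ) + d - n) ∈ T ↔ (s, (m : ℕ) + d - n) ∈ T' := by
      by_contra hcon
      have : (s, (m : ℕ) + d - n) ∈ symmDiff T T' := by
        rw [Finset.mem_symmDiff]; tauto
      have := hdmax _ this
      simp only at this
      omega
    rw [hf, hf', shiftSum_single _ _ hU, shiftSum_single _ _ hU', hβα]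
    simp only [Finset.mem_cons, Prod.mk.injEq, hs0, false_and, false_or, hiff]
    exact CharTwo.add_self_eq_zero _
  · simp

theorem LinearMap.card_filter_mul_card_of_surjective {R V W : Type*} [Ring R] [AddCommGroup V]
    [AddCommGroup W] [Module R V] [Module R W] [Fintype V] [Fintype W] [DecidableEq W]
    (f : V →ₗ[R] W) (hf : Function.Surjective f) (A : Finset W) :
    (Finset.univ.filter fun v => f v ∈ A).card * Fintype.card W = A.card * Fintype.card V := by
  have hfib : ∀ w, (Finset.univ.filter fun v => f v = w).card
      = (Finset.univ.filter fun v => f v = 0).card := fun w =>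
    AddMonoidHom.card_fiber_eq_of_mem_range f.toAddMonoidHom (hf w) ⟨0, map_zero f⟩
  have key : ∀ B : Finset W, (Finset.univ.filter fun v => f v ∈ B).card
      = B.card * (Finset.univ.filter fun v => f v = 0).card := by
    intro B
    rw [Finset.card_eq_sum_card_fiberwise (f := f) (t := B) (by intro v; simp)]
    refine Finset.sum_const_nat fun w hw => ?_
    rw [← hfib w, Finset.filter_filter]
    congr 1
    ext v
    simp only [Finset.mem_filter, Finset.mem_univ, true_and]
    exact ⟨fun h => h.2, fun h => ⟨h ▸ hw, h⟩⟩
  have h := key Finset.univ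
  simp only [Finset.mem_univ, Finset.filter_true, Finset.card_univ] at h
  rw [key, h]
  ring

/-- Second moment bound for pairwise independent events on a finite uniform probability space. -/
theorem Finset.card_filter_forall_notMem_mul_le {Ω ι : Type*} [Fintype Ω] [DecidableEq ι]
    (F : Finset ι) (E : ι → Ω → Prop) [∀ i, DecidablePred (E i)] {p : ℝ}
    (hp : ∀ i ∈ F, ((univ.filter fun ω => E i ω).card : ℝ) = p * Fintype.card Ω)
    (hpp : ∀ i ∈ F, ∀ j ∈ F, i ≠ j →
      ((univ.filter fun ω => E i ω ∧ E j ω).card : ℝ) = p ^ 2 * Fintype.card Ω) :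
    ((univ.filter fun ω => ∀ i ∈ F, ¬ E i ω).card : ℝ) * (F.card * p) ^ 2
      ≤ F.card * p * Fintype.card Ω := by
  set Z : Ω → ℝ := fun ω => ∑ i ∈ F, if E i ω then 1 else 0 with hZ
  have h1 : ∑ ω, Z ω = F.card * p * Fintype.card Ω := by
    rw [hZ, Finset.sum_comm]
    simp only [Finset.sum_boole]
    rw [Finset.sum_congr rfl hp, Finset.sum_const, nsmul_eq_mul, mul_assoc]
  have h2 : ∑ ω, Z ω ^ 2 ≤ F.card * p * Fintype.card Ω + F.card ^ 2 * p ^ 2 * Fintype.card Ω := by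
    have e : ∀ ω, Z ω ^ 2 = ∑ i ∈ F, ∑ j ∈ F, if E i ω ∧ E j ω then (1 : ℝ) else 0 := by
      intro ω
      rw [hZ, sq, Finset.sum_mul_sum]
      refine Finset.sum_congr rfl fun i _ => Finset.sum_congr rfl fun j _ => ?_
      by_cases h : E i ω <;> by_cases h' : E j ω <;> simp [h, h']
    simp only [e]
    rw [Finset.sum_comm]
    have : ∀ i ∈ F, ∑ ω, ∑ j ∈ F, (if E i ω ∧ E j ω then (1 : ℝ) else 0)
        ≤ p * Fintype.card Ω + F.card * (p ^ 2 * Fintype.card Ω) := by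
      intro i hi
      rw [Finset.sum_comm]
      simp only [Finset.sum_boole]
      rw [← Finset.add_sum_erase F _ hi]
      refine add_le_add ?_ ?_
      · simp only [and_self]; exact (hp i hi).le
      · rw [Finset.sum_congr rfl fun j hj => hpp i hi j (Finset.mem_of_mem_erase hj)
          (Finset.ne_of_mem_erase hj).symm, Finset.sum_const, nsmul_eq_mul]
        exact mul_le_mul_of_nonneg_right (by exact_mod_cast Finset.card_erase_le) (by positivity)
    refine (Finset.sum_le_sum this).trans (le_of_eq ?_)
    rw [Finset.sum_const, nsmul_eq_mul]
    ring
  have h3 : ((univ.filter fun ω => ∀ i ∈ F, ¬ E i ω).card : ℝ) * (F.card * p) ^ 2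
      ≤ ∑ ω, (Z ω - F.card * p) ^ 2 := by
    rw [← nsmul_eq_mul, ← Finset.sum_const]
    calc _ = ∑ ω ∈ univ.filter fun ω => ∀ i ∈ F, ¬ E i ω, (Z ω - F.card * p) ^ 2 := by
          refine Finset.sum_congr rfl fun ω hω => ?_
          have : Z ω = 0 := Finset.sum_eq_zero fun i hi => if_neg ((mem_filter.1 hω).2 i hi)
          rw [this]; ring
      _ ≤ _ := Finset.sum_le_univ_sum_of_nonneg fun ω => sq_nonneg _
  have h4 : ∑ ω, (Z ω - F.card * p) ^ 2
      = ∑ ω, Z ω ^ 2 - 2 * (F.card * p) * ∑ ω, Z ω + (F.card * p) ^ 2 * Fintype.card Ω := by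
    simp only [sub_sq, Finset.sum_add_distrib, Finset.sum_sub_distrib, Finset.mul_sum,
      Finset.sum_const, Finset.card_univ, nsmul_eq_mul]
    congr 1
    · congr 1
      exact Finset.sum_congr rfl fun _ _ => by ring
    · ring
  rw [h4, h1] at h3
  nlinarith

/-- The additive encoding of signs: `true` (the value `1`) is `0` and `false` (the value `-1`)
is `1`. -/
def signEquiv : Bool ≃ ZMod 2 where
  toFun b := if b then 0 else 1
  invFun z := decide (z = 0)
  left_inv := by decide
  right_inv := by decide

/-- The sign `(-1) ^ z` of a residue `z` modulo `2`. -/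
def zmodSign (z : ZMod 2) : ℤ := if z = 0 then 1 else -1

theorem zmodSign_add : ∀ a b : ZMod 2, zmodSign (a + b) = zmodSign a * zmodSign b := by decide

theorem zmodSign_sum {ι : Type*} (U : Finset ι) (f : ι → ZMod 2) :
    zmodSign (∑ u ∈ U, f u) = ∏ u ∈ U, zmodSign (f u) := by
  classical
  induction U using Finset.induction_on with
  | empty => rfl
  | insert a U ha ih => rw [Finset.sum_insert ha, Finset.prod_insert ha, zmodSign_add, ih]

theorem pmVal_eq_zmodSign : ∀ b, pmVal b = zmodSign (signEquiv b) := by decide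

/-- The additive encoding of a generator. -/
def generatorEquiv (S : Type*) (N : ℕ) : (S → Fin N → Bool) ≃ (S → Fin N → ZMod 2) :=
  Equiv.piCongrRight fun _ => Equiv.piCongrRight fun _ => signEquiv

theorem sum_prod_seqAt {S : Type*} {N : ℕ} (M : ℕ) (U : Finset (S × ℕ)) (G : S → Fin N → Bool) :
    ∑ n ∈ Finset.range M, ∏ u ∈ U, seqAt (G u.1) (n + u.2)
      = ∑ n, zmodSign (shiftSum S N M U (generatorEquiv S N G) n) := by
  rw [Finset.sum_range]
  refine Finset.sum_congr rfl fun n _ => ?_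
  change _ = zmodSign (∑ u ∈ U, _)
  rw [zmodSign_sum]
  refine Finset.prod_congr rfl fun u _ => ?_
  unfold seqAt
  split_ifs with h
  · exact pmVal_eq_zmodSign _
  · rfl

theorem card_filter_sum_zmodSign_eq (h t : ℕ) :
    (Finset.univ.filter fun v : Fin (2 * h) → ZMod 2 => ∑ n, zmodSign (v n) = 2 * t).card
      = (2 * h).choose (h + t) := by
  have hsum : ∀ v : Fin (2 * h) → ZMod 2, ∑ n, zmodSign (v n)
      = 2 * ((Finset.univ.filter fun n => v n = 0).card : ℤ) - 2 * h := by
    intro v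
    have e : ∀ n, zmodSign (v n) = 2 * (if v n = 0 then 1 else 0) - 1 := by
      intro n; unfold zmodSign; split_ifs <;> norm_num
    rw [Finset.sum_congr rfl fun n _ => e n, Finset.sum_sub_distrib, ← Finset.mul_sum,
      Finset.sum_boole]
    simp
  have hc : (2 * h).choose (h + t)
      = (Finset.powersetCard (h + t) (Finset.univ : Finset (Fin (2 * h)))).card := by
    simp
  rw [hc]
  refine Finset.card_bij' (fun v _ => Finset.univ.filter fun n => v n = 0)
    (fun A _ n => if n ∈ A then 0 else 1) ?_ ?_ ?_ ?_
  · intro v hv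
    rw [Finset.mem_filter, hsum] at hv
    rw [Finset.mem_powersetCard]
    exact ⟨Finset.subset_univ _, by have := hv.2; omega⟩
  · intro A hA
    rw [Finset.mem_powersetCard] at hA
    rw [Finset.mem_filter, hsum]
    refine ⟨Finset.mem_univ _, ?_⟩
    have : (Finset.univ.filter fun n => (if n ∈ A then (0 : ZMod 2) else 1) = 0) = A := by
      ext n; by_cases hn : n ∈ A <;> simp [hn]
    rw [this, hA.2]
    push_cast; ring
  · intro v _
    ext n
    have : ∀ z : ZMod 2, z ≠ 0 → 1 = z := by decide
    by_cases hn : v n = 0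
    · simp [hn]
    · simp [← this _ hn]
  · intro A _
    ext n; by_cases hn : n ∈ A <;> simp [hn]

open Classical in
theorem card_filter_genCrossCorr_lt_mul_le {S : Type*} [Fintype S] (s₀ : S) {N h : ℕ} (t : ℕ)
    {k : ℕ} (hk : 2 ≤ k) (hh : 1 ≤ h) (hN : 2 * h ≤ N) :
    ((Finset.univ.filter fun G : S → Fin N → Bool => genCrossCorr k G < 2 * t).card : ℝ)
      * ((((N - 2 * h + 1) * (Fintype.card S - 1)).choose (k - 1) : ℝ)
        * ((2 * h).choose (h + t) / 4 ^ h))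
      ≤ Fintype.card (S → Fin N → Bool) := by
  set B : Finset (S × ℕ) := (Finset.univ.erase s₀) ×ˢ Finset.range (N - 2 * h + 1) with hB
  have hBcard : B.card = (N - 2 * h + 1) * (Fintype.card S - 1) := by
    rw [hB, Finset.card_product, Finset.card_erase_of_mem (Finset.mem_univ _), Finset.card_univ,
      Finset.card_range, mul_comm]
  set F := Finset.powersetCard (k - 1) B with hF
  have hFcard : F.card = ((N - 2 * h + 1) * (Fintype.card S - 1)).choose (k - 1) := by
    rw [hF, Finset.card_powersetCard, hBcard]
  have hFs : ∀ T ∈ F, ∀ u ∈ T, u.1 ≠ s₀ := by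
    intro T hT u hu
    have := (Finset.mem_powersetCard.1 hT).1 hu
    rw [hB, Finset.mem_product] at this
    exact Finset.ne_of_mem_erase this.1
  have hFd : ∀ T ∈ F, ∀ u ∈ T, 2 * h + u.2 ≤ N := by
    intro T hT u hu
    have := (Finset.mem_powersetCard.1 hT).1 hu
    rw [hB, Finset.mem_product, Finset.mem_range] at this
    omega
  set W := Finset.univ.filter fun v : Fin (2 * h) → ZMod 2 => ∑ n, zmodSign (v n) = 2 * t with hW
  have hWcard : W.card = (2 * h).choose (h + t) := card_filter_sum_zmodSign_eq h t
  set f : Finset (S × ℕ) → (S → Fin N → ZMod 2) →ₗ[ZMod 2] (Fin (2 * h) → ZMod 2) :=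
    fun T => shiftSum S N (2 * h) (insert (s₀, 0) T) with hf
  set E : Finset (S × ℕ) → (S → Fin N → Bool) → Prop :=
    fun T G => f T (generatorEquiv S N G) ∈ W with hE
  set p : ℝ := (2 * h).choose (h + t) / 4 ^ h with hp
  have h4 : (Fintype.card (Fin (2 * h) → ZMod 2) : ℝ) = 4 ^ h := by
    rw [Fintype.card_fun, ZMod.card, Fintype.card_fin, pow_mul]; norm_num
  have hpair : ∀ T ∈ F, ∀ T' ∈ F, T ≠ T' → Function.Surjective ((f T).prod (f T')) := by
    intro T hT T' hT' hne
    have := shiftSum_prod_surjective hne hN (hFs T hT) (hFs T' hT') (hFd T hT) (hFd T' hT')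
    rwa [Finset.cons_eq_insert, Finset.cons_eq_insert] at this
  have hΩ : Fintype.card (S → Fin N → ZMod 2) = Fintype.card (S → Fin N → Bool) :=
    (Fintype.card_congr (generatorEquiv S N)).symm
  have htrans : ∀ (P : (S → Fin N → ZMod 2) → Prop) (Q : (S → Fin N → Bool) → Prop)
      [DecidablePred P] [DecidablePred Q], (∀ G, Q G ↔ P (generatorEquiv S N G)) →
      (Finset.univ.filter Q).card = (Finset.univ.filter P).card := by
    intro P Q _ _ hPQ
    exact Finset.card_equiv (generatorEquiv S N) (by simp [hPQ])
  have hpp : ∀ T ∈ F, ∀ T' ∈ F, T ≠ T' →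
      ((Finset.univ.filter fun G => E T G ∧ E T' G).card : ℝ)
        = p ^ 2 * Fintype.card (S → Fin N → Bool) := by
    intro T hT T' hT' hne
    have := LinearMap.card_filter_mul_card_of_surjective _ (hpair T hT T' hT' hne) (W ×ˢ W)
    rw [Finset.card_product, Fintype.card_prod, hWcard, hΩ] at this
    have h1 : (Finset.univ.filter fun G => E T G ∧ E T' G).card
        = (Finset.univ.filter fun x => ((f T).prod (f T')) x ∈ W ×ˢ W).card :=
      htrans _ _ fun G => by simp [hE, Finset.mem_product]
    rw [h1, hp, div_pow, div_mul_eq_mul_div, eq_div_iff (by positivity), ← h4]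
    rw [sq, sq]
    exact_mod_cast this
  have hp1 : ∀ T ∈ F, ((Finset.univ.filter fun G => E T G).card : ℝ)
        = p * Fintype.card (S → Fin N → Bool) := by
    intro T hT
    have hsurj : Function.Surjective (f T) := by
      have hT0 : T ≠ ∅ := by
        rintro rfl
        have := (Finset.mem_powersetCard.1 hT).2
        rw [Finset.card_empty] at this
        omega
      have := shiftSum_prod_surjective hT0 hN (hFs T hT) (by simp) (hFd T hT) (by simp)
      rw [Finset.cons_eq_insert] at this
      exact fun w => (this (w, 0)).imp fun x hx => congrArg Prod.fst hx
    have := LinearMap.card_filter_mul_card_of_surjective _ hsurj W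
    rw [hWcard, hΩ] at this
    have h1 : (Finset.univ.filter fun G => E T G).card
        = (Finset.univ.filter fun x => f T x ∈ W).card :=
      htrans _ _ fun G => Iff.rfl
    rw [h1, hp, div_mul_eq_mul_div, eq_div_iff (by positivity), ← h4]
    exact_mod_cast this
  have hcheb := Finset.card_filter_forall_notMem_mul_le F E hp1 hpp
  have hsub : (Finset.univ.filter fun G : S → Fin N → Bool => genCrossCorr k G < 2 * t)
      ⊆ Finset.univ.filter fun G => ∀ T ∈ F, ¬ E T G := by
    intro G hG
    simp only [Finset.mem_filter, Finset.mem_univ, true_and] at hG ⊢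
    intro T hT hTG
    have hmem : (s₀, 0) ∉ T := fun hm => hFs T hT _ hm rfl
    have hcard : (insert (s₀, 0) T).card = k := by
      rw [Finset.card_insert_of_notMem hmem, (Finset.mem_powersetCard.1 hT).2]
      omega
    have h1 := natAbs_sum_prod_mem_genCorrSet (M := 2 * h) G (insert (s₀, 0) T)
      ⟨_, Finset.mem_insert_self _ _⟩ (by omega) (by
        intro u hu
        rcases Finset.mem_insert.1 hu with rfl | hu
        exacts [hN, hFd T hT u hu])
    rw [hcard, sum_prod_seqAt, (Finset.mem_filter.1 hTG).2] at h1
    have h2 : ((2 * t : ℤ)).natAbs ≤ genCrossCorr k G := le_csSup (bddAbove_genCorrSet k G) h1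
    omega
  have hR : 0 ≤ (F.card : ℝ) * p := by positivity
  rw [← hFcard]
  rcases hR.eq_or_lt with h0 | h0
  · rw [← h0]; simp
  · refine (mul_le_mul_of_nonneg_right (Nat.cast_le.2 (Finset.card_le_card hsub)) hR).trans ?_
    refine le_of_mul_le_mul_right ?_ h0
    calc _ = _ := by ring
      _ ≤ _ := hcheb
      _ = _ := mul_comm _ _

/-- Let `m = ⌊N/3⌋`. If `1 ≤ log₂|𝒮| ≤ m^(1/4)`, then with probability tending to `1` as
`N → ∞`, a random generator `G : 𝒮 → {-1,1}^N` (entries independent uniform `±1`) satisfies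
`Φ̃ₖ(G) > (4/9)·√(N(log C(N,k) + k log|𝒮|))` for every `k` with `2 ≤ k ≤ N/(6 log₂|𝒮|)`. -/
theorem lower_bound_cross_correlation_small_seed_set :
    ∀ ε : ℝ, 0 < ε → ∃ N₀ : ℕ, ∀ N : ℕ, N₀ ≤ N →
    ∀ (S : Type) [Fintype S],
      1 ≤ Real.logb 2 (Fintype.card S) →
      Real.logb 2 (Fintype.card S) ≤ ((N / 3 : ℕ) : ℝ) ^ ((1 : ℝ) / 4) →
    (1 - ε) * (Nat.card (S → Fin N → Bool) : ℝ) ≤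
      ({G : S → Fin N → Bool |
        ∀ k : ℕ, 2 ≤ k → (k : ℝ) ≤ (N : ℝ) / (6 * Real.logb 2 (Fintype.card S)) →
          (4/9) * Real.sqrt ((N : ℝ) *
              (Real.log (N.choose k) + k * Real.log (Fintype.card S)))
            < (genCrossCorr k G : ℝ)}.ncard : ℝ) := by
  classical
  intro ε hε
  refine ⟨max (10 ^ 6) ⌈Real.exp (max 520 (-(100 * Real.log ε)))⌉₊, ?_⟩
  intro N hN S _ hS1 _
  have hN6 : 10 ^ 6 ≤ N := (le_max_left _ _).trans hN
  have hlog : max 520 (-(100 * Real.log ε)) ≤ Real.log N :=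
    (Real.le_log_iff_exp_le (by exact_mod_cast (by omega : 0 < N))).2
      (Nat.ceil_le.1 ((le_max_right _ _).trans hN))
  have hlog1 : 520 ≤ Real.log N := (le_max_left _ _).trans hlog
  have hεN : 1 ≤ ε * Real.exp (Real.log N / 100) := by
    have h1 : -(100 * Real.log ε) ≤ Real.log N := (le_max_right _ _).trans hlog
    rw [← Real.exp_log hε, ← Real.exp_add, Real.one_le_exp_iff]
    linarith
  set q := Fintype.card S with hq
  have hq2 : 2 ≤ q := by
    by_contra hlt
    have : q = 0 ∨ q = 1 := by omega
    rcases this with h | h <;> rw [h] at hS1 <;> norm_num at hS1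
  obtain ⟨s₀⟩ : Nonempty S := Fintype.card_pos_iff.1 (by omega)
  set Ω := S → Fin N → Bool with hΩ
  set τ : ℕ → ℕ := fun k => ⌊2 / 9 * √(N * (Real.log (N.choose k) + k * Real.log q))⌋₊ + 1 with hτ
  set K := (Finset.Ioc 1 N).filter fun k : ℕ => (k : ℝ) ≤ N / (6 * Real.logb 2 q) with hK
  set bad : ℕ → Finset Ω := fun k =>
    Finset.univ.filter fun G => genCrossCorr k G < 2 * τ k with hbad
  have hbadk : ∀ k ∈ K, ((bad k).card : ℝ) ≤ ε * Fintype.card Ω * ((k : ℝ) ^ 2)⁻¹ := by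
    intro k hk
    rw [hK, Finset.mem_filter, Finset.mem_Ioc] at hk
    have h1 := card_filter_genCrossCorr_lt_mul_le s₀ (N := N) (h := N / 3) (τ k)
      (show 2 ≤ k by omega) (by omega) (by omega)
    have h2 := sq_mul_exp_le_choose_mul hN6 hlog1 hq2 (show 2 ≤ k by omega) hk.2 (t := τ k) rfl
    have hk0 : (0 : ℝ) < k := by exact_mod_cast (by omega : 0 < k)
    have h3 := (mul_le_mul_of_nonneg_left h2 (Nat.cast_nonneg (bad k).card)).trans h1
    rw [le_mul_inv_iff₀ (by positivity)]
    calc ((bad k).card : ℝ) * (k : ℝ) ^ 2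
        ≤ (bad k).card * (k : ℝ) ^ 2 * (ε * Real.exp (Real.log N / 100)) :=
          le_mul_of_one_le_right (by positivity) hεN
      _ = ε * ((bad k).card * ((k : ℝ) ^ 2 * Real.exp (Real.log N / 100))) := by ring
      _ ≤ _ := mul_le_mul_of_nonneg_left h3 hε.le
  have hbadcard : ((K.biUnion bad).card : ℝ) ≤ ε * Fintype.card Ω := by
    calc ((K.biUnion bad).card : ℝ) ≤ ∑ k ∈ K, ((bad k).card : ℝ) := by
          exact_mod_cast Finset.card_biUnion_le
      _ ≤ ∑ k ∈ K, ε * Fintype.card Ω * ((k : ℝ) ^ 2)⁻¹ := Finset.sum_le_sum hbadk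
      _ ≤ ∑ k ∈ Finset.Ioc 1 N, ε * Fintype.card Ω * ((k : ℝ) ^ 2)⁻¹ :=
          Finset.sum_le_sum_of_subset_of_nonneg (Finset.filter_subset _ _)
            fun _ _ _ => by positivity
      _ = ε * Fintype.card Ω * ∑ k ∈ Finset.Ioc 1 N, ((k : ℝ) ^ 2)⁻¹ := by rw [Finset.mul_sum]
      _ ≤ ε * Fintype.card Ω * 1 := by
          refine mul_le_mul_of_nonneg_left ?_ (by positivity)
          have h1 := sum_Ioc_inv_sq_le_sub (α := ℝ) one_ne_zero (show 1 ≤ N by omega)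
          have h2 : (0 : ℝ) ≤ (N : ℝ)⁻¹ := by positivity
          rw [Nat.cast_one, inv_one] at h1
          linarith
      _ = _ := mul_one _
  have hsub : (((K.biUnion bad)ᶜ : Finset Ω) : Set Ω) ⊆ {G : S → Fin N → Bool |
        ∀ k : ℕ, 2 ≤ k → (k : ℝ) ≤ (N : ℝ) / (6 * Real.logb 2 q) →
          (4/9) * Real.sqrt ((N : ℝ) *
              (Real.log (N.choose k) + k * Real.log q))
            < (genCrossCorr k G : ℝ)} := by
    intro G hG k hk2 hkN
    have hkN' : k ≤ N := by
      have : (N : ℝ) / (6 * Real.logb 2 q) ≤ N :=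
        div_le_self (Nat.cast_nonneg N) (by linarith)
      exact_mod_cast hkN.trans this
    have hkK : k ∈ K := Finset.mem_filter.2 ⟨Finset.mem_Ioc.2 ⟨by omega, hkN'⟩, hkN⟩
    have hG' : G ∉ K.biUnion bad := by simpa using hG
    have hGk : ¬ genCrossCorr k G < 2 * τ k := fun h =>
      hG' (Finset.mem_biUnion.2 ⟨k, hkK, Finset.mem_filter.2 ⟨Finset.mem_univ _, h⟩⟩)
    have h1 : (2 * (τ k : ℝ)) ≤ genCrossCorr k G := by exact_mod_cast not_lt.1 hGk
    have h2 := Nat.lt_floor_add_one (2 / 9 * √(N * (Real.log (N.choose k) + k * Real.log q)))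
    rw [hτ] at h1
    push_cast at h1
    linarith
  have hle := Set.ncard_le_ncard hsub (Set.toFinite _)
  rw [Set.ncard_coe_finset, Finset.card_compl] at hle
  refine le_trans ?_ (Nat.cast_le.2 hle)
  rw [Nat.cast_sub (Finset.card_le_univ _), Nat.card_eq_fintype_card]
  linarith
end

section
/- Let m = ⌊N/3⌋ and let 𝒮 be a finite seed set with m^{1/4} < log₂|𝒮| < N/12. Let G : 𝒮 → {-1,1}^N be a random generator whose entries e_n(s) are independent uniform ±1 random variables. Then with probability tending to 1 as N → ∞ one has Φ̃_k(G) > (4/9)·√(N·(k·log N + log C(|𝒮|,k))) for every integer k with 2 ≤ k ≤ N/(6·log₂|𝒮|). -/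
theorem card_mul_sum_comp_monoidHom {Ω K : Type*} [Group Ω] [Fintype Ω] [Group K] [Fintype K]
    (φ : Ω →* K) (hφ : Function.Surjective φ) (F : K → ℝ) :
    (Fintype.card K : ℝ) * ∑ g, F (φ g) = Fintype.card Ω * ∑ u, F u := by
  choose σ hσ using hφ
  have h1 : ∀ u, ∑ g, F (φ g) = ∑ g, F (u * φ g) := fun u => by
    rw [← Equiv.sum_comp (Equiv.mulLeft (σ u))]
    simp [hσ]
  have h2 : ∑ _u : K, ∑ g, F (φ g) = ∑ u, ∑ g, F (u * φ g) :=
    Finset.sum_congr rfl fun u _ => h1 u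
  have h3 : ∀ g, ∑ u, F (u * φ g) = ∑ u, F u := fun g =>
    Equiv.sum_comp (Equiv.mulRight (φ g)) F
  replace h2 := h2.trans Finset.sum_comm
  simp only [h3, Finset.sum_const, Finset.card_univ, nsmul_eq_mul] at h2
  exact h2

/-- Multiplying together the values of a function on a finset, as a homomorphism. -/
def prodHom (S H : Type*) [CommGroup H] (A : Finset S) : (S → H) →* H where
  toFun G := ∏ s ∈ A, G s
  map_one' := by simp
  map_mul' _ _ := by simp [Finset.prod_mul_distrib]

theorem prodHom_mulSingle {S H : Type*} [DecidableEq S] [CommGroup H] (A : Finset S) (a : S)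
    (u : H) : prodHom S H A (Pi.mulSingle a u) = if a ∈ A then u else 1 := by
  simp [prodHom]

theorem prodHom_surjective {S H : Type*} [CommGroup H] {A : Finset S} (hA : A.Nonempty) :
    Function.Surjective (prodHom S H A) := by
  classical
  obtain ⟨a, ha⟩ := hA
  exact fun u => ⟨Pi.mulSingle a u, by simp [prodHom_mulSingle, ha]⟩

theorem prodHom_prod_surjective {S H : Type*} [CommGroup H] {A B : Finset S}
    (hcard : A.card = B.card) (hne : A ≠ B) :
    Function.Surjective ((prodHom S H A).prod (prodHom S H B)) := by
  classical
  obtain ⟨a, haA, haB⟩ : ∃ a ∈ A, a ∉ B := by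
    by_contra! h
    exact hne (Finset.eq_of_subset_of_card_le h hcard.ge)
  obtain ⟨b, hbB, hbA⟩ : ∃ b ∈ B, b ∉ A := by
    by_contra! h
    exact hne (Finset.eq_of_subset_of_card_le h hcard.le).symm
  rintro ⟨u, v⟩
  refine ⟨Pi.mulSingle a u * Pi.mulSingle b v, ?_⟩
  simp [prodHom_mulSingle, haA, haB, hbA, hbB]

/-- Second moment bound: few maps `G : S → H` have no `k`-subset product in `P`. -/
theorem card_forall_prodHom_notMem_mul_le {S H : Type*} [Fintype S] [DecidableEq S] [CommGroup H]
    [Fintype H] [DecidableEq H] {k : ℕ} (hk : 1 ≤ k) (P : Finset H) :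
    (({G : S → H | ∀ A : Finset S, A.card = k → prodHom S H A G ∉ P} : Finset (S → H)).card : ℝ) *
      ((Fintype.card S).choose k * P.card) ≤ Fintype.card (S → H) * Fintype.card H := by
  set bad : Finset (S → H) := {G | ∀ A : Finset S, A.card = k → prodHom S H A G ∉ P}
  set Q : Finset (Finset S) := Finset.powersetCard k Finset.univ
  have hQ : (Q.card : ℝ) = (Fintype.card S).choose k := by simp [Q]
  have hmem : ∀ A ∈ Q, A.card = k := fun A hA => (Finset.mem_powersetCard.1 hA).2
  have hHpos : (0 : ℝ) < Fintype.card H := by exact_mod_cast Fintype.card_pos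
  set h : ℝ := (Fintype.card H : ℝ)
  set ω : ℝ := (Fintype.card (S → H) : ℝ)
  set p : ℝ := P.card / h with hp
  have hp0 : 0 ≤ p := by positivity
  have hph : p * h = P.card := by rw [hp]; field_simp
  set g : H → ℝ := fun u => (if u ∈ P then 1 else 0) - p with hg
  have hg0 : ∑ u, g u = 0 := by
    simp only [hg, Finset.sum_sub_distrib, Finset.sum_const, Finset.card_univ, nsmul_eq_mul]
    simp
    linarith
  have hg2 : ∑ u, g u * g u ≤ p * h := by
    have : ∀ u, g u * g u ≤ (if u ∈ P then 1 else 0) - p * g u - p * (if u ∈ P then 1 else 0) := by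
      intro u
      simp only [hg]
      split_ifs <;> nlinarith
    refine (Finset.sum_le_sum fun u _ => this u).trans ?_
    rw [Finset.sum_sub_distrib, Finset.sum_sub_distrib, ← Finset.mul_sum, ← Finset.mul_sum, hg0]
    simp
    nlinarith [(Nat.cast_nonneg P.card : (0 : ℝ) ≤ P.card)]
  have hoff : ∀ A ∈ Q, ∀ B ∈ Q, A ≠ B →
      ∑ G, g (prodHom S H A G) * g (prodHom S H B G) = 0 := by
    intro A hA B hB hne
    have := card_mul_sum_comp_monoidHom _
      (prodHom_prod_surjective (H := H) ((hmem A hA).trans (hmem B hB).symm) hne)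
      (fun z => g z.1 * g z.2)
    simp only [MonoidHom.prod_apply, Fintype.sum_prod_type, ← Finset.mul_sum, hg0, mul_zero,
      Finset.sum_const_zero] at this
    refine (mul_eq_zero.1 this).resolve_left ?_
    simp
  have hdiag : ∀ A ∈ Q, ∑ G, g (prodHom S H A G) * g (prodHom S H A G) ≤ ω * p := by
    intro A hA
    have := card_mul_sum_comp_monoidHom _
      (prodHom_surjective (H := H) (A := A) (Finset.card_pos.1 (by rw [hmem A hA]; omega)))
      (fun z => g z * g z)
    have h2 : h * ∑ G, g (prodHom S H A G) * g (prodHom S H A G) ≤ h * (ω * p) := by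
      rw [this]
      calc ω * ∑ u, g u * g u ≤ ω * (p * h) := by gcongr
        _ = _ := by ring
    exact le_of_mul_le_mul_left h2 hHpos
  have hsecond : ∑ G, (∑ A ∈ Q, g (prodHom S H A G)) ^ 2 ≤ Q.card * (ω * p) := by
    simp_rw [sq, Finset.sum_mul_sum]
    rw [Finset.sum_comm, ← nsmul_eq_mul]
    refine Finset.sum_le_card_nsmul _ _ _ fun A hA => ?_
    rw [Finset.sum_comm, Finset.sum_eq_single A (fun B hB hBA => hoff A hA B hB hBA.symm)
      (fun hn => absurd hA hn)]
    exact hdiag A hA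
  have hlow : bad.card * (Q.card * p) ^ 2 ≤ ∑ G, (∑ A ∈ Q, g (prodHom S H A G)) ^ 2 := by
    rw [← nsmul_eq_mul]
    refine (Finset.card_nsmul_le_sum bad _ _ fun G hG => ?_).trans
      (Finset.sum_le_sum_of_subset_of_nonneg (Finset.subset_univ _) fun _ _ _ => sq_nonneg _)
    have hG' : ∀ A ∈ Q, g (prodHom S H A G) = -p := fun A hA => by
      have := (Finset.mem_filter.1 hG).2 A (hmem A hA)
      simp [hg, this]
    rw [Finset.sum_congr rfl hG']
    simp
  rw [← hQ, ← hph]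
  rcases (mul_nonneg (Nat.cast_nonneg (α := ℝ) Q.card) hp0).eq_or_lt with h0 | h0
  · rw [← mul_assoc (Q.card : ℝ), ← h0]
    simp only [zero_mul, mul_zero]
    positivity
  · have : bad.card * (Q.card * p) ≤ ω := by
      refine le_of_mul_le_mul_right ?_ h0
      linarith [hlow.trans hsecond]
    calc bad.card * (Q.card * (p * h)) = bad.card * (Q.card * p) * h := by ring
      _ ≤ _ := by gcongr

theorem sum_fin_units_succ {n : ℕ} (F : (Fin (n + 1) → ℤˣ) → ℝ) :
    ∑ x, F x = ∑ x : Fin n → ℤˣ, (F (Fin.cons 1 x) + F (Fin.cons (-1) x)) := by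
  rw [← Equiv.sum_comp (Fin.consEquiv fun _ => ℤˣ), Fintype.sum_prod_type]
  simp [UnitsInt.univ, Fin.consEquiv, Finset.sum_add_distrib]

theorem sum_prod_one_add (n : ℕ) (δ : ℝ) :
    ∑ x : Fin n → ℤˣ, ∏ i, (1 + δ * ((x i : ℤ) : ℝ)) = 2 ^ n := by
  induction n with
  | zero => simp
  | succ n ih =>
    rw [sum_fin_units_succ, pow_succ, ← ih, Finset.sum_mul]
    refine Finset.sum_congr rfl fun x _ => ?_
    simp only [Fin.prod_univ_succ, Fin.cons_zero, Fin.cons_succ]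
    push_cast
    ring

theorem sum_prod_one_add_mul_sq (n : ℕ) (δ c : ℝ) :
    ∑ x : Fin n → ℤˣ, (∏ i, (1 + δ * ((x i : ℤ) : ℝ))) * (∑ i, ((x i : ℤ) : ℝ) - δ * n + c) ^ 2 =
      2 ^ n * (n * (1 - δ ^ 2) + c ^ 2) := by
  induction n generalizing c with
  | zero => simp
  | succ n ih =>
    have e1 := ih (1 - δ + c)
    have e2 := ih (-1 - δ + c)
    rw [sum_fin_units_succ]
    calc _ = (1 + δ) * ∑ x : Fin n → ℤˣ, (∏ i, (1 + δ * ((x i : ℤ) : ℝ))) *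
            (∑ i, ((x i : ℤ) : ℝ) - δ * n + (1 - δ + c)) ^ 2 +
          (1 - δ) * ∑ x : Fin n → ℤˣ, (∏ i, (1 + δ * ((x i : ℤ) : ℝ))) *
            (∑ i, ((x i : ℤ) : ℝ) - δ * n + (-1 - δ + c)) ^ 2 := by
          rw [Finset.mul_sum, Finset.mul_sum, ← Finset.sum_add_distrib]
          refine Finset.sum_congr rfl fun x _ => ?_
          simp only [Fin.prod_univ_succ, Fin.sum_univ_succ, Fin.cons_zero, Fin.cons_succ]
          push_cast
          ring
      _ = _ := by
          rw [e1, e2]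
          push_cast
          ring

/-- Lower bound for the upper tail of a sum of independent signs. -/
theorem two_pow_le_card_lt_sum_mul_exp {n : ℕ} (hn : 0 < n) {δ : ℝ} (h0 : 0 ≤ δ) (h1 : δ ≤ 1) :
    (2 : ℝ) ^ n ≤ (({x : Fin n → ℤˣ | δ * n - √(2 * n) < ∑ i, ((x i : ℤ) : ℝ)} :
        Finset (Fin n → ℤˣ)).card : ℝ) * (2 * Real.exp (δ ^ 2 * n + δ * √(2 * n))) := by
  set E := Real.exp (δ ^ 2 * n + δ * √(2 * n)) with hE
  have hn' : (0 : ℝ) < n := by exact_mod_cast hn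
  have hr : √(2 * (n : ℝ)) ^ 2 = 2 * n := Real.sq_sqrt (by positivity)
  have hr0 := Real.sqrt_nonneg (2 * (n : ℝ))
  have hpt : ∀ x : Fin n → ℤˣ, ∏ i, (1 + δ * ((x i : ℤ) : ℝ)) ≤
      (if δ * n - √(2 * n) < ∑ i, ((x i : ℤ) : ℝ) then 1 else 0) * E +
      ((∏ i, (1 + δ * ((x i : ℤ) : ℝ))) * (∑ i, ((x i : ℤ) : ℝ) - δ * n + 0) ^ 2) / (2 * n) := by
    intro x
    set s := ∑ i, ((x i : ℤ) : ℝ) with hs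
    have hfac : ∀ i, 0 ≤ 1 + δ * ((x i : ℤ) : ℝ) := fun i => by
      rcases Int.units_eq_one_or (x i) with h | h <;> rw [h] <;> push_cast <;> linarith
    have hw0 : 0 ≤ ∏ i, (1 + δ * ((x i : ℤ) : ℝ)) := Finset.prod_nonneg fun i _ => hfac i
    have hwe : ∏ i, (1 + δ * ((x i : ℤ) : ℝ)) ≤ Real.exp (δ * s) := by
      rw [hs, Finset.mul_sum, Real.exp_sum]
      refine Finset.prod_le_prod (fun i _ => hfac i) fun i _ => ?_
      rw [add_comm]
      exact Real.add_one_le_exp _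
    set w := ∏ i, (1 + δ * ((x i : ℤ) : ℝ))
    by_cases hc : 2 * n ≤ (s - δ * n + 0) ^ 2
    · have : w ≤ w * (s - δ * n + 0) ^ 2 / (2 * n) := by
        rw [le_div_iff₀ (by positivity)]
        gcongr
      have : 0 ≤ (if δ * n - √(2 * n) < s then (1 : ℝ) else 0) * E := by positivity
      linarith
    · push Not at hc
      rw [add_zero, ← hr, sq_lt_sq, abs_of_nonneg hr0, abs_lt] at hc
      rw [if_pos (by linarith)]
      have : w ≤ E := hwe.trans <| Real.exp_le_exp.2 <| by nlinarith
      have : 0 ≤ w * (s - δ * n + 0) ^ 2 / (2 * n) := by positivity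
      linarith
  have hsum := Finset.sum_le_sum fun x (_ : x ∈ Finset.univ) => hpt x
  rw [sum_prod_one_add, Finset.sum_add_distrib, ← Finset.sum_mul, ← Finset.sum_div,
    sum_prod_one_add_mul_sq, Finset.sum_boole] at hsum
  have : (2 : ℝ) ^ n * (n * (1 - δ ^ 2) + 0 ^ 2) / (2 * n) ≤ 2 ^ n / 2 := by
    rw [div_le_div_iff₀ (by positivity) (by positivity)]
    have : (0 : ℝ) ≤ 2 ^ n * n * δ ^ 2 := by positivity
    nlinarith
  linarith

theorem mul_log_le_log_choose {N k c : ℕ} (hN : 2 ≤ N) (hkN : k ≤ N)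
    (hc : N ^ 10 ≤ c) : 8 * (k * Real.log N) ≤ Real.log (c.choose k) := by
  have h1 : N ^ 9 ≤ c + 1 - k := by
    have : 2 * N ^ 9 ≤ N ^ 10 := by rw [pow_succ N 9]; nlinarith [pow_pos (by omega : 0 < N) 9]
    have : N ≤ N ^ 9 := Nat.le_self_pow (by norm_num) N
    omega
  have hN0 : (0 : ℝ) < N := by positivity
  have h2 : ((N : ℝ) ^ 8) ^ k ≤ c.choose k := by
    refine le_trans ?_ (Nat.pow_le_choose k c)
    rw [le_div_iff₀ (by positivity)]
    calc ((N : ℝ) ^ 8) ^ k * k.factorial ≤ ((N : ℝ) ^ 8) ^ k * (N : ℝ) ^ k := by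
          gcongr
          exact_mod_cast (Nat.factorial_le_pow k).trans (Nat.pow_le_pow_left hkN k)
      _ = ((N ^ 9 : ℕ) : ℝ) ^ k := by push_cast; rw [← mul_pow]; ring
      _ ≤ _ := by gcongr
  have h3 := Real.log_le_log (by positivity) h2
  rw [Real.log_pow, Real.log_pow] at h3
  push_cast at h3
  linarith

theorem log_choose_le_mul_log {c k : ℕ} : Real.log (c.choose k) ≤ k * Real.log c := by
  rcases (c.choose k).eq_zero_or_pos with h | h
  · rw [h]
    simp only [Nat.cast_zero, Real.log_zero]
    exact mul_nonneg (by positivity) (Real.log_natCast_nonneg c)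
  · rw [← Real.log_pow]
    exact Real.log_le_log (by exact_mod_cast h) (by exact_mod_cast Nat.choose_le_pow c k)

theorem exists_tilt {N k c : ℕ} (hlog : 4 ≤ Real.log N) (hc : N ^ 10 ≤ c) (hk : 2 ≤ k)
    (hkN : k ≤ N) (hkc : 6 * (k * Real.log c) ≤ N) :
    ∃ δ : ℝ, 0 ≤ δ ∧ δ ≤ 1 ∧
      δ * N - √(2 * N) = 4 / 9 * √(N * (k * Real.log N + Real.log (c.choose k))) ∧
      (N : ℝ) ^ 2 * (2 * Real.exp (δ ^ 2 * N + δ * √(2 * N))) ≤ c.choose k := by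
  have hN10 : (10 : ℝ) ≤ N := by
    by_contra! h
    have h0 : (0 : ℝ) < N := by
      rcases N.eq_zero_or_pos with h | h
      · simp [h] at hlog; linarith
      · exact_mod_cast h
    have h1 : Real.log N ≤ Real.log (Real.exp 1 ^ 3) :=
      Real.log_le_log h0 (by nlinarith [Real.exp_one_gt_d9, sq_nonneg (Real.exp 1 - 2.7)])
    rw [Real.log_pow, Real.log_exp] at h1
    norm_num at h1
    linarith
  have hN2 : 2 ≤ N := by exact_mod_cast (by linarith : (2 : ℝ) ≤ N)
  have hlow := mul_log_le_log_choose hN2 hkN hc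
  have hup := log_choose_le_mul_log (c := c) (k := k)
  set l := Real.log (c.choose k) with hl
  set a := k * Real.log N with ha
  have hk' : (2 : ℝ) ≤ k := by exact_mod_cast hk
  have ha8 : 2 * Real.log N ≤ a := by rw [ha]; gcongr
  have hN0 : (0 : ℝ) < N := by linarith
  set r := √(N : ℝ) with hr
  have hr0 : 0 < r := Real.sqrt_pos.2 hN0
  have hrr : r * r = N := Real.mul_self_sqrt hN0.le
  set q := √(2 : ℝ) with hq
  have hq0 : 0 ≤ q := Real.sqrt_nonneg _
  have hqq : q * q = 2 := Real.mul_self_sqrt (by norm_num)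
  set z := √(a + l) with hz
  have hz0 : 0 ≤ z := Real.sqrt_nonneg _
  have hzz : z * z = a + l := Real.mul_self_sqrt (by linarith)
  have e2 : √(2 * (N : ℝ)) = q * r := Real.sqrt_mul (by norm_num) _
  have ez : √((N : ℝ) * (a + l)) = r * z := Real.sqrt_mul hN0.le _
  set y := 4 / 9 * z + q with hy
  have hy0 : 0 ≤ y := by positivity
  have hyy : y * y ≤ 32 / 81 * (a + l) + 4 := by
    nlinarith [mul_self_nonneg (4 / 9 * z - q)]
  have hδr : y / r * r = y := div_mul_cancel₀ _ hr0.ne'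
  refine ⟨y / r, by positivity, ?_, ?_, ?_⟩
  · rw [div_le_one hr0]
    refine abs_le_of_sq_le_sq' ?_ hr0.le |>.2
    nlinarith
  · rw [e2, ez, ← hrr, ← mul_assoc, hδr, hy]
    ring
  · have e : (y / r) ^ 2 * N + y / r * √(2 * N) = y * y + y * q := by
      rw [e2, ← hrr]
      calc _ = (y / r * r) ^ 2 + (y / r * r) * q := by ring
        _ = _ := by rw [hδr]; ring
    have hcpos : (0 : ℝ) < c.choose k := by
      by_contra! h
      have : l ≤ 0 := by rw [hl, le_antisymm h (by positivity)]; simp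
      linarith
    rw [e, ← Real.log_le_log_iff (by positivity) hcpos, Real.log_mul (by positivity) (by positivity),
      Real.log_mul (by positivity) (by positivity), Real.log_pow, Real.log_exp, ← hl]
    have := Real.log_two_lt_d9
    push_cast
    nlinarith [mul_self_nonneg (y - q)]

theorem eventually_log_le :
    ∃ N₀ : ℕ, ∀ N : ℕ, N₀ ≤ N → 4 ≤ Real.log N ∧
      10 * Real.log N ≤ Real.log 2 * ((N / 3 : ℕ) : ℝ) ^ ((1 : ℝ) / 4) := by
  have h1 := (isLittleO_log_rpow_atTop (r := 1 / 4) (by norm_num)).bound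
    (show (0 : ℝ) < 1 / 40 by norm_num)
  have ht : Filter.Tendsto (fun N : ℕ => ((N / 3 : ℕ) : ℝ)) Filter.atTop Filter.atTop :=
    tendsto_natCast_atTop_atTop.comp (Nat.tendsto_div_const_atTop (by norm_num))
  have h2 := (Real.tendsto_log_atTop.comp tendsto_natCast_atTop_atTop).eventually_ge_atTop (4 : ℝ)
  obtain ⟨N₀, h⟩ := Filter.eventually_atTop.1
    ((ht.eventually h1).and (h2.and (Filter.eventually_ge_atTop 12)))
  refine ⟨N₀, fun N hN => ?_⟩
  obtain ⟨h1, h2, h3⟩ := h N hN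
  refine ⟨h2, ?_⟩
  have hm : N ≤ (N / 3) ^ 2 := by
    have : 4 ≤ N / 3 := by omega
    have : N ≤ 3 * (N / 3) + 2 := by omega
    nlinarith
  set m := N / 3
  rw [Real.norm_of_nonneg (Real.log_natCast_nonneg m),
    Real.norm_of_nonneg (by positivity)] at h1
  have h4 : Real.log N ≤ 2 * Real.log m := by
    have := Real.log_le_log (show (0 : ℝ) < N by norm_cast; omega)
      (show (N : ℝ) ≤ (m : ℝ) ^ 2 by exact_mod_cast hm)
    rwa [Real.log_pow] at this
  have h5 : (0 : ℝ) ≤ (m : ℝ) ^ ((1 : ℝ) / 4) := by positivity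
  nlinarith [Real.log_two_gt_d9]

theorem natAbs_pmVal (b : Bool) : (pmVal b).natAbs = 1 := by cases b <;> rfl

theorem natAbs_seqAt {N : ℕ} (E : Fin N → Bool) (t : ℕ) : (seqAt E t).natAbs = 1 := by
  unfold seqAt
  split_ifs
  · exact natAbs_pmVal _
  · rfl

/-- Booleans as units of `ℤ`, compatibly with `pmVal`. -/
def boolEquivUnits : Bool ≃ ℤˣ where
  toFun b := if b then 1 else -1
  invFun u := decide (u = 1)
  left_inv b := by cases b <;> rfl
  right_inv u := by rcases Int.units_eq_one_or u with rfl | rfl <;> rfl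

theorem coe_boolEquivUnits (b : Bool) : ((boolEquivUnits b : ℤˣ) : ℤ) = pmVal b := by
  cases b <;> rfl

/-- Generators with Boolean entries as generators with entries in `ℤˣ`. -/
def genEquivUnits (S : Type*) (N : ℕ) : (S → Fin N → Bool) ≃ (S → Fin N → ℤˣ) :=
  Equiv.piCongrRight fun _ => Equiv.piCongrRight fun _ => boolEquivUnits

theorem sum_prodHom_le_genCrossCorr {S : Type*} {N k : ℕ} (hN : 1 ≤ N) (hk : 1 ≤ k)
    (G : S → Fin N → Bool) {A : Finset S} (hA : A.card = k) :
    ∑ n, ((prodHom S (Fin N → ℤˣ) A (genEquivUnits S N G) n : ℤˣ) : ℤ) ≤ genCrossCorr k G := by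
  set e := A.equivFinOfCardEq hA
  have hmem : (∑ n, ((prodHom S (Fin N → ℤˣ) A (genEquivUnits S N G) n : ℤˣ) : ℤ)).natAbs ∈
      genCorrSet k G := by
    refine ⟨k, fun _ => 1, fun i => (e.symm i : S), N, fun _ _ => 0, hk, fun _ => le_rfl,
      by simp, Subtype.val_injective.comp e.symm.injective, hN,
      fun _ => Subsingleton.strictMono _, by simp, ?_⟩
    rw [← Fin.sum_univ_eq_sum_range
      (fun n => ∏ i : Fin k, ∏ _j : Fin 1, seqAt (G (e.symm i)) (n + 0))]
    congr 1
    refine Finset.sum_congr rfl fun n _ => ?_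
    rw [Equiv.prod_comp e.symm (fun a : A => ∏ _j : Fin 1, seqAt (G a) (n + 0)),
      Finset.prod_coe_sort A (fun a => ∏ _j : Fin 1, seqAt (G a) (n + 0))]
    simp [prodHom, Finset.prod_apply, genEquivUnits, coe_boolEquivUnits, seqAt]
  exact Int.le_natAbs.trans (by exact_mod_cast le_csSup (bddAbove_genCorrSet k G) hmem)

/-- Few generators have small cross-correlation of a given order `k`. -/
theorem sq_mul_ncard_genCrossCorr_le {S : Type*} [Fintype S] {N k : ℕ}
    (hlog : 4 ≤ Real.log N) (hc : N ^ 10 ≤ Fintype.card S) (hk : 2 ≤ k) (hkN : k ≤ N)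
    (hkc : 6 * (k * Real.log (Fintype.card S)) ≤ N) :
    (N : ℝ) ^ 2 * ({G : S → Fin N → Bool | (genCrossCorr k G : ℝ) ≤
      4 / 9 * √(N * (k * Real.log N + Real.log ((Fintype.card S).choose k)))}.ncard : ℝ) ≤
      Nat.card (S → Fin N → Bool) := by
  classical
  have hN : 0 < N := by omega
  obtain ⟨δ, h0, h1, hT, hC⟩ := exists_tilt hlog hc hk hkN hkc
  rw [← hT]
  set P : Finset (Fin N → ℤˣ) := {x | δ * N - √(2 * N) < ∑ i, ((x i : ℤ) : ℝ)}
  have htail : (2 : ℝ) ^ N ≤ P.card * (2 * Real.exp (δ ^ 2 * N + δ * √(2 * N))) :=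
    two_pow_le_card_lt_sum_mul_exp hN h0 h1
  have hsecond := card_forall_prodHom_notMem_mul_le (S := S) (by omega : 1 ≤ k) P
  set bad : Finset (S → Fin N → ℤˣ) :=
    {G | ∀ A : Finset S, A.card = k → prodHom S (Fin N → ℤˣ) A G ∉ P}
  set C : ℝ := ((Fintype.card S).choose k : ℝ)
  set E := 2 * Real.exp (δ ^ 2 * N + δ * √(2 * N)) with hE
  have hE0 : 0 < E := by positivity
  have hcardH : (Fintype.card (Fin N → ℤˣ) : ℝ) = 2 ^ N := by simp
  have hcardΩ : (Fintype.card (S → Fin N → ℤˣ) : ℝ) = Nat.card (S → Fin N → Bool) := by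
    rw [Nat.card_congr (genEquivUnits S N), Nat.card_eq_fintype_card]
  rw [hcardH, hcardΩ] at hsecond
  have hle : {G : S → Fin N → Bool | (genCrossCorr k G : ℝ) ≤ δ * N - √(2 * N)}.ncard ≤
      bad.card := by
    rw [← Set.ncard_coe_finset]
    refine Set.ncard_le_ncard_of_injOn (genEquivUnits S N) (fun G hG => ?_)
      (genEquivUnits S N).injective.injOn
    simp only [bad, Finset.coe_filter, Finset.mem_univ, true_and, Set.mem_ofPred_eq]
    intro A hA hmem
    have hlt := (Finset.mem_filter.1 hmem).2
    have hle : (∑ n, ((prodHom S (Fin N → ℤˣ) A (genEquivUnits S N G) n : ℤ) : ℝ)) ≤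
        genCrossCorr k G := by
      exact_mod_cast sum_prodHom_le_genCrossCorr hN (by omega) G hA
    exact absurd hlt (not_lt.2 (hle.trans hG))
  have hle' : ({G : S → Fin N → Bool | (genCrossCorr k G : ℝ) ≤ δ * N - √(2 * N)}.ncard : ℝ) ≤
      bad.card := by exact_mod_cast hle
  refine (mul_le_mul_of_nonneg_left hle' (by positivity)).trans ?_
  have h2 : (0 : ℝ) < E * 2 ^ N := by positivity
  refine le_of_mul_le_mul_right ?_ h2
  calc (N : ℝ) ^ 2 * bad.card * (E * 2 ^ N) = (N ^ 2 * E) * (bad.card * 2 ^ N) := by ring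
    _ ≤ C * (bad.card * (P.card * E)) := by gcongr
    _ = bad.card * (C * P.card) * E := by ring
    _ ≤ (Nat.card (S → Fin N → Bool) * 2 ^ N) * E := by gcongr
    _ = _ := by ring


/-- Let `m = ⌊N/3⌋`. If `m^(1/4) < log₂|𝒮| < N/12`, then with probability tending to `1` as
`N → ∞`, a random generator `G : 𝒮 → {-1,1}^N` (entries independent uniform `±1`) satisfies
`Φ̃ₖ(G) > (4/9)·√(N(k log N + log C(|𝒮|,k)))` for every `k` with `2 ≤ k ≤ N/(6 log₂|𝒮|)`. -/
theorem lower_bound_cross_correlation_large_seed_set :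
    ∀ ε : ℝ, 0 < ε → ∃ N₀ : ℕ, ∀ N : ℕ, N₀ ≤ N →
    ∀ (S : Type) [Fintype S],
      ((N / 3 : ℕ) : ℝ) ^ ((1 : ℝ) / 4) < Real.logb 2 (Fintype.card S) →
      Real.logb 2 (Fintype.card S) < (N : ℝ) / 12 →
    (1 - ε) * (Nat.card (S → Fin N → Bool) : ℝ) ≤
      ({G : S → Fin N → Bool |
        ∀ k : ℕ, 2 ≤ k → (k : ℝ) ≤ (N : ℝ) / (6 * Real.logb 2 (Fintype.card S)) →
          (4/9) * Real.sqrt ((N : ℝ) *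
              (k * Real.log N + Real.log ((Fintype.card S).choose k)))
            < (genCrossCorr k G : ℝ)}.ncard : ℝ) := by
  intro ε hε
  obtain ⟨N₁, hN₁⟩ := eventually_log_le
  obtain ⟨N₂, hN₂⟩ := exists_nat_ge (1 / ε)
  refine ⟨max N₁ (max N₂ 3), fun N hN S _ hlow _ => ?_⟩
  obtain ⟨h1, h2, h3⟩ : N₁ ≤ N ∧ N₂ ≤ N ∧ 3 ≤ N := by simpa using hN
  obtain ⟨hlog4, hlog⟩ := hN₁ N h1
  have hN0 : (0 : ℝ) < N := by positivity
  have hεN : 1 ≤ ε * N := by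
    have : 1 / ε ≤ N := hN₂.trans (by exact_mod_cast h2)
    rwa [div_le_iff₀' hε] at this
  set c := Fintype.card S
  have hl2 : 0 < Real.log 2 := Real.log_pos one_lt_two
  have hL1 : 1 ≤ Real.logb 2 c := by
    refine le_trans ?_ hlow.le
    refine Real.one_le_rpow ?_ (by norm_num)
    exact_mod_cast (by omega : 1 ≤ N / 3)
  have hLc : Real.log c = Real.log 2 * Real.logb 2 c := by
    rw [Real.logb]
    field_simp
  have hc0 : (0 : ℝ) < c := by
    refine (Nat.cast_nonneg c).lt_of_ne' fun h => ?_
    rw [h] at hL1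
    norm_num at hL1
  have hc : N ^ 10 ≤ c := by
    have : Real.log ((N : ℝ) ^ 10) ≤ Real.log c := by
      rw [Real.log_pow, hLc]
      push_cast
      exact hlog.trans (by gcongr)
    exact_mod_cast (Real.log_le_log_iff (by positivity) hc0).1 this
  set T : ℕ → ℝ := fun k => 4 / 9 * √(N * (k * Real.log N + Real.log (c.choose k)))
  set good : Set (S → Fin N → Bool) := {G | ∀ k : ℕ, 2 ≤ k →
    (k : ℝ) ≤ (N : ℝ) / (6 * Real.logb 2 c) → T k < (genCrossCorr k G : ℝ)}
  set ω : ℝ := (Nat.card (S → Fin N → Bool) : ℝ)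
  set K : Finset ℕ := {k ∈ Finset.Icc 2 N | (k : ℝ) ≤ (N : ℝ) / (6 * Real.logb 2 c)}
  set bad : ℕ → Set (S → Fin N → Bool) := fun k => {G | (genCrossCorr k G : ℝ) ≤ T k}
  have hbad : ∀ k ∈ K, (N : ℝ) ^ 2 * (bad k).ncard ≤ ω := by
    intro k hk
    obtain ⟨hk1, hk2⟩ := Finset.mem_filter.1 hk
    obtain ⟨hk2', hkN⟩ := Finset.mem_Icc.1 hk1
    refine sq_mul_ncard_genCrossCorr_le hlog4 hc hk2' hkN ?_
    rw [le_div_iff₀ (by positivity)] at hk2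
    have : Real.log c ≤ Real.logb 2 c := by
      rw [hLc]
      nlinarith [Real.log_two_lt_d9]
    calc 6 * (k * Real.log c) ≤ 6 * (k * Real.logb 2 c) := by gcongr
      _ ≤ N := by linarith
  have hcover : goodᶜ ⊆ ⋃ k ∈ K, bad k := by
    intro G hG
    simp only [good, Set.mem_compl_iff, Set.mem_ofPred_eq, not_forall, not_lt] at hG
    obtain ⟨k, hk2, hkN, hle⟩ := hG
    refine Set.mem_biUnion (x := k) ?_ hle
    refine Finset.mem_filter.2 ⟨Finset.mem_Icc.2 ⟨hk2, ?_⟩, hkN⟩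
    have : (k : ℝ) ≤ N := hkN.trans (div_le_self hN0.le (by linarith))
    exact_mod_cast this
  have hcompl : ((goodᶜ).ncard : ℝ) ≤ ∑ k ∈ K, ((bad k).ncard : ℝ) := by
    exact_mod_cast (Set.ncard_le_ncard hcover (Set.toFinite _)).trans
      (Finset.set_ncard_biUnion_le K bad)
  have hKcard : (K.card : ℝ) ≤ N := by
    have : K.card ≤ (Finset.Icc 2 N).card := Finset.card_filter_le _ _
    rw [Nat.card_Icc] at this
    exact_mod_cast this.trans (by omega)
  have hω : 0 ≤ ω := by positivity
  have hsum : (N : ℝ) ^ 2 * (goodᶜ).ncard ≤ N * ω :=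
    calc (N : ℝ) ^ 2 * (goodᶜ).ncard ≤ N ^ 2 * ∑ k ∈ K, ((bad k).ncard : ℝ) := by gcongr
      _ = ∑ k ∈ K, (N : ℝ) ^ 2 * (bad k).ncard := Finset.mul_sum _ _ _
      _ ≤ K.card * ω := by
        rw [← nsmul_eq_mul]
        exact Finset.sum_le_card_nsmul _ _ _ hbad
      _ ≤ N * ω := by gcongr
  have hfinal : ((goodᶜ).ncard : ℝ) ≤ ε * ω := by
    have h4 : (N : ℝ) * (goodᶜ).ncard ≤ ω := by
      refine le_of_mul_le_mul_left ?_ hN0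
      linarith
    refine le_of_mul_le_mul_left ?_ hN0
    nlinarith
  have hadd : (good.ncard : ℝ) + (goodᶜ).ncard = ω := by
    rw [← Nat.cast_add, Set.ncard_add_ncard_compl]
  change (1 - ε) * ω ≤ (good.ncard : ℝ)
  linarith
end

section
/- Let S(n,1/2) denote a binomial random variable with parameters n and 1/2. If c = c(n) > 0 satisfies c(n) → ∞ and c(n) = o(n^{1/6}) as n → ∞, then P(S(n,1/2) ≥ ⌊n/2⌋ + c·√n) = (1+o(1))·e^{-2c²}/(2c·√(2π)) as n → ∞; that is, the ratio of the two sides tends to 1. -/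
/-- `P(S(m,1/2) ≥ x)` for a binomial random variable `S(m,1/2)` with parameters
`m` and `1/2`, i.e. `P(S(m,1/2) = j) = C(m,j)/2^m` for `0 ≤ j ≤ m`. -/
noncomputable def binomialUpperTail (m : ℕ) (x : ℝ) : ℝ :=
  (∑ j ∈ Finset.range (m + 1), if x ≤ (j : ℝ) then (m.choose j : ℝ) else 0) / 2 ^ m

open Filter Topology Finset

/-- The relative decrease `1 - C(n,j+1)/C(n,j)` of consecutive binomial coefficients. -/
noncomputable def chooseDrop (n j : ℕ) : ℝ := (2 * j + 1 - n) / (j + 1)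

lemma choose_sub_choose_succ (n j : ℕ) :
    (n.choose j : ℝ) - n.choose (j + 1) = chooseDrop n j * n.choose j := by
  have hj : (j : ℝ) + 1 ≠ 0 := by positivity
  have h : (n.choose (j + 1) : ℝ) * (j + 1) = n.choose j * ((n : ℝ) - j) := by
    rcases le_or_gt j n with hle | hlt
    · rw [← Nat.cast_sub hle]
      exact_mod_cast Nat.choose_succ_right_eq n j
    · rw [Nat.choose_eq_zero_of_lt hlt, Nat.choose_eq_zero_of_lt (hlt.trans (Nat.lt_succ_self j))]
      simp
  unfold chooseDrop
  field_simp
  linarith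

lemma chooseDrop_mono (n : ℕ) : Monotone (chooseDrop n) := by
  intro i j hij
  have hij' : (i : ℝ) ≤ j := by exact_mod_cast hij
  have hn : (0 : ℝ) ≤ n := by positivity
  unfold chooseDrop
  rw [div_le_div_iff₀ (by positivity) (by positivity)]
  nlinarith

lemma sum_chooseDrop_mul_choose (n p L : ℕ) :
    ∑ j ∈ Ico p (p + L), chooseDrop n j * n.choose j = (n.choose p : ℝ) - n.choose (p + L) := by
  induction L with
  | zero => simp
  | succ L ih =>
    rw [← add_assoc, sum_Ico_succ_top (by omega), ih, ← choose_sub_choose_succ]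
    ring

lemma sum_Ico_choose_le (n p L : ℕ) :
    ∑ j ∈ Ico p (p + L), (n.choose j : ℝ) ≤ ∑ j ∈ Ico p (n + 1), (n.choose j : ℝ) := by
  calc ∑ j ∈ Ico p (p + L), (n.choose j : ℝ)
      = ∑ j ∈ Ico p (p + L) with j < n + 1, (n.choose j : ℝ) := by
        rw [sum_filter]
        refine sum_congr rfl fun j _ => ?_
        split_ifs with h
        · rfl
        · simp [Nat.choose_eq_zero_of_lt (by omega : n < j)]
    _ ≤ _ := by
        refine sum_le_sum_of_subset_of_nonneg (fun j hj => ?_) fun _ _ _ => by positivity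
        simp only [mem_filter, mem_Ico] at hj ⊢
        omega

lemma chooseDrop_mul_sum_le {n p : ℕ} (hpn : p ≤ n) :
    chooseDrop n p * ∑ j ∈ Ico p (n + 1), (n.choose j : ℝ) ≤ n.choose p := by
  have h := sum_chooseDrop_mul_choose n p (n + 1 - p)
  have he : p + (n + 1 - p) = n + 1 := by omega
  rw [he, Nat.choose_eq_zero_of_lt (Nat.lt_succ_self n), Nat.cast_zero, sub_zero] at h
  rw [← h, mul_sum]
  refine sum_le_sum fun j hj => ?_
  gcongr
  exact chooseDrop_mono n (mem_Ico.1 hj).1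

lemma choose_sub_le_chooseDrop_mul_sum {n p : ℕ} (L : ℕ) (h : 0 ≤ chooseDrop n p) :
    (n.choose p : ℝ) - n.choose (p + L) ≤
      chooseDrop n (p + L) * ∑ j ∈ Ico p (n + 1), (n.choose j : ℝ) := by
  rw [← sum_chooseDrop_mul_choose]
  calc ∑ j ∈ Ico p (p + L), chooseDrop n j * (n.choose j : ℝ)
      ≤ ∑ j ∈ Ico p (p + L), chooseDrop n (p + L) * (n.choose j : ℝ) := by
        refine sum_le_sum fun j hj => ?_
        gcongr
        exact chooseDrop_mono n (mem_Ico.1 hj).2.le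
    _ = chooseDrop n (p + L) * ∑ j ∈ Ico p (p + L), (n.choose j : ℝ) := by rw [mul_sum]
    _ ≤ _ := by
        exact mul_le_mul_of_nonneg_left (sum_Ico_choose_le n p L)
          (h.trans (chooseDrop_mono n (by omega)))

lemma choose_succ_le_choose {n j : ℕ} (h : 0 ≤ chooseDrop n j) :
    (n.choose (j + 1) : ℝ) ≤ n.choose j := by
  have := choose_sub_choose_succ n j
  have : 0 ≤ chooseDrop n j * n.choose j := by positivity
  linarith

lemma choose_add_le_choose {n p : ℕ} (h : 0 ≤ chooseDrop n p) {i L : ℕ} (hi : i ≤ L) :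
    (n.choose (p + L) : ℝ) ≤ n.choose (p + i) := by
  induction L, hi using Nat.le_induction with
  | base => exact le_rfl
  | succ L _ ih =>
    exact (choose_succ_le_choose (h.trans (chooseDrop_mono n (Nat.le_add_right p L)))).trans ih

lemma mul_choose_add_le_sum {n p : ℕ} (L : ℕ) (h : 0 ≤ chooseDrop n p) :
    (L : ℝ) * n.choose (p + L) ≤ ∑ j ∈ Ico p (n + 1), (n.choose j : ℝ) := by
  refine le_trans ?_ (sum_Ico_choose_le n p L)
  have := card_nsmul_le_sum (Ico p (p + L)) (fun j => (n.choose j : ℝ)) (n.choose (p + L)) ?_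
  · simpa using this
  · intro j hj
    obtain ⟨h1, h2⟩ := mem_Ico.1 hj
    obtain ⟨i, rfl⟩ := Nat.exists_eq_add_of_le h1
    exact choose_add_le_choose h (by omega)

/-- Lower bound for a binomial tail in terms of its leading term. -/
lemma le_chooseDrop_mul_sum_div_choose {n p : ℕ} (L : ℕ) (hL : 0 < L) (hpn : p ≤ n)
    (h : 0 < chooseDrop n p) :
    chooseDrop n p / chooseDrop n (p + L) * (1 - 1 / (L * chooseDrop n p)) ≤
      chooseDrop n p * (∑ j ∈ Ico p (n + 1), (n.choose j : ℝ)) / n.choose p := by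
  have hC : (0 : ℝ) < n.choose p := by exact_mod_cast Nat.choose_pos hpn
  have hL' : (0 : ℝ) < L := by exact_mod_cast hL
  have h' : 0 < chooseDrop n (p + L) := h.trans_le (chooseDrop_mono n (by omega))
  have h1 := chooseDrop_mul_sum_le hpn
  have h2 := choose_sub_le_chooseDrop_mul_sum L h.le
  have h3 := mul_choose_add_le_sum L h.le
  set T := ∑ j ∈ Ico p (n + 1), (n.choose j : ℝ)
  have h4 : (n.choose (p + L) : ℝ) ≤ n.choose p / (L * chooseDrop n p) := by
    rw [le_div_iff₀ (by positivity)]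
    nlinarith
  have h5 : (n.choose p : ℝ) * (1 - 1 / (L * chooseDrop n p)) ≤ chooseDrop n (p + L) * T := by
    have : (n.choose p : ℝ) * (1 - 1 / (L * chooseDrop n p)) =
      n.choose p - n.choose p / (L * chooseDrop n p) := by ring
    linarith
  rw [le_div_iff₀ hC, div_mul_eq_mul_div, div_mul_eq_mul_div, div_le_iff₀ h']
  nlinarith

/-- The entropy function governing the local limit theorem, to second order. -/
lemma abs_entropy_sub_sq_le {x : ℝ} (hx : |x| ≤ 1 / 2) :
    |(1 + x) * Real.log (1 + x) + (1 - x) * Real.log (1 - x) - x ^ 2| ≤ 7 * x ^ 4 := by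
  have key : ∀ y : ℝ, |y| ≤ 1 / 2 →
      |y + y ^ 2 / 2 + y ^ 3 / 3 + Real.log (1 - y)| ≤ 2 * y ^ 4 := by
    intro y hy
    have h := Real.abs_log_sub_add_sum_range_le (x := y) (by linarith) 3
    have h4 : |y| ^ 4 = y ^ 4 := by
      rw [show 4 = 2 * 2 by norm_num, pow_mul, sq_abs, pow_mul]
    norm_num [sum_range_succ] at h
    refine h.trans ?_
    rw [h4, div_le_iff₀ (by linarith)]
    nlinarith [show 0 ≤ y ^ 4 by positivity]
  have h1 := key x hx
  have h2 := key (-x) (by rwa [abs_neg])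
  rw [sub_neg_eq_add] at h2
  set a := x + x ^ 2 / 2 + x ^ 3 / 3 + Real.log (1 - x) with ha
  set b := -x + (-x) ^ 2 / 2 + (-x) ^ 3 / 3 + Real.log (1 + x) with hb
  have he : (1 + x) * Real.log (1 + x) + (1 - x) * Real.log (1 - x) - x ^ 2 =
      (1 + x) * b + (1 - x) * a + 2 / 3 * x ^ 4 := by
    rw [ha, hb]; ring
  rw [abs_le] at hx h1 h2
  rw [he, abs_le]
  have h0 : 0 ≤ x ^ 4 := by positivity
  constructor <;> nlinarith

lemma factorial_eq_stirlingSeq {n : ℕ} (hn : 0 < n) :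
    (n.factorial : ℝ) = Stirling.stirlingSeq n * (√(2 * n) * (n / Real.exp 1) ^ n) := by
  have : (0 : ℝ) < n := by exact_mod_cast hn
  rw [Stirling.stirlingSeq, div_mul_cancel₀]
  positivity

/-- Stirling's formula for a binomial coefficient, with `p = n(1+x)/2`. -/
lemma choose_eq_stirling {n p : ℕ} (hp : 0 < p) (hpn : p < n) {x : ℝ}
    (hx : x = (2 * p - n) / n) :
    (n.choose p : ℝ) / 2 ^ n * √n * Real.exp (n * x ^ 2 / 2) =
      Stirling.stirlingSeq n / (Stirling.stirlingSeq p * Stirling.stirlingSeq (n - p)) *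
        (√2 / √(1 - x ^ 2)) *
        Real.exp (-(n / 2 * ((1 + x) * Real.log (1 + x) + (1 - x) * Real.log (1 - x) - x ^ 2))) := by
  obtain ⟨q, hq, rfl⟩ : ∃ q, 0 < q ∧ n = p + q := ⟨n - p, by omega, by omega⟩
  have hp' : (0 : ℝ) < p := by exact_mod_cast hp
  have hq' : (0 : ℝ) < q := by exact_mod_cast hq
  rw [Nat.add_sub_cancel_left]
  set N : ℝ := ((p + q : ℕ) : ℝ) with hN
  have hNpq : N = p + q := by rw [hN]; push_cast; ring
  have hN0 : 0 < N := by rw [hNpq]; positivity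
  have hP : (p : ℝ) = N / 2 * (1 + x) := by rw [hx]; field_simp; ring
  have hQ : (q : ℝ) = N / 2 * (1 - x) := by rw [hx, hNpq]; field_simp; ring
  have h1x : 0 < 1 + x := by
    by_contra! h; nlinarith
  have h2x : 0 < 1 - x := by
    by_contra! h; nlinarith
  have hs : ∀ k : ℕ, 0 < k → 0 < Stirling.stirlingSeq k := by
    intro k hk
    obtain ⟨k, rfl⟩ := Nat.exists_eq_succ_of_ne_zero hk.ne'
    exact Stirling.stirlingSeq'_pos k
  have hsp := hs p hp
  have hsq := hs q hq
  have hpow : ∀ (k : ℕ) (y : ℝ), 0 < y → (k : ℝ) = N / 2 * y →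
      ((k : ℝ) / Real.exp 1) ^ k = (N / 2 / Real.exp 1) ^ k * Real.exp (N / 2 * (y * Real.log y)) := by
    intro k y hy hk
    rw [← mul_assoc, ← hk, Real.exp_nat_mul, Real.exp_log hy, ← mul_pow]
    congr 1
    rw [hk]; ring
  have hsqrt : √(2 * p) * √(2 * q) = N * √(1 - x ^ 2) := by
    rw [← Real.sqrt_mul (by positivity), hP, hQ,
      show 2 * (N / 2 * (1 + x)) * (2 * (N / 2 * (1 - x))) = N ^ 2 * (1 - x ^ 2) by ring,
      Real.sqrt_mul (by positivity), Real.sqrt_sq hN0.le]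
  have hsx : 0 < √(1 - x ^ 2) := Real.sqrt_pos.2 (by nlinarith)
  rw [Nat.cast_add_choose, factorial_eq_stirlingSeq (by omega : 0 < p + q),
    factorial_eq_stirlingSeq hp, factorial_eq_stirlingSeq hq, hpow p _ h1x hP, hpow q _ h2x hQ,
    ← hN]
  have hden : Stirling.stirlingSeq p * (√(2 * p) * ((N / 2 / Real.exp 1) ^ p *
        Real.exp (N / 2 * ((1 + x) * Real.log (1 + x))))) *
      (Stirling.stirlingSeq q * (√(2 * q) * ((N / 2 / Real.exp 1) ^ q *
        Real.exp (N / 2 * ((1 - x) * Real.log (1 - x)))))) =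
      Stirling.stirlingSeq p * Stirling.stirlingSeq q * (N * √(1 - x ^ 2)) *
        ((N / Real.exp 1) ^ (p + q) / 2 ^ (p + q)) *
        (Real.exp (N / 2 * ((1 + x) * Real.log (1 + x))) *
          Real.exp (N / 2 * ((1 - x) * Real.log (1 - x)))) := by
    rw [← hsqrt, ← div_pow, show N / Real.exp 1 / 2 = N / 2 / Real.exp 1 by ring, pow_add]
    ring
  have hexp : Real.exp (-(N / 2 * ((1 + x) * Real.log (1 + x) + (1 - x) * Real.log (1 - x)
      - x ^ 2))) = Real.exp (N * x ^ 2 / 2) / (Real.exp (N / 2 * ((1 + x) * Real.log (1 + x))) *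
          Real.exp (N / 2 * ((1 - x) * Real.log (1 - x)))) := by
    rw [← Real.exp_add, ← Real.exp_sub]
    congr 1; ring
  rw [hden, hexp, Real.sqrt_mul (by norm_num)]
  have hNN : √N * √N = N := Real.mul_self_sqrt hN0.le
  have hne : (N / Real.exp 1) ^ (p + q) ≠ 0 := by positivity
  set E := (N / Real.exp 1) ^ (p + q)
  set A := Real.exp (N / 2 * ((1 + x) * Real.log (1 + x))) *
          Real.exp (N / 2 * ((1 - x) * Real.log (1 - x))) with hA
  have hA0 : A ≠ 0 := by rw [hA]; positivity
  field_simp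
  rw [Real.sq_sqrt hN0.le]

/-- De Moivre–Laplace local limit theorem in the moderate deviation range. -/
lemma tendsto_choose_mul_exp {p : ℕ → ℕ} {x : ℕ → ℝ}
    (hx : ∀ n : ℕ, x n = (2 * p n - n) / n) (hx0 : Tendsto x atTop (𝓝 0))
    (hx4 : Tendsto (fun n : ℕ => n * x n ^ 4) atTop (𝓝 0)) :
    Tendsto (fun n : ℕ => (n.choose (p n) : ℝ) / 2 ^ n * √n * Real.exp (n * x n ^ 2 / 2)) atTop
      (𝓝 (√2 / √Real.pi)) := by
  have hcast : Tendsto (fun n : ℕ => (n : ℝ)) atTop atTop := tendsto_natCast_atTop_atTop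
  have hsmall : ∀ᶠ n in atTop, |x n| ≤ 1 / 2 := by
    have := hx0.abs
    rw [abs_zero] at this
    exact this.eventually_le_const (by norm_num)
  have hbounds : ∀ᶠ n : ℕ in atTop, (n : ℝ) / 4 ≤ p n ∧ (p n : ℝ) ≤ 3 / 4 * n ∧ 0 < n := by
    filter_upwards [hsmall, eventually_gt_atTop 0] with n hn hn0
    have hn' : (0 : ℝ) < n := by exact_mod_cast hn0
    have : (p n : ℝ) = n / 2 * (1 + x n) := by rw [hx]; field_simp; ring
    rw [abs_le] at hn
    refine ⟨?_, ?_, hn0⟩ <;> rw [this] <;> nlinarith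
  have hp : Tendsto p atTop atTop := by
    rw [← tendsto_natCast_atTop_iff (R := ℝ)]
    refine tendsto_atTop_mono' _ ?_ (hcast.atTop_div_const (show (0 : ℝ) < 4 by norm_num))
    filter_upwards [hbounds] with n hn using hn.1
  have hq : Tendsto (fun n => n - p n) atTop atTop := by
    rw [← tendsto_natCast_atTop_iff (R := ℝ)]
    refine tendsto_atTop_mono' _ ?_ (hcast.atTop_div_const (show (0 : ℝ) < 4 by norm_num))
    filter_upwards [hbounds] with n hn
    have hle : p n ≤ n := by
      have : (p n : ℝ) ≤ n := by linarith [hn.2.1, (Nat.cast_nonneg n : (0 : ℝ) ≤ n)]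
      exact_mod_cast this
    rw [Nat.cast_sub hle]
    linarith [hn.2.1]
  have hS := Stirling.tendsto_stirlingSeq_sqrt_pi
  have hpi : 0 < √Real.pi := Real.sqrt_pos.2 Real.pi_pos
  have hlim1 := hS.div ((hS.comp hp).mul (hS.comp hq)) (by positivity)
  have hlim2 : Tendsto (fun n => √2 / √(1 - x n ^ 2)) atTop (𝓝 √2) := by
    have : Tendsto (fun n => √2 / √(1 - x n ^ 2)) atTop (𝓝 (√2 / √(1 - 0 ^ 2))) :=
      tendsto_const_nhds.div (((hx0.pow 2).const_sub 1).sqrt) (by norm_num)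
    simpa using this
  have hlim3 : Tendsto (fun n : ℕ => Real.exp (-(n / 2 * ((1 + x n) * Real.log (1 + x n) +
      (1 - x n) * Real.log (1 - x n) - x n ^ 2)))) atTop (𝓝 1) := by
    rw [show 𝓝 (1 : ℝ) = 𝓝 (Real.exp 0) by rw [Real.exp_zero]]
    refine (Real.continuous_exp.tendsto 0).comp ?_
    refine squeeze_zero_norm' ?_ (by simpa using hx4.const_mul (7 / 2))
    filter_upwards [hsmall] with n hn
    have hn0 : (0 : ℝ) ≤ n := Nat.cast_nonneg n
    rw [norm_neg, norm_mul, Real.norm_eq_abs, Real.norm_eq_abs, abs_of_nonneg (by positivity)]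
    nlinarith [abs_entropy_sub_sq_le hn]
  have hmain := (hlim1.mul hlim2).mul hlim3
  have hval : √Real.pi / (√Real.pi * √Real.pi) * √2 * 1 = √2 / √Real.pi := by
    field_simp
  rw [hval] at hmain
  refine hmain.congr' ?_
  filter_upwards [hbounds] with n ⟨h1, h2, h3⟩
  have h3' : (0 : ℝ) < n := by exact_mod_cast h3
  have hp0 : 0 < p n := by
    have : (0 : ℝ) < p n := by linarith
    exact_mod_cast this
  have hpn : p n < n := by
    have : (p n : ℝ) < n := by linarith
    exact_mod_cast this
  exact (choose_eq_stirling hp0 hpn (hx n)).symm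

lemma binomialUpperTail_eq (n : ℕ) (x : ℝ) :
    binomialUpperTail n x = (∑ j ∈ Ico ⌈x⌉₊ (n + 1), (n.choose j : ℝ)) / 2 ^ n := by
  unfold binomialUpperTail
  rw [← sum_filter]
  congr 2
  ext j
  simp only [mem_filter, mem_range, mem_Ico, Nat.ceil_le]
  tauto

lemma tendsto_binomialUpperTail_aux (c : ℕ → ℝ)
    (hinf : Tendsto c atTop atTop) (hc4 : Tendsto (fun n : ℕ => c n ^ 4 / n) atTop (𝓝 0))
    {p : ℕ → ℕ} {y : ℕ → ℝ} (hy : ∀ n : ℕ, y n = (2 * p n - n) / √n)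
    (hyc : ∀ᶠ n : ℕ in atTop, |y n - 2 * c n| ≤ 2 / √n) :
    Tendsto (fun n : ℕ => (∑ j ∈ Ico (p n) (n + 1), (n.choose j : ℝ)) / 2 ^ n /
      (Real.exp (-2 * c n ^ 2) / (2 * c n * √(2 * Real.pi)))) atTop (𝓝 1) := by
  have hcast : Tendsto (fun n : ℕ => (n : ℝ)) atTop atTop := tendsto_natCast_atTop_atTop
  have hsq : Tendsto (fun n : ℕ => √(n : ℝ)) atTop atTop := Real.tendsto_sqrt_atTop.comp hcast
  have hsqinv : Tendsto (fun n : ℕ => 1 / √(n : ℝ)) atTop (𝓝 0) := by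
    simp only [one_div]
    exact hsq.inv_tendsto_atTop
  have hcinv : Tendsto (fun n : ℕ => 1 / c n) atTop (𝓝 0) := by
    simp only [one_div]
    exact hinf.inv_tendsto_atTop
  have hgood : ∀ᶠ n : ℕ in atTop, 2 ≤ c n ∧ 1 ≤ √(n : ℝ) ∧ |y n - 2 * c n| ≤ 2 / √n ∧
      |y n - 2 * c n| ≤ 2 := by
    filter_upwards [hinf.eventually_ge_atTop 2, hsq.eventually_ge_atTop 1, hyc] with n h1 h2 h3
    refine ⟨h1, h2, h3, h3.trans ?_⟩
    rw [div_le_iff₀ (by linarith)]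
    linarith
  have hcs : Tendsto (fun n : ℕ => c n / √n) atTop (𝓝 0) := by
    have h2 : Tendsto (fun n : ℕ => √(c n ^ 4 / n)) atTop (𝓝 0) := by
      simpa using hc4.sqrt
    refine squeeze_zero_norm' ?_ h2
    filter_upwards [hgood] with n ⟨h1, h3, _⟩
    rw [Real.norm_eq_abs, abs_of_nonneg (by positivity), Real.sqrt_div (by positivity),
      show c n ^ 4 = (c n ^ 2) ^ 2 by ring, Real.sqrt_sq (by positivity)]
    gcongr
    nlinarith
  set x : ℕ → ℝ := fun n => (2 * p n - n) / n with hxdef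
  have hxy : ∀ᶠ n : ℕ in atTop, x n = y n / √n := by
    filter_upwards with n
    rw [hy, div_div, Real.mul_self_sqrt (Nat.cast_nonneg n)]
  have hyub : ∀ᶠ n : ℕ in atTop, |y n| ≤ 3 * c n := by
    filter_upwards [hgood] with n ⟨h1, _, _, h4⟩
    rw [abs_le] at h4 ⊢
    constructor <;> linarith
  have hx0 : Tendsto x atTop (𝓝 0) := by
    refine squeeze_zero_norm' ?_ (by simpa using hcs.const_mul 3)
    filter_upwards [hxy, hyub] with n h1 h2
    rw [h1, Real.norm_eq_abs, abs_div, abs_of_nonneg (Real.sqrt_nonneg _), ← mul_div_assoc]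
    gcongr
  have hx4 : Tendsto (fun n : ℕ => n * x n ^ 4) atTop (𝓝 0) := by
    refine squeeze_zero_norm' ?_ (by simpa using hc4.const_mul 81)
    filter_upwards [hxy, hyub, eventually_gt_atTop 0] with n h1 h2 h3
    have hn : (0 : ℝ) < n := by exact_mod_cast h3
    have e : n * x n ^ 4 = |y n| ^ 4 / n := by
      rw [h1, div_pow, show √(n : ℝ) ^ 4 = (√(n : ℝ) ^ 2) ^ 2 by ring, Real.sq_sqrt hn.le,
        show |y n| ^ 4 = (|y n| ^ 2) ^ 2 by ring, sq_abs]
      field_simp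
    rw [e, Real.norm_eq_abs, abs_of_nonneg (by positivity), ← mul_div_assoc]
    gcongr
    calc |y n| ^ 4 ≤ (3 * c n) ^ 4 := by gcongr
      _ = 81 * c n ^ 4 := by ring
  have hlocal := tendsto_choose_mul_exp (fun n => rfl) hx0 hx4
  have hexp : Tendsto (fun n : ℕ => Real.exp (2 * c n ^ 2 - n * x n ^ 2 / 2)) atTop (𝓝 1) := by
    rw [show 𝓝 (1 : ℝ) = 𝓝 (Real.exp 0) by rw [Real.exp_zero]]
    refine (Real.continuous_exp.tendsto 0).comp ?_
    refine squeeze_zero_norm' ?_ (by simpa using hcs.const_mul 5)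
    filter_upwards [hxy, hyub, hgood, eventually_gt_atTop 0] with n h1 h2 ⟨h3, h4, h5, _⟩ h6
    have hn : (0 : ℝ) < n := by exact_mod_cast h6
    have e : 2 * c n ^ 2 - n * x n ^ 2 / 2 = -((y n - 2 * c n) * ((y n + 2 * c n) / 2)) := by
      rw [h1, div_pow, Real.sq_sqrt hn.le]
      field_simp
      ring
    rw [e, norm_neg, norm_mul, Real.norm_eq_abs, Real.norm_eq_abs]
    have h7 : |(y n + 2 * c n) / 2| ≤ 5 / 2 * c n := by
      rw [abs_le] at h2 ⊢
      constructor <;> linarith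
    calc _ ≤ 2 / √n * (5 / 2 * c n) := by gcongr
      _ = 5 * (c n / √n) := by ring
  -- `chooseDrop n (p n) * √n / c n → 4`
  have hyc2 : Tendsto (fun n : ℕ => y n / c n) atTop (𝓝 2) := by
    rw [tendsto_iff_norm_sub_tendsto_zero]
    refine squeeze_zero' (Eventually.of_forall fun n => norm_nonneg _) ?_
      (by simpa using hcinv.const_mul 2)
    filter_upwards [hgood] with n ⟨h1, _, _, h4⟩
    have hc : 0 < c n := by linarith
    rw [show y n / c n - 2 = (y n - 2 * c n) / c n by field_simp, norm_div, Real.norm_eq_abs,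
      Real.norm_eq_abs, abs_of_pos hc]
    calc _ ≤ 2 / c n := by gcongr
      _ = _ := by ring
  have hdrop : Tendsto (fun n : ℕ => chooseDrop n (p n) * √n / c n) atTop (𝓝 4) := by
    have hninv : Tendsto (fun n : ℕ => 1 / (n : ℝ)) atTop (𝓝 0) := tendsto_one_div_atTop_nhds_zero_nat
    have h : Tendsto (fun n : ℕ => (y n / c n + 1 / c n * (1 / √n)) / ((1 + x n) / 2 + 1 / n)) atTop
        (𝓝 ((2 + 0 * 0) / ((1 + 0) / 2 + 0))) :=
      (hyc2.add (hcinv.mul hsqinv)).div (((hx0.const_add 1).div_const 2).add hninv) (by norm_num)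
    norm_num at h
    refine h.congr' ?_
    filter_upwards [hgood, eventually_gt_atTop 0] with n ⟨h1, h2, _, _⟩ h6
    have hn : (0 : ℝ) < n := by exact_mod_cast h6
    have hc : 0 < c n := by linarith
    have hs : 0 < √(n : ℝ) := by linarith
    have e1 : (1 + x n) / 2 + (n : ℝ)⁻¹ = (p n + 1) / n := by
      rw [hxdef]; field_simp; ring
    have e2 : y n / c n + (c n)⁻¹ * (√n)⁻¹ = (2 * p n + 1 - n) / (c n * √n) := by
      rw [hy]; field_simp; ring
    have e3 : (n : ℝ) = √n * √n := (Real.mul_self_sqrt hn.le).symm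
    have hp1 : (0 : ℝ) < p n + 1 := by positivity
    rw [e1, e2, chooseDrop, div_div_div_eq, div_mul_eq_mul_div, div_div,
      div_eq_div_iff (by positivity) (by positivity)]
    linear_combination (2 * (p n : ℝ) + 1 - n) * (p n + 1) * c n * e3
  have hdropinf : Tendsto (fun n : ℕ => chooseDrop n (p n) * √n) atTop atTop := by
    refine (hdrop.pos_mul_atTop (by norm_num) hinf).congr' ?_
    filter_upwards [hgood] with n ⟨h1, _⟩
    have : c n ≠ 0 := by linarith
    field_simp
  -- the tail is comparable to a geometric series
  have htail : Tendsto (fun n : ℕ => chooseDrop n (p n) *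
      (∑ j ∈ Ico (p n) (n + 1), (n.choose j : ℝ)) / n.choose (p n)) atTop (𝓝 1) := by
    have hlow : Tendsto (fun n : ℕ => (1 - 4 * (1 / c n)) * (1 - 1 / (chooseDrop n (p n) * √n)))
        atTop (𝓝 1) := by
      have h := ((hcinv.const_mul 4).const_sub 1).mul ((hdropinf.inv_tendsto_atTop).const_sub 1)
      simpa using h
    have hpn : ∀ᶠ n : ℕ in atTop, p n ≤ n := by
      filter_upwards [hx0.eventually_le_const (show (0 : ℝ) < 1 by norm_num),
        eventually_gt_atTop 0] with n h1 h6
      have hn : (0 : ℝ) < n := by exact_mod_cast h6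
      rw [hxdef] at h1
      simp only [div_le_one hn] at h1
      have : (p n : ℝ) ≤ n := by linarith
      exact_mod_cast this
    refine tendsto_of_tendsto_of_tendsto_of_le_of_le' hlow tendsto_const_nhds ?_ ?_
    · filter_upwards [hpn, hgood, hdropinf.eventually_ge_atTop 1, hinf.eventually_ge_atTop 4]
        with n h1 ⟨h2, h3, _, h5⟩ h6 h8
      have hs : 0 < √(n : ℝ) := by linarith
      have hd : 0 < chooseDrop n (p n) := by
        by_contra! h; nlinarith
      set L := ⌈√(n : ℝ)⌉₊ with hL
      have hL1 : √(n : ℝ) ≤ L := Nat.le_ceil _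
      have hL2 : (L : ℝ) ≤ 2 * √n := by linarith [Nat.ceil_lt_add_one hs.le]
      have hL0 : 0 < L := Nat.ceil_pos.2 hs
      refine le_trans ?_ (le_chooseDrop_mul_sum_div_choose L hL0 h1 hd)
      have hd' : 0 < chooseDrop n (p n + L) := hd.trans_le (chooseDrop_mono n (by omega))
      have hyn : c n ≤ y n := by
        rw [abs_le] at h5; linarith
      have hyp : 2 * (p n : ℝ) - n = y n * √n := by
        rw [hy]; field_simp
      have hc : 0 < c n := by linarith
      have hinv : (1 : ℝ) / (chooseDrop n (p n) * √n) ≤ 1 := by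
        rw [div_le_one (by positivity)]; exact h6
      apply mul_le_mul
      · have hlt : (0 : ℝ) < 2 * p n + 1 - n := by nlinarith
        have hA : (1 - 4 * (1 / c n)) * (2 * p n + 2 * L + 1 - n) ≤ 2 * p n + 1 - n := by
          have h9 : 2 * (L : ℝ) ≤ 4 * (1 / c n) * (2 * p n + 2 * L + 1 - n) := by
            rw [mul_one_div, div_mul_eq_mul_div, le_div_iff₀ hc]
            have : c n * √n ≤ y n * √n := by gcongr
            have : (L : ℝ) * c n ≤ 2 * √n * c n := by gcongr
            nlinarith
          linarith
        rw [le_div_iff₀ hd']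
        unfold chooseDrop
        push_cast
        have hnn : 0 ≤ 1 - 4 * (1 / c n) := by
          rw [mul_one_div, sub_nonneg, div_le_one hc]; exact h8
        calc (1 - 4 * (1 / c n)) * ((2 * ((p n : ℝ) + L) + 1 - n) / (p n + L + 1))
            = (1 - 4 * (1 / c n)) * (2 * p n + 2 * L + 1 - n) / (p n + L + 1) := by ring
          _ ≤ (2 * p n + 1 - n) / (p n + L + 1) := by gcongr
          _ ≤ (2 * p n + 1 - n) / (p n + 1) := by
            apply div_le_div_of_nonneg_left hlt.le (by positivity)
            linarith
      · gcongr 1 - 1 / ?_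
        rw [mul_comm]
        gcongr
      · linarith
      · positivity
    · filter_upwards [hpn] with n h1
      have hC : (0 : ℝ) < n.choose (p n) := by exact_mod_cast Nat.choose_pos h1
      rw [div_le_one hC]
      exact chooseDrop_mul_sum_le h1
  have hfin := ((htail.mul (hlocal.mul hexp)).div hdrop (by norm_num)).mul_const
    (2 * √(2 * Real.pi))
  have hpi : 0 < √Real.pi := Real.sqrt_pos.2 Real.pi_pos
  have hval : 1 * (√2 / √Real.pi * 1) / 4 * (2 * √(2 * Real.pi)) = 1 := by
    rw [Real.sqrt_mul (by norm_num)]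
    field_simp
    norm_num
  rw [hval] at hfin
  refine hfin.congr' ?_
  filter_upwards [hgood, hdropinf.eventually_ge_atTop 1,
    htail.eventually_ne (show (1 : ℝ) ≠ 0 by norm_num)] with n ⟨h1, h2, _⟩ h6 h7
  have hs : 0 < √(n : ℝ) := by linarith
  have hd : chooseDrop n (p n) ≠ 0 := by
    intro h; rw [h] at h6; linarith
  have hC : (n.choose (p n) : ℝ) ≠ 0 := by
    intro h; rw [h] at h7; simp at h7
  have hc : c n ≠ 0 := by linarith
  have e : Real.exp (n * x n ^ 2 / 2) * Real.exp (2 * c n ^ 2 - n * x n ^ 2 / 2) =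
      1 / Real.exp (-2 * c n ^ 2) := by
    rw [← Real.exp_add, one_div, ← Real.exp_neg]
    congr 1; ring
  simp only [Pi.div_apply]
  rw [mul_assoc _ (Real.exp _) (Real.exp _), e]
  field_simp

/-- If `c = c(n) > 0` with `c(n) → ∞` and `c(n) = o(n^(1/6))`, then
`P(S(n,1/2) ≥ ⌊n/2⌋ + c√n) = (1 + o(1)) · e^{-2c²}/(2c√(2π))`, i.e. the ratio of the two
sides tends to `1` as `n → ∞`. -/
theorem binomial_tail_asymptotic (c : ℕ → ℝ) (hpos : ∀ n, 0 < c n)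
    (hinf : Filter.Tendsto c Filter.atTop Filter.atTop)
    (hlittleo : c =o[Filter.atTop] fun n : ℕ => (n : ℝ) ^ ((1 : ℝ) / 6)) :
    Filter.Tendsto
      (fun n : ℕ =>
        binomialUpperTail n (((n / 2 : ℕ) : ℝ) + c n * Real.sqrt n) /
          (Real.exp (-2 * (c n) ^ 2) / (2 * c n * Real.sqrt (2 * Real.pi))))
      Filter.atTop (nhds 1) := by
  simp only [binomialUpperTail_eq]
  refine tendsto_binomialUpperTail_aux c hinf ?_ (fun n => rfl) ?_
  · have h0 : Tendsto (fun n : ℕ => (c n / (n : ℝ) ^ ((1 : ℝ) / 6)) ^ 4) atTop (𝓝 0) := by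
      simpa using hlittleo.tendsto_div_nhds_zero.pow 4
    refine squeeze_zero_norm' ?_ h0
    filter_upwards [eventually_ge_atTop 1] with n hn
    have hn' : (1 : ℝ) ≤ n := by exact_mod_cast hn
    have hc := hpos n
    rw [Real.norm_eq_abs, abs_of_nonneg (by positivity), div_pow]
    gcongr
    rw [← Real.rpow_natCast, ← Real.rpow_mul (by positivity)]
    calc (n : ℝ) ^ ((1 : ℝ) / 6 * (4 : ℕ)) ≤ (n : ℝ) ^ (1 : ℝ) :=
          Real.rpow_le_rpow_of_exponent_le hn' (by norm_num)
      _ = n := Real.rpow_one _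
  · filter_upwards [eventually_ge_atTop 1] with n hn
    have hn' : (0 : ℝ) < n := by exact_mod_cast hn
    have hs : 0 < √(n : ℝ) := Real.sqrt_pos.2 hn'
    have hc := hpos n
    set X := ((n / 2 : ℕ) : ℝ) + c n * √n with hX
    have h1 : X ≤ ⌈X⌉₊ := Nat.le_ceil X
    have h2 : (⌈X⌉₊ : ℝ) < X + 1 := Nat.ceil_lt_add_one (by positivity)
    have h3 : ((n / 2 : ℕ) : ℝ) * 2 ≤ n := by exact_mod_cast Nat.div_mul_le_self n 2
    have h4 : (n : ℝ) ≤ ((n / 2 : ℕ) : ℝ) * 2 + 1 := by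
      have : n ≤ n / 2 * 2 + 1 := by omega
      exact_mod_cast this
    rw [show (2 * (⌈X⌉₊ : ℝ) - n) / √n - 2 * c n = (2 * ⌈X⌉₊ - n - 2 * c n * √n) / √n by field_simp,
      abs_div, abs_of_pos hs]
    gcongr
    rw [abs_le]
    constructor <;> linarith
end

section
/- Let S(n,1/2) denote a binomial random variable with parameters n and 1/2, and write {x} = x - ⌊x⌋. For every ε > 0 there exists n₀ such that for all n ≥ n₀ and every integer c with -⌊n/2⌋ ≤ c ≤ ⌈n/2⌉, one has P(S(n,1/2) = ⌊n/2⌋ + c) = C(n, ⌊n/2⌋+c)/2ⁿ ≥ (1-ε)·2^{-4(c+{n/2})²/n}·√(2/(πn)). -/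
open scoped Real Nat

/-- A sequence whose successive ratios form a log-concave sequence starting at or above `1` is
bounded below by the smaller of its two end values. -/
theorem min_le_of_logConcave_ratio {a r : ℕ → ℝ} {p M : ℕ}
    (ha : ∀ t, p ≤ t → t ≤ M → 0 ≤ a t)
    (hr : ∀ t, p ≤ t → t < M → a (t + 1) = r t * a t)
    (hpos : ∀ t, p ≤ t → t < M → 0 < r t)
    (hlc : ∀ t, p ≤ t → t + 2 < M → r (t + 2) * r t ≤ r (t + 1) ^ 2)
    (hp : 1 ≤ r p) {t : ℕ} (hpt : p ≤ t) (htM : t ≤ M) :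
    min (a p) (a M) ≤ a t := by
  have anti : ∀ s, p ≤ s → s + 1 < M → r (s + 1) < 1 → r (s + 1) ≤ r s := by
    intro s hs
    induction s, hs using Nat.le_induction with
    | base => intro _ h; linarith
    | succ s hs ih =>
      intro hsM h
      by_cases h1 : 1 ≤ r (s + 1)
      · linarith
      have h2 := ih (by omega) (not_le.mp h1)
      have h3 := hlc s hs (by omega)
      have h4 := hpos s hs (by omega)
      have h5 := hpos (s + 1) (by omega) (by omega)
      refine le_of_mul_le_mul_right ?_ h4
      nlinarith
  have step : ∀ s, p ≤ s → s + 1 < M → r s < 1 → r (s + 1) < 1 := by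
    intro s hs hsM h
    have hps : s ≠ p := by rintro rfl; linarith
    obtain ⟨u, rfl⟩ : ∃ u, s = u + 1 := ⟨s - 1, by omega⟩
    have h2 := anti u (by omega) (by omega) h
    have h3 := hlc u (by omega) hsM
    have h4 := hpos u (by omega) (by omega)
    have h5 := hpos (u + 1) (by omega) (by omega)
    refine lt_of_le_of_lt (le_of_mul_le_mul_right ?_ h4) h
    nlinarith
  by_cases hall : ∀ s, p ≤ s → s < t → 1 ≤ r s
  · refine (min_le_left _ _).trans ?_
    induction t, hpt using Nat.le_induction with
    | base => exact le_rfl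
    | succ t hpt ih =>
      have h1 := ih (by omega) fun s h h' => hall s h (by omega)
      have h2 := hall t hpt (by omega)
      have h3 := ha t hpt (by omega)
      rw [hr t hpt (by omega)]
      nlinarith
  · push Not at hall
    obtain ⟨s, hps, hst, hs⟩ := hall
    have hlt : ∀ u, s ≤ u → u < M → r u < 1 := by
      intro u hu
      induction u, hu using Nat.le_induction with
      | base => exact fun _ => hs
      | succ u hu ih => exact fun h => step u (by omega) h (ih (by omega))
    have hdec : ∀ u, t ≤ u → u ≤ M → a u ≤ a t := by
      intro u hu
      induction u, hu using Nat.le_induction with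
      | base => exact fun _ => le_rfl
      | succ u hu ih =>
        intro h
        have h1 := ih (by omega)
        have h2 := hlt u (by omega) (by omega)
        have h3 := ha u (by omega) (by omega)
        rw [hr u (by omega) (by omega)]
        nlinarith
    exact (min_le_right _ _).trans (hdec M htM le_rfl)

/-- The lower bound on the central binomial coefficient coming from Wallis' product. -/
theorem sqrt_le_centralBinom_div (m : ℕ) :
    √(2 / (π * (2 * m + 1))) ≤ m.centralBinom / 4 ^ m := by
  have hW := Real.Wallis.W_le m
  rw [Real.Wallis.W_eq_factorial_ratio] at hW
  have hC : (m.centralBinom : ℝ) * (m ! : ℝ) ^ 2 = ((2 * m)! : ℝ) := by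
    have h := Nat.choose_mul_factorial_mul_factorial (n := 2 * m) (k := m) (by omega)
    rw [show 2 * m - m = m by omega, ← Nat.centralBinom_eq_two_mul_choose] at h
    rw [← h]
    push_cast
    ring
  have hCpos : (0 : ℝ) < m.centralBinom := by exact_mod_cast m.centralBinom_pos
  have hfpos : (0 : ℝ) < (m ! : ℝ) := by exact_mod_cast m.factorial_pos
  rw [← hC, div_le_iff₀ (by positivity)] at hW
  refine Real.sqrt_le_iff.mpr ⟨by positivity, ?_⟩
  rw [div_pow, div_le_div_iff₀ (by positivity) (by positivity)]
  have h16 : ((4 : ℝ) ^ m) ^ 2 = 2 ^ (4 * m) := by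
    rw [← pow_mul, show (4 : ℝ) = 2 ^ 2 by norm_num, ← pow_mul]
    ring_nf
  rw [h16]
  have hf4 : (0 : ℝ) < (m ! : ℝ) ^ 4 := by positivity
  refine le_of_mul_le_mul_right ?_ hf4
  linear_combination 2 * hW

theorem sqrt_le_choose_half_div (n : ℕ) :
    √(2 / (π * (n + 2))) ≤ (n.choose (n / 2) : ℝ) / 2 ^ n := by
  rcases Nat.even_or_odd' n with ⟨m, rfl | rfl⟩
  · have h := sqrt_le_centralBinom_div m
    rw [Nat.centralBinom_eq_two_mul_choose] at h
    rw [show 2 * m / 2 = m by omega, pow_mul, show (2 : ℝ) ^ 2 = 4 by norm_num]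
    refine le_trans (Real.sqrt_le_sqrt ?_) h
    push_cast
    gcongr
    norm_num
  · have h := sqrt_le_centralBinom_div (m + 1)
    have hC : (m + 1).centralBinom = 2 * (2 * m + 1).choose m := by
      rw [Nat.centralBinom_eq_two_mul_choose, show 2 * (m + 1) = 2 * m + 1 + 1 by ring,
        Nat.choose_succ_succ, Nat.choose_symm_half]
      ring
    rw [hC] at h
    rw [show (2 * m + 1) / 2 = m by omega]
    refine le_trans (le_of_eq ?_) (h.trans (le_of_eq ?_))
    · push_cast
      ring_nf
    · rw [pow_succ, pow_succ, pow_mul, show (2 : ℝ) ^ 2 = 4 by norm_num]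
      push_cast
      field_simp
      ring

/-- The weighted binomial coefficient `C(n,h-t)·2^{(2t-e)²/n}` at distance `t` below `h`. -/
noncomputable def weightedChoose (n h e t : ℕ) : ℝ :=
  n.choose (h - t) * (2 : ℝ) ^ ((2 * (t : ℝ) - e) ^ 2 / n)

/-- The ratio of successive values of `weightedChoose`. -/
noncomputable def weightedRatio (n h e t : ℕ) : ℝ :=
  ((h : ℝ) - t) / (h + e + t + 1) * (2 : ℝ) ^ ((8 * (t : ℝ) + 4 - 4 * e) / n)

theorem choose_sub_succ {n h e t : ℕ} (hn : n = 2 * h + e) (ht : t < h) :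
    (n.choose (h - (t + 1)) : ℝ) = ((h : ℝ) - t) / (h + e + t + 1) * n.choose (h - t) := by
  obtain ⟨u, rfl⟩ : ∃ u, h = u + 1 + t := ⟨h - t - 1, by omega⟩
  have h1 := Nat.choose_succ_right_eq n u
  rw [show n - u = u + 1 + t + e + t + 1 by omega] at h1
  rw [show u + 1 + t - (t + 1) = u by omega, show u + 1 + t - t = u + 1 by omega]
  have h2 : ((n.choose (u + 1) : ℝ)) * (u + 1) = n.choose u * (u + 1 + t + e + t + 1) := by
    exact_mod_cast h1
  push_cast
  field_simp
  linear_combination -h2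

theorem weightedChoose_succ {n h e t : ℕ} (hn : n = 2 * h + e) (ht : t < h) :
    weightedChoose n h e (t + 1) = weightedRatio n h e t * weightedChoose n h e t := by
  unfold weightedChoose weightedRatio
  rw [choose_sub_succ hn ht]
  have hexp : (2 * ((t + 1 : ℕ) : ℝ) - e) ^ 2 / n =
      (8 * (t : ℝ) + 4 - 4 * e) / n + (2 * (t : ℝ) - e) ^ 2 / n := by
    push_cast
    ring
  rw [hexp, Real.rpow_add two_pos]
  ring

theorem weightedRatio_logConcave {n h e t : ℕ} (ht : t + 2 < h) :
    weightedRatio n h e (t + 2) * weightedRatio n h e t ≤ weightedRatio n h e (t + 1) ^ 2 := by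
  unfold weightedRatio
  have hexp : (2 : ℝ) ^ ((8 * ((t + 2 : ℕ) : ℝ) + 4 - 4 * e) / n) *
      (2 : ℝ) ^ ((8 * (t : ℝ) + 4 - 4 * e) / n) =
      ((2 : ℝ) ^ ((8 * ((t + 1 : ℕ) : ℝ) + 4 - 4 * e) / n)) ^ 2 := by
    rw [sq, ← Real.rpow_add two_pos, ← Real.rpow_add two_pos]
    congr 1
    push_cast
    ring
  rw [mul_mul_mul_comm, hexp, mul_pow]
  gcongr
  have ht' : (t : ℝ) + 2 < h := by exact_mod_cast ht
  rw [div_mul_div_comm, div_pow, div_le_div_iff₀ (by positivity) (by positivity)]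
  push_cast
  have he : (0 : ℝ) ≤ e := e.cast_nonneg
  have ht0 : (0 : ℝ) ≤ t := t.cast_nonneg
  have huv : ((h : ℝ) - (t + 1)) ^ 2 ≤ (h + e + (t + 1) + 1) ^ 2 :=
    pow_le_pow_left₀ (by linarith) (by linarith) 2
  nlinarith

theorem one_le_weightedRatio_three {n h e : ℕ} (hn : n = 2 * h + e) (he : e ≤ 1)
    (hlarge : 300 ≤ n) : 1 ≤ weightedRatio n h e 3 := by
  unfold weightedRatio
  have hn' : (n : ℝ) = 2 * h + e := by exact_mod_cast hn
  have he' : (e : ℝ) ≤ 1 := by exact_mod_cast he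
  have hl : (300 : ℝ) ≤ n := by exact_mod_cast hlarge
  have he0 : (0 : ℝ) ≤ e := e.cast_nonneg
  have hh : (0 : ℝ) < (h : ℝ) - 3 := by linarith
  have key : ((h : ℝ) + e + 3 + 1) / (h - 3) ≤ (2 : ℝ) ^ ((8 * (3 : ℝ) + 4 - 4 * e) / n) := by
    rw [Real.rpow_def_of_pos two_pos]
    have h1 : ((h : ℝ) + e + 3 + 1) / (h - 3) = (e + 7) / (h - 3) + 1 := by
      field_simp
      ring
    rw [h1]
    refine le_trans ?_ (Real.add_one_le_exp _)
    gcongr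
    have hlog := Real.log_two_gt_d9
    rw [← mul_div_assoc, div_le_div_iff₀ hh (by linarith)]
    have h2 : (0.693 : ℝ) * (28 - 4 * e) ≤ Real.log 2 * (8 * 3 + 4 - 4 * e) := by
      nlinarith
    refine le_trans ?_ (mul_le_mul_of_nonneg_right h2 hh.le)
    rw [hn']
    have h3 : (300 : ℝ) ≤ 2 * h + e := by linarith
    nlinarith
  rw [div_le_iff₀ hh] at key
  rw [div_mul_eq_mul_div, le_div_iff₀ (by positivity)]
  push_cast
  linarith

theorem weightedChoose_nonneg (n h e t : ℕ) : 0 ≤ weightedChoose n h e t := by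
  unfold weightedChoose
  positivity

theorem min_le_weightedChoose {n h e t : ℕ} (hn : n = 2 * h + e) (he : e ≤ 1)
    (hlarge : 300 ≤ n) (ht : 3 ≤ t) (hth : t ≤ h) :
    min (weightedChoose n h e 3) (weightedChoose n h e h) ≤ weightedChoose n h e t := by
  refine min_le_of_logConcave_ratio (r := weightedRatio n h e)
    (fun t _ _ => weightedChoose_nonneg n h e t) (fun t _ h' => weightedChoose_succ hn h')
    (fun t _ h' => ?_) (fun t _ h' => weightedRatio_logConcave h')
    (one_le_weightedRatio_three hn he hlarge) ht hth
  have h1 : (0 : ℝ) < (h : ℝ) - t := sub_pos.mpr (by exact_mod_cast h')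
  unfold weightedRatio
  positivity

theorem two_pow_div_le_weightedChoose_self {n h e : ℕ} (hn : n = 2 * h + e) (he : e ≤ 1)
    (hpos : 0 < n) : (2 : ℝ) ^ n / 16 ≤ weightedChoose n h e h := by
  unfold weightedChoose
  have hn' : (n : ℝ) = 2 * h + e := by exact_mod_cast hn
  have he' : (e : ℝ) ≤ 1 := by exact_mod_cast he
  have hl : (0 : ℝ) < n := by exact_mod_cast hpos
  have h1 : (2 : ℝ) ^ n / 16 = (2 : ℝ) ^ ((n : ℝ) - 4) := by
    rw [Real.rpow_sub two_pos, Real.rpow_natCast]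
    norm_num
  rw [h1, Nat.sub_self, Nat.choose_zero_right, Nat.cast_one, one_mul]
  refine Real.rpow_le_rpow_of_exponent_le one_le_two ?_
  rw [le_div_iff₀ hl, show 2 * (h : ℝ) - e = n - 2 * e by linarith]
  nlinarith [e.cast_nonneg (α := ℝ)]

theorem pow_mul_choose_le_choose_sub {n h e t : ℕ} (hn : n = 2 * h + e) (he : e ≤ 1)
    (hlarge : 7 ≤ n) (ht : t ≤ 3) :
    (((n : ℝ) - 7) / (n + 9)) ^ 3 * n.choose h ≤ n.choose (h - t) := by
  have hn' : (n : ℝ) = 2 * h + e := by exact_mod_cast hn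
  have he' : (e : ℝ) ≤ 1 := by exact_mod_cast he
  have hl : (7 : ℝ) ≤ n := by exact_mod_cast hlarge
  have he0 : (0 : ℝ) ≤ e := e.cast_nonneg
  set x : ℝ := ((n : ℝ) - 7) / (n + 9) with hx
  have hx0 : 0 ≤ x := div_nonneg (by linarith) (by linarith)
  have hx1 : x ≤ 1 := by
    rw [hx, div_le_one (by linarith)]
    linarith
  have main : ∀ t : ℕ, t ≤ 3 → x ^ t * n.choose h ≤ n.choose (h - t) := by
    intro t
    induction t with
    | zero => simp
    | succ t ih =>
      intro ht
      have hih := ih (by omega)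
      have ht' : (t : ℝ) ≤ 2 := by exact_mod_cast (by omega : t ≤ 2)
      rw [choose_sub_succ hn (by omega), pow_succ', mul_assoc]
      refine mul_le_mul ?_ hih (by positivity) (div_nonneg (by linarith) (by positivity))
      rw [hx, div_le_div_iff₀ (by linarith) (by positivity), hn']
      nlinarith [t.cast_nonneg (α := ℝ)]
  refine le_trans ?_ (main t ht)
  gcongr ?_ * _
  exact pow_le_pow_of_le_one hx0 hx1 ht

/-- The estimate on the lower half, with the Gaussian factor moved to the other side. -/
theorem le_weightedChoose_div {ε : ℝ} {n h e t : ℕ} (hε : 0 < ε) (hn : n = 2 * h + e)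
    (he : e ≤ 1) (hlarge : 300 ≤ n) (hεn : 64 / ε ≤ n) (hth : t ≤ h) :
    (1 - ε) * √(2 / (π * n)) ≤ weightedChoose n h e t / 2 ^ n := by
  have hl : (300 : ℝ) ≤ n := by exact_mod_cast hlarge
  have hnear : ∀ t ≤ 3, (1 - ε) * √(2 / (π * n)) ≤ weightedChoose n h e t / 2 ^ n := by
    intro t ht
    set x : ℝ := ((n : ℝ) - 7) / (n + 9) with hx
    have hx0 : 0 ≤ x := div_nonneg (by linarith) (by linarith)
    have hx4 : 1 - ε ≤ x ^ 4 := by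
      have hb := one_add_mul_le_pow (a := x - 1) (by linarith) 4
      have hxe : x = 1 - 16 / (n + 9) := by
        rw [hx]
        field_simp
        ring
      have h64 : 64 / ((n : ℝ) + 9) ≤ ε := by
        rw [div_le_iff₀ hε] at hεn
        rw [div_le_iff₀ (by positivity)]
        nlinarith
      have h16 : 64 / ((n : ℝ) + 9) = 4 * (16 / (n + 9)) := by ring
      rw [add_sub_cancel] at hb
      push_cast at hb
      linarith
    have hsqrt : x * √(2 / (π * n)) ≤ √(2 / (π * (n + 2))) := by
      refine Real.le_sqrt_of_sq_le ?_
      rw [mul_pow, Real.sq_sqrt (by positivity)]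
      have hx2 : x ^ 2 ≤ n / (n + 2) := by
        have hx1 : x ≤ n / (n + 2) := by
          rw [hx, div_le_div_iff₀ (by linarith) (by linarith)]
          nlinarith
        have hx1' : x ≤ 1 := by
          rw [hx, div_le_one (by linarith)]
          linarith
        nlinarith
      calc x ^ 2 * (2 / (π * n)) ≤ n / (n + 2) * (2 / (π * n)) := by gcongr
        _ = 2 / (π * (n + 2)) := by
          field_simp
    have hhalf := sqrt_le_choose_half_div n
    rw [show n / 2 = h by omega] at hhalf
    have hsub := pow_mul_choose_le_choose_sub hn he (by omega) ht
    have hw : (n.choose (h - t) : ℝ) ≤ weightedChoose n h e t := by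
      unfold weightedChoose
      exact le_mul_of_one_le_right (by positivity)
        (Real.one_le_rpow one_le_two (by positivity))
    calc (1 - ε) * √(2 / (π * n)) ≤ x ^ 4 * √(2 / (π * n)) := by gcongr
      _ = x ^ 3 * (x * √(2 / (π * n))) := by ring
      _ ≤ x ^ 3 * (n.choose h / 2 ^ n) := by
        gcongr
        exact hsqrt.trans hhalf
      _ = x ^ 3 * n.choose h / 2 ^ n := by ring
      _ ≤ weightedChoose n h e t / 2 ^ n := by
        gcongr
        exact hsub.trans hw
  rcases le_total t 3 with ht | ht
  · exact hnear t ht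
  rcases min_le_iff.mp (min_le_weightedChoose hn he hlarge ht hth) with hm | hm
  · refine (hnear 3 le_rfl).trans ?_
    gcongr
  · have hend := (two_pow_div_le_weightedChoose_self hn he (by omega)).trans hm
    have h16 : (1 : ℝ) / 16 ≤ weightedChoose n h e t / 2 ^ n := by
      rw [le_div_iff₀ (by positivity)]
      linarith
    have hs : √(2 / (π * n)) ≤ 1 / 16 := by
      refine Real.sqrt_le_iff.mpr ⟨by norm_num, ?_⟩
      rw [div_le_iff₀ (by positivity)]
      nlinarith [Real.pi_gt_three]
    have hs0 := Real.sqrt_nonneg (2 / (π * n))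
    nlinarith


/-- For every `ε > 0` there is `n₀` such that for all `n ≥ n₀` and every integer `c` with
`-⌊n/2⌋ ≤ c ≤ ⌈n/2⌉`, a binomial random variable `S(n,1/2)` satisfies
`P(S(n,1/2) = ⌊n/2⌋ + c) = C(n,⌊n/2⌋+c)/2ⁿ ≥ (1-ε)·2^{-4(c+{n/2})²/n}·√(2/(πn))`,
where `{x} = x - ⌊x⌋` is the fractional part. -/
theorem binomial_pointwise_lower_bound :
    ∀ ε : ℝ, 0 < ε → ∃ n₀ : ℕ, ∀ n : ℕ, n₀ ≤ n → ∀ c : ℤ,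
      -((n / 2 : ℕ) : ℤ) ≤ c → c ≤ (((n + 1) / 2 : ℕ) : ℤ) →
      (1 - ε) * (2 : ℝ) ^ (-(4 * ((c : ℝ) + Int.fract ((n : ℝ) / 2)) ^ 2) / n) *
          Real.sqrt (2 / (Real.pi * n)) ≤
        (n.choose (((n / 2 : ℕ) : ℤ) + c).toNat : ℝ) / 2 ^ n := by
  intro ε hε
  refine ⟨max 300 ⌈64 / ε⌉₊, fun n hn c hc1 hc2 => ?_⟩
  have hlarge : 300 ≤ n := (le_max_left _ _).trans hn
  have hεn : 64 / ε ≤ n :=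
    (Nat.le_ceil _).trans (by exact_mod_cast (le_max_right _ _).trans hn)
  obtain ⟨h, e, hne, he⟩ : ∃ h e : ℕ, n = 2 * h + e ∧ e ≤ 1 :=
    ⟨n / 2, n % 2, by omega, by omega⟩
  have hfract : Int.fract ((n : ℝ) / 2) = e / 2 := by
    have he' : (e : ℝ) ≤ 1 := by exact_mod_cast he
    rw [Int.fract_eq_iff]
    refine ⟨by positivity, by linarith, h, ?_⟩
    rw [hne]
    push_cast
    ring
  have hn0 : (0 : ℝ) < n := by exact_mod_cast (by omega : 0 < n)
  rw [hfract, show n / 2 = h by omega]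
  rw [show n / 2 = h by omega] at hc1
  obtain ⟨t, hth, hchoose, hsq⟩ : ∃ t : ℕ, t ≤ h ∧
      n.choose ((h : ℤ) + c).toNat = n.choose (h - t) ∧
      (2 * (t : ℝ) - e) ^ 2 ≤ 4 * ((c : ℝ) + e / 2) ^ 2 := by
    rcases le_or_gt c 0 with hc | hc
    · refine ⟨(-c).toNat, by omega, by congr 1; omega, le_of_eq ?_⟩
      have h1 : (((-c).toNat : ℕ) : ℝ) = -c := by
        exact_mod_cast Int.toNat_of_nonneg (by omega : 0 ≤ -c)
      rw [h1]
      ring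
    · refine ⟨(c - e).toNat, by omega, Nat.choose_symm_of_eq_add (by omega), ?_⟩
      have h1 : (((c - e).toNat : ℕ) : ℝ) = c - e := by
        exact_mod_cast Int.toNat_of_nonneg (by omega : 0 ≤ c - e)
      have h2 : (1 : ℝ) ≤ c := by exact_mod_cast hc
      have h3 : (e : ℝ) ≤ 1 := by exact_mod_cast he
      rw [h1]
      nlinarith [e.cast_nonneg (α := ℝ)]
  rw [hchoose]
  have key := le_weightedChoose_div hε hne he hlarge hεn hth
  unfold weightedChoose at key
  set E : ℝ := 4 * ((c : ℝ) + e / 2) ^ 2 / n with hE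
  have hpow : (2 : ℝ) ^ ((2 * (t : ℝ) - e) ^ 2 / n) ≤ 2 ^ E :=
    Real.rpow_le_rpow_of_exponent_le one_le_two (by rw [hE]; gcongr)
  rw [neg_div, ← hE, Real.rpow_neg two_pos.le]
  calc (1 - ε) * (2 ^ E)⁻¹ * √(2 / (π * n)) = (1 - ε) * √(2 / (π * n)) * (2 ^ E)⁻¹ := by ring
    _ ≤ n.choose (h - t) * 2 ^ E / 2 ^ n * (2 ^ E)⁻¹ := by
      gcongr
      refine key.trans ?_
      gcongr
    _ = n.choose (h - t) / 2 ^ n := by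
      field_simp
end

section
/- Let m = ⌊N/3⌋. For every sufficiently large N: if 2 ≤ k ≤ log m, then log C(⌊N/3⌋, k) ≥ 0.98·log C(N, k), where C(a,b) denotes the binomial coefficient and log the natural logarithm. -/
open Filter in
/-- Any fixed multiple of `log ⌊n/3⌋` is eventually at most `⌊n/3⌋`. -/
theorem eventually_mul_log_div_three_le (c : ℝ) :
    ∀ᶠ n : ℕ in atTop, c * Real.log ((n / 3 : ℕ) : ℝ) ≤ ((n / 3 : ℕ) : ℝ) := by
  have hlim : Tendsto (fun n : ℕ => ((n / 3 : ℕ) : ℝ)) atTop atTop :=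
    tendsto_natCast_atTop_atTop.comp (Nat.tendsto_div_const_atTop (by norm_num))
  refine hlim.eventually (p := fun x : ℝ => c * Real.log x ≤ x) ?_
  filter_upwards [(Real.isLittleO_log_id_atTop.const_mul_left c).bound one_pos,
    eventually_ge_atTop 0] with x hx hx0
  simp only [id, Real.norm_eq_abs, one_mul, abs_of_nonneg hx0] at hx
  exact (le_abs_self _).trans hx

theorem choose_le_four_pow_mul_choose {n m k : ℕ} (hn : n ≤ 3 * m + 2) (hk : 3 * k ≤ m + 1) :
    n.choose k ≤ 4 ^ k * m.choose k := by
  have hdesc : n.descFactorial k ≤ 4 ^ k * m.descFactorial k := by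
    induction k with
    | zero => simp
    | succ k ih =>
      rw [Nat.descFactorial_succ, Nat.descFactorial_succ]
      calc (n - k) * n.descFactorial k
          ≤ (4 * (m - k)) * (4 ^ k * m.descFactorial k) :=
            Nat.mul_le_mul (by omega) (ih (by omega))
        _ = 4 ^ (k + 1) * ((m - k) * m.descFactorial k) := by ring
  rw [Nat.descFactorial_eq_factorial_mul_choose, Nat.descFactorial_eq_factorial_mul_choose,
    mul_left_comm] at hdesc
  exact Nat.le_of_mul_le_mul_left hdesc k.factorial_pos

theorem pow_le_choose_of_mul_le {m k : ℕ} {a : ℝ} (ha : 0 ≤ a) (hkm : k ≤ m)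
    (h : (a + 1) * k ≤ m) : a ^ k ≤ (m.choose k : ℝ) := by
  have hfact : (0 : ℝ) < (k.factorial : ℝ) := by exact_mod_cast k.factorial_pos
  have hkk : (k.factorial : ℝ) ≤ (k : ℝ) ^ k := by exact_mod_cast Nat.factorial_le_pow k
  refine le_trans ?_ (Nat.pow_le_choose k m)
  rw [le_div_iff₀ hfact]
  calc a ^ k * k.factorial ≤ a ^ k * (k : ℝ) ^ k := by gcongr
    _ = (a * k) ^ k := (mul_pow _ _ _).symm
    _ ≤ ((m + 1 - k : ℕ) : ℝ) ^ k := by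
      gcongr
      rw [Nat.cast_sub (by omega)]
      push_cast
      linarith

/-- Let `m = ⌊N/3⌋`. For every sufficiently large `N`, if `2 ≤ k ≤ log m` then
`log C(⌊N/3⌋, k) ≥ 0.98 · log C(N, k)`. -/
theorem log_choose_third_small_k :
    ∃ N₀ : ℕ, ∀ N : ℕ, N₀ ≤ N → ∀ k : ℕ, 2 ≤ k → (k : ℝ) ≤ Real.log ((N / 3 : ℕ) : ℝ) →
      0.98 * Real.log ((N.choose k : ℕ) : ℝ) ≤ Real.log (((N / 3).choose k : ℕ) : ℝ) := by
  obtain ⟨N₀, hN₀⟩ := Filter.eventually_atTop.1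
    (eventually_mul_log_div_three_le (Real.exp 70 + 1))
  refine ⟨N₀, fun N hN k _ hk => ?_⟩
  have hlog := hN₀ N hN
  have hN3 : N ≤ 3 * (N / 3) + 2 := by omega
  generalize N / 3 = m at *
  have hexp : (71 : ℝ) ≤ Real.exp 70 := by linarith [Real.add_one_le_exp (70 : ℝ)]
  have hmul : (Real.exp 70 + 1) * k ≤ m :=
    (mul_le_mul_of_nonneg_left hk (by positivity)).trans hlog
  have h3k : 3 * k ≤ m := by
    have : (3 : ℝ) * k ≤ m := le_trans (by gcongr; linarith) hmul
    exact_mod_cast this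
  have hlower : 70 * (k : ℝ) ≤ Real.log (m.choose k) := by
    have := Real.log_le_log (by positivity)
      (pow_le_choose_of_mul_le (Real.exp_pos 70).le (by omega) hmul)
    rwa [Real.log_pow, Real.log_exp, mul_comm] at this
  have hpos : (0 : ℝ) < (m.choose k : ℝ) := by
    exact_mod_cast Nat.choose_pos (by omega : k ≤ m)
  have hupper : Real.log (N.choose k) ≤ k * Real.log 4 + Real.log (m.choose k) := by
    rcases Nat.eq_zero_or_pos (N.choose k) with h0 | h0
    · rw [h0, Nat.cast_zero, Real.log_zero]
      have : 0 ≤ Real.log 4 := Real.log_nonneg (by norm_num)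
      have : 0 ≤ (k : ℝ) * Real.log 4 := by positivity
      have : (0 : ℝ) ≤ 70 * k := by positivity
      linarith
    · rw [← Real.log_pow, ← Real.log_mul (by positivity) hpos.ne']
      refine Real.log_le_log (by exact_mod_cast h0) ?_
      exact_mod_cast choose_le_four_pow_mul_choose hN3 (by omega)
  have hlog4 : Real.log 4 ≤ 1.4 := by
    rw [show (4 : ℝ) = 2 ^ 2 by norm_num, Real.log_pow]
    push_cast
    linarith [Real.log_two_lt_d9]
  have : (k : ℝ) * Real.log 4 ≤ k * 1.4 := by gcongr
  linarith
end

section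
/- Let m = ⌊N/3⌋ and let 𝒮 be a finite set with 1 ≤ log₂|𝒮|. For every sufficiently large N: if log m < k ≤ N/(6·log₂|𝒮|), then log C(⌊N/3⌋, k) ≥ ((1 - 10^{-10})/3)·log C(N, k), where C(a,b) denotes the binomial coefficient and log the natural logarithm. -/
theorem Nat.choose_succ_le_choose_succ_cube {m n k : ℕ}
    (hk : (n - k) * (k + 1) ^ 2 ≤ (m - k) ^ 3) (h : n.choose k ≤ m.choose k ^ 3) :
    n.choose (k + 1) ≤ m.choose (k + 1) ^ 3 := by
  refine Nat.le_of_mul_le_mul_right (c := (k + 1) ^ 3) ?_ (by positivity)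
  calc n.choose (k + 1) * (k + 1) ^ 3
      = n.choose (k + 1) * (k + 1) * (k + 1) ^ 2 := by ring
    _ = n.choose k * ((n - k) * (k + 1) ^ 2) := by rw [Nat.choose_succ_right_eq, mul_assoc]
    _ ≤ m.choose k ^ 3 * (m - k) ^ 3 := Nat.mul_le_mul h hk
    _ = m.choose (k + 1) ^ 3 * (k + 1) ^ 3 := by
      rw [← mul_pow, ← Nat.choose_succ_right_eq, mul_pow]

theorem Nat.choose_le_choose_cube_of_succ {m n k : ℕ} (hkn : k < n)
    (hk : (m - k) ^ 3 ≤ (n - k) * (k + 1) ^ 2)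
    (h : n.choose (k + 1) ≤ m.choose (k + 1) ^ 3) :
    n.choose k ≤ m.choose k ^ 3 := by
  have hpos : 0 < n - k := Nat.sub_pos_of_lt hkn
  refine Nat.le_of_mul_le_mul_right (c := (n - k) * (k + 1) ^ 2) ?_ (by positivity)
  calc n.choose k * ((n - k) * (k + 1) ^ 2)
      = n.choose (k + 1) * (k + 1) ^ 3 := by
        rw [← mul_assoc, ← Nat.choose_succ_right_eq]; ring
    _ ≤ m.choose (k + 1) ^ 3 * (k + 1) ^ 3 := Nat.mul_le_mul_right _ h
    _ = m.choose k ^ 3 * (m - k) ^ 3 := by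
      rw [← mul_pow, Nat.choose_succ_right_eq, mul_pow]
    _ ≤ m.choose k ^ 3 * ((n - k) * (k + 1) ^ 2) := Nat.mul_le_mul_left _ hk

theorem Nat.sub_mul_succ_sq_le_of_le {n i j : ℕ} (hij : i ≤ j) (hj : 2 * j ≤ n) :
    (n - i) * (i + 1) ^ 2 ≤ (n - j) * (j + 1) ^ 2 := by
  induction j, hij using Nat.le_induction with
  | base => rfl
  | succ j _ ih =>
    refine (ih (by omega)).trans ?_
    obtain ⟨d, hd⟩ : ∃ d, n - j = d + 1 := ⟨n - j - 1, by omega⟩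
    have hd' : n - (j + 1) = d := by omega
    have hjd : j + 1 ≤ d := by omega
    rw [hd, hd']
    nlinarith

theorem Nat.two_pow_le_succ_mul_choose_half (m : ℕ) :
    2 ^ m ≤ (m + 1) * m.choose (m / 2) := by
  rw [← Nat.sum_range_choose]
  simpa using Finset.sum_le_card_nsmul (Finset.range (m + 1)) _ _
    fun i _ => Nat.choose_le_middle i m

theorem Nat.choose_le_five_fourths_pow_mul (n k : ℕ) :
    (n.choose k : ℝ) ≤ (5 / 4) ^ n * 4 ^ k := by
  rcases lt_or_ge n k with h | h
  · rw [Nat.choose_eq_zero_of_lt h, Nat.cast_zero]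
    positivity
  have hsum : (1 / 4 : ℝ) ^ k * n.choose k ≤ (1 / 4 + 1) ^ n := by
    rw [add_pow]
    simpa using Finset.single_le_sum
      (f := fun i => (1 / 4 : ℝ) ^ i * 1 ^ (n - i) * n.choose i)
      (fun i _ => by positivity) (Finset.mem_range_succ_iff.2 h)
  calc (n.choose k : ℝ) = (1 / 4 : ℝ) ^ k * n.choose k * 4 ^ k := by
        rw [mul_right_comm, ← mul_pow]; norm_num
    _ ≤ (5 / 4) ^ n * 4 ^ k := by
        norm_num at hsum ⊢
        exact hsum

theorem Nat.two_mul_succ_cube_le_two_pow {m : ℕ} (hm : 13 ≤ m) :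
    2 * (m + 1) ^ 3 ≤ 2 ^ m := by
  induction m, hm using Nat.le_induction with
  | base => norm_num
  | succ m hm ih =>
    have h : (m + 1 + 1) ^ 3 ≤ 2 * (m + 1) ^ 3 := by
      have := Nat.mul_le_mul_right m (Nat.mul_le_mul hm hm)
      nlinarith
    rw [pow_succ 2]
    linarith

theorem Nat.choose_half_le_choose_half_cube {m n : ℕ} (hm : 13 ≤ m) (hn : n ≤ 3 * m + 2) :
    n.choose (m / 2) ≤ m.choose (m / 2) ^ 3 := by
  have h₁ : (2 : ℝ) ^ m ≤ (m + 1) * m.choose (m / 2) := by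
    exact_mod_cast Nat.two_pow_le_succ_mul_choose_half m
  have h₂ : 2 * ((m : ℝ) + 1) ^ 3 ≤ 2 ^ m := by
    exact_mod_cast Nat.two_mul_succ_cube_le_two_pow hm
  have h₃ : (n.choose (m / 2) : ℝ) ≤ 2 * 4 ^ m :=
    calc (n.choose (m / 2) : ℝ) ≤ (5 / 4) ^ n * 4 ^ (m / 2) :=
          Nat.choose_le_five_fourths_pow_mul _ _
      _ ≤ (5 / 4) ^ (3 * m + 2) * 2 ^ m := by
          gcongr
          · norm_num
          · rw [show (4 : ℝ) = 2 ^ 2 by norm_num, ← pow_mul]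
            exact pow_le_pow_right₀ (by norm_num) (Nat.mul_div_le m 2)
      _ = 25 / 16 * (125 / 32) ^ m := by
          rw [pow_add, pow_mul, mul_right_comm, ← mul_pow]
          norm_num [mul_comm]
      _ ≤ 2 * 4 ^ m := by gcongr <;> norm_num
  have h₄ : (n.choose (m / 2) : ℝ) ≤ (m.choose (m / 2) : ℝ) ^ 3 := by
    refine le_of_mul_le_mul_right (a := ((m : ℝ) + 1) ^ 3) ?_ (by positivity)
    calc (n.choose (m / 2) : ℝ) * ((m : ℝ) + 1) ^ 3 ≤ 2 * 4 ^ m * ((m : ℝ) + 1) ^ 3 := by gcongr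
      _ = 4 ^ m * (2 * ((m : ℝ) + 1) ^ 3) := by ring
      _ ≤ 4 ^ m * 2 ^ m := by gcongr
      _ = (2 ^ m) ^ 3 := by rw [← mul_pow, ← pow_mul, mul_comm m, pow_mul]; norm_num
      _ ≤ (((m : ℝ) + 1) * m.choose (m / 2)) ^ 3 := by gcongr
      _ = (m.choose (m / 2) : ℝ) ^ 3 * (m + 1) ^ 3 := by ring
  exact_mod_cast h₄

/-- The ratio `C(m, k) ^ 3 / C(n, k)` is unimodal in `k`, so it suffices to bound it at the
endpoints `k = 0` and `k = m / 2`. -/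
theorem Nat.choose_le_choose_cube {m n k : ℕ} (hm : 13 ≤ m) (hmn : 3 * m ≤ n)
    (hn : n ≤ 3 * m + 2) (hk : k ≤ m / 2) : n.choose k ≤ m.choose k ^ 3 := by
  by_cases hup : ∀ j < k, (n - j) * (j + 1) ^ 2 ≤ (m - j) ^ 3
  · clear hk
    induction k with
    | zero => simp
    | succ k ih =>
      exact Nat.choose_succ_le_choose_succ_cube (hup k k.lt_succ_self)
        (ih fun j hj => hup j (hj.trans k.lt_succ_self))
  · push Not at hup
    obtain ⟨j, hjk, hj⟩ := hup
    refine Nat.decreasingInduction' (P := fun i => n.choose i ≤ m.choose i ^ 3)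
      (fun i hi hki ih => ?_) hk (Nat.choose_half_le_choose_half_cube hm hn)
    refine Nat.choose_le_choose_cube_of_succ (by omega) ?_ ih
    calc (m - i) ^ 3 ≤ (m - j) ^ 3 := Nat.pow_le_pow_left (by omega) 3
      _ ≤ (n - j) * (j + 1) ^ 2 := hj.le
      _ ≤ (n - i) * (i + 1) ^ 2 := Nat.sub_mul_succ_sq_le_of_le (by omega) (by omega)


/-- Let `m = ⌊N/3⌋` and let `𝒮` be a finite set with `1 ≤ log₂|𝒮|`. For every sufficiently
large `N`, if `log m < k ≤ N/(6 log₂|𝒮|)` then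
`log C(⌊N/3⌋, k) ≥ ((1 - 10⁻¹⁰)/3) · log C(N, k)`. -/
theorem log_choose_third_large_k :
    ∃ N₀ : ℕ, ∀ N : ℕ, N₀ ≤ N → ∀ (S : Type) [Fintype S],
      1 ≤ Real.logb 2 (Fintype.card S) →
      ∀ k : ℕ, Real.log ((N / 3 : ℕ) : ℝ) < (k : ℝ) →
        (k : ℝ) ≤ (N : ℝ) / (6 * Real.logb 2 (Fintype.card S)) →
        ((1 - 1e-10) / 3) * Real.log ((N.choose k : ℕ) : ℝ) ≤
          Real.log (((N / 3).choose k : ℕ) : ℝ) := by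
  refine ⟨39, fun N hN S _ hS k _ hk => ?_⟩
  have hkN : (k : ℝ) ≤ N / 6 :=
    hk.trans (div_le_div_of_nonneg_left (by positivity) (by norm_num) (by linarith))
  have hkN' : 6 * k ≤ N := by
    have : (6 : ℝ) * k ≤ N := by linarith
    exact_mod_cast this
  have hle : ((N.choose k : ℕ) : ℝ) ≤ (((N / 3).choose k : ℕ) : ℝ) ^ 3 := by
    exact_mod_cast Nat.choose_le_choose_cube (m := N / 3) (n := N) (k := k)
      (by omega) (by omega) (by omega) (by omega)
  have hpos : (1 : ℝ) ≤ ((N.choose k : ℕ) : ℝ) := by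
    exact_mod_cast Nat.choose_pos (show k ≤ N by omega)
  have hlog := Real.log_le_log (by linarith) hle
  rw [Real.log_pow] at hlog
  have hnonneg := Real.log_nonneg hpos
  norm_num at hlog ⊢
  linarith
end
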